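/- arXiv:1705.03367 — 2 statements merged into one kernel-verified Lean document; each statement's English description precedes it below -/
import Mathlib

section
/- Let Γ be a finite-dimensional algebra over a field with gldim Γ = n < ∞, and let T be a k-tilting Γ-module with injective dimension m. Let B = End_Γ(T)^op. Then n − k ≤ gldim B ≤ m + k. -/
/-!
Formalization of definitions from "Special tilting modules for algebras with positive
dominant dimension" (Pressland–Sauter), together with one of its statements.
-/

open CategoryTheory

noncomputable section
namespace PS

variable {R : Type} [Ring R]

/-- `N` is (isomorphic to) a direct summand of `M`. -/
def IsSummand (N M : ModuleCat.{0} R) : Prop :=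
  ∃ (ι : N →ₗ[R] M) (π : M →ₗ[R] N), π ∘ₗ ι = LinearMap.id

/-- `M` lies in `add X`: it is a direct summand of a finite direct sum of copies of `X`. -/
def MemAdd (X M : ModuleCat.{0} R) : Prop :=
  ∃ n : ℕ, IsSummand M (ModuleCat.of R (Fin n → X))

/-- `M` is projective-injective. -/
def ProjInj (M : ModuleCat.{0} R) : Prop :=
  Module.Projective R M ∧ Module.Injective R M

/-- The regular left module. -/
def reg (R : Type) [Ring R] : ModuleCat.{0} R := ModuleCat.of R R

/-- A module is basic if no nonzero module `X` has `X ⊕ X` as a direct summand of it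
(equivalently, for finite length modules, its indecomposable direct summands are pairwise
non-isomorphic). -/
def IsBasic (M : ModuleCat.{0} R) : Prop :=
  ∀ X : ModuleCat.{0} R, IsSummand (ModuleCat.of R (X × X)) M → Subsingleton X

/-- `P` is a maximal projective-injective direct summand of the regular module. -/
def IsMaxProjInjSummand (P : ModuleCat.{0} R) : Prop :=
  IsSummand P (reg R) ∧ ProjInj P ∧
    ∀ Q : ModuleCat.{0} R, IsSummand Q (reg R) → ProjInj Q → MemAdd P Q

/-- The data `Y 0 → Y 1 → ⋯ → Y n` forms an exact sequence
`0 → Y 0 → Y 1 → ⋯ → Y n → 0` (with `n ≥ 1` maps; terms beyond `Y n` are ignored). -/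
def IsExactSeq (n : ℕ) (Y : ℕ → ModuleCat.{0} R) (f : ∀ i, Y i →ₗ[R] Y (i+1)) : Prop :=
  Function.Injective (f 0) ∧ Function.Surjective (f (n-1)) ∧
    ∀ i, i + 2 ≤ n → Function.Exact (f i) (f (i+1))

/-- The algebra `R` has dominant dimension at least `k`: the regular module has an
injective resolution whose first `k` terms are projective-injective. -/
def DomdimGE (R : Type) [Ring R] (k : ℕ) : Prop :=
  ∃ (Y : ℕ → ModuleCat.{0} R) (g : reg R →ₗ[R] Y 0) (f : ∀ i, Y i →ₗ[R] Y (i+1)),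
    Function.Injective g ∧ Function.Exact g (f 0) ∧
    (∀ i, Function.Exact (f i) (f (i+1))) ∧
    (∀ i, Module.Injective R (Y i)) ∧ (∀ i, i < k → Module.Projective R (Y i))

/-- `domdim R = d`. -/
def DomdimEq (R : Type) [Ring R] (d : ℕ) : Prop :=
  DomdimGE R d ∧ ¬ DomdimGE R (d+1)

/-- The Ext group `Ext^j(M, N)` in the category of `R`-modules. -/
def ext (M N : ModuleCat.{0} R) (j : ℕ) : Type :=
  ((Ext ℤ (ModuleCat.{0} R) j).obj (Opposite.op M)).obj N

/-- `Ext^j(M, N) = 0` (for a single `j`). -/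
def ExtZero (M N : ModuleCat.{0} R) (j : ℕ) : Prop := Subsingleton (ext M N j)

/-- `Ext^j(M, N) = 0` for all `j ≥ 1`. -/
def ExtVanishing (M N : ModuleCat.{0} R) : Prop :=
  ∀ j : ℕ, 1 ≤ j → ExtZero M N j

/-- Projective dimension at most `k`. -/
def PdimLE (k : ℕ) (M : ModuleCat.{0} R) : Prop :=
  ∃ (Y : ℕ → ModuleCat.{0} R) (f : ∀ i, Y i →ₗ[R] Y (i+1)),
    IsExactSeq (k+1) Y f ∧ (∀ i, i ≤ k → Module.Projective R (Y i)) ∧ Y (k+1) = M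

/-- Injective dimension at most `k`. -/
def IdimLE (k : ℕ) (M : ModuleCat.{0} R) : Prop :=
  ∃ (Y : ℕ → ModuleCat.{0} R) (f : ∀ i, Y i →ₗ[R] Y (i+1)),
    IsExactSeq (k+1) Y f ∧ (∀ i, 1 ≤ i → i ≤ k+1 → Module.Injective R (Y i)) ∧ Y 0 = M

/-- `T` is a `k`-tilting module. -/
def IsTilting (k : ℕ) (T : ModuleCat.{0} R) : Prop :=
  Module.Finite R T ∧ PdimLE k T ∧ ExtVanishing T T ∧
    ∃ (Y : ℕ → ModuleCat.{0} R) (f : ∀ i, Y i →ₗ[R] Y (i+1)),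
      IsExactSeq (k+1) Y f ∧ Y 0 = reg R ∧ ∀ i, 1 ≤ i → i ≤ k+1 → MemAdd T (Y i)

/-- `T` is a `P`-special `k`-tilting module: it is `k`-tilting, and there is a coresolution
`0 → R → t_0 → ⋯ → t_k → 0` with all `t_j ∈ add T` and `t_j ∈ add P` for `j ≤ k-1`. -/
def IsSpecialTilting (P : ModuleCat.{0} R) (k : ℕ) (T : ModuleCat.{0} R) : Prop :=
  IsTilting k T ∧
    ∃ (Y : ℕ → ModuleCat.{0} R) (f : ∀ i, Y i →ₗ[R] Y (i+1)),
      IsExactSeq (k+1) Y f ∧ Y 0 = reg R ∧ (∀ i, 1 ≤ i → i ≤ k+1 → MemAdd T (Y i)) ∧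
        (∀ i, 1 ≤ i → i ≤ k → MemAdd P (Y i))

/-- `M ∈ gen_k(X)`: there is an exact sequence `X^k → ⋯ → X^0 → M → 0` with `X^i ∈ add X`. -/
def MemGen (k : ℕ) (X M : ModuleCat.{0} R) : Prop :=
  ∃ (Y : ℕ → ModuleCat.{0} R) (f : ∀ i, Y i →ₗ[R] Y (i+1)),
    (∀ i, i ≤ k → MemAdd X (Y i)) ∧ Y (k+1) = M ∧
    Function.Surjective (f k) ∧ ∀ i, i < k → Function.Exact (f i) (f (i+1))

/-- `M ∈ cogen^k(X)`: there is an exact sequence `0 → M → X_0 → ⋯ → X_k` with `X_i ∈ add X`. -/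
def MemCogen (k : ℕ) (X M : ModuleCat.{0} R) : Prop :=
  ∃ (Y : ℕ → ModuleCat.{0} R) (f : ∀ i, Y i →ₗ[R] Y (i+1)),
    (∀ i, 1 ≤ i → i ≤ k+1 → MemAdd X (Y i)) ∧ Y 0 = M ∧
    Function.Injective (f 0) ∧ ∀ i, i < k → Function.Exact (f i) (f (i+1))

/-- `M ∈ gen_{k-1}(X)`, where `gen_{-1}(X)` is the whole module category. -/
def MemGenShift : ℕ → ModuleCat.{0} R → ModuleCat.{0} R → Prop
  | 0, _X, _M => True
  | (k+1), X, M => MemGen k X M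

/-- `M ∈ cogen^{k-1}(X)`, where `cogen^{-1}(X)` is the whole module category. -/
def MemCogenShift : ℕ → ModuleCat.{0} R → ModuleCat.{0} R → Prop
  | 0, _X, _M => True
  | (k+1), X, M => MemCogen k X M

/-- Global dimension at most `n` (on finitely generated modules). -/
def GldimLE (R : Type) [Ring R] (n : ℕ) : Prop :=
  ∀ M : ModuleCat.{0} R, Module.Finite R M → PdimLE n M

/-- Global dimension exactly `n`. -/
def GldimEq (R : Type) [Ring R] (n : ℕ) : Prop :=
  GldimLE R n ∧ ∀ m : ℕ, GldimLE R m → n ≤ m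

section Duality

variable (K : Type) [Field K]

section DualDefs
variable (S M : Type) [Semiring S] [AddCommGroup M] [Module K M]

/-- The action of `s : S` as a `K`-linear endomorphism. -/
def actMap [Module S M] [SMulCommClass S K M] (s : S) : M →ₗ[K] M where
  toFun m := s • m
  map_add' := smul_add s
  map_smul' c m := (smul_comm s c m)

/-- The `K`-linear dual of a left `S`-module is a left `Sᵐᵒᵖ`-module (i.e. a right
`S`-module), by precomposition. -/
def dualModuleOp [Module S M] [SMulCommClass S K M] : Module Sᵐᵒᵖ (M →ₗ[K] K) where
  smul s φ := φ ∘ₗ actMap K S M s.unop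
  one_smul φ := by ext m; exact congrArg φ (one_smul S m)
  mul_smul s t φ := by ext m; exact congrArg φ (mul_smul t.unop s.unop m)
  smul_zero s := by ext m; rfl
  smul_add s φ ψ := by ext m; rfl
  add_smul s t φ := by
    ext m
    show φ ((s.unop + t.unop) • m) = φ (s.unop • m) + φ (t.unop • m)
    rw [add_smul, map_add]
  zero_smul φ := by
    ext m
    show φ ((0 : S) • m) = 0
    rw [zero_smul, map_zero]

/-- The `K`-linear dual of a right `S`-module is a left `S`-module, by precomposition. -/
def dualModuleUnop [Module Sᵐᵒᵖ M] [SMulCommClass Sᵐᵒᵖ K M] : Module S (M →ₗ[K] K) where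
  smul s φ := φ ∘ₗ actMap K Sᵐᵒᵖ M (MulOpposite.op s)
  one_smul φ := by ext m; exact congrArg φ (one_smul Sᵐᵒᵖ m)
  mul_smul s t φ := by
    ext m
    show φ (MulOpposite.op (s * t) • m) = φ (MulOpposite.op t • MulOpposite.op s • m)
    rw [← mul_smul]
    rfl
  smul_zero s := by ext m; rfl
  smul_add s φ ψ := by ext m; rfl
  add_smul s t φ := by
    ext m
    show φ ((MulOpposite.op s + MulOpposite.op t) • m)
      = φ (MulOpposite.op s • m) + φ (MulOpposite.op t • m)
    rw [add_smul, map_add]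
  zero_smul φ := by
    ext m
    show φ ((0 : Sᵐᵒᵖ) • m) = 0
    rw [zero_smul, map_zero]

end DualDefs

/-- `D R`: the `K`-linear dual of the right regular module, as a left `R`-module. -/
def Dreg (R : Type) [Ring R] [Algebra K R] : ModuleCat.{0} R :=
  letI : Module R (R →ₗ[K] K) := dualModuleUnop K R R
  ModuleCat.of R (R →ₗ[K] K)

variable {R : Type} [Ring R] [Algebra K R]

/-- The `K`-module structure on an `R`-module, via restriction of scalars. -/
def kMod (M : ModuleCat.{0} R) : Module K M := Module.compHom M (algebraMap K R)

theorem kMod_smulCommClass (M : ModuleCat.{0} R) :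
    letI := kMod K M; SMulCommClass R K M := by
  letI := kMod K M
  constructor
  intro r c m
  show r • (algebraMap K R c • m) = algebraMap K R c • (r • m)
  rw [← mul_smul, ← mul_smul, Algebra.commutes]

theorem kMod_end_smulCommClass (M : ModuleCat.{0} R) :
    letI := kMod K M; SMulCommClass (Module.End R M) K M := by
  letI := kMod K M
  constructor
  intro f c m
  show f (algebraMap K R c • m) = algebraMap K R c • f m
  rw [map_smul]

/-- The dual `D T` of a left `R`-module `T`, as a left module over `B = End_R(T)ᵒᵖ`. -/
def DT (T : ModuleCat.{0} R) : ModuleCat.{0} ((Module.End R T)ᵐᵒᵖ) :=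
  letI := kMod K T
  letI := kMod_end_smulCommClass K T
  letI : Module (Module.End R T)ᵐᵒᵖ (T →ₗ[K] K) := dualModuleOp K (Module.End R T) T
  ModuleCat.of _ (T →ₗ[K] K)

/-- `C` is a `k`-cotilting module. -/
def IsCotilting (k : ℕ) (C : ModuleCat.{0} R) : Prop :=
  Module.Finite R C ∧ IdimLE k C ∧ ExtVanishing C C ∧
    ∃ (Y : ℕ → ModuleCat.{0} R) (f : ∀ i, Y i →ₗ[R] Y (i+1)),
      IsExactSeq (k+1) Y f ∧ Y (k+1) = Dreg K R ∧ ∀ i, i ≤ k → MemAdd C (Y i)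

/-- `C` is an `I`-special `k`-cotilting module: it is `k`-cotilting, and there is a resolution
`0 → c^k → ⋯ → c^0 → D R → 0` with all `c^j ∈ add C` and `c^j ∈ add I` for `j ≤ k-1`. -/
def IsSpecialCotilting (I : ModuleCat.{0} R) (k : ℕ) (C : ModuleCat.{0} R) : Prop :=
  IsCotilting K k C ∧
    ∃ (Y : ℕ → ModuleCat.{0} R) (f : ∀ i, Y i →ₗ[R] Y (i+1)),
      IsExactSeq (k+1) Y f ∧ Y (k+1) = Dreg K R ∧ (∀ i, i ≤ k → MemAdd C (Y i)) ∧
        (∀ i, 1 ≤ i → i ≤ k → MemAdd I (Y i))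

/-- `R` is a `d`-Auslander–Gorenstein algebra: `id R ≤ d+1 ≤ domdim R`. -/
def IsAuslanderGorenstein (R : Type) [Ring R] (d : ℕ) : Prop :=
  IdimLE (d+1) (reg R) ∧ DomdimGE R (d+1)

/-- `R` is a `d`-Auslander algebra: `gldim R ≤ d+1 ≤ domdim R`. -/
def IsAuslander (R : Type) [Ring R] (d : ℕ) : Prop :=
  GldimLE R (d+1) ∧ DomdimGE R (d+1)

end Duality

/-- Injective dimension exactly `m`. -/
def IdimEq (m : ℕ) (M : ModuleCat.{0} R) : Prop :=
  IdimLE m M ∧ ∀ m' : ℕ, IdimLE m' M → m ≤ m'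

end PS
end

noncomputable section
namespace PS
namespace Aux

variable {R : Type} [Ring R]

/-- vanishing of a Yoneda Ext group -/
def E0 (M N : ModuleCat.{0} R) (i : ℕ) : Prop := ∀ e : Abelian.Ext.{0} M N i, e = 0

/-- short exact sequences of modules -/
def SES {A X C : ModuleCat.{0} R} (f : A →ₗ[R] X) (g : X →ₗ[R] C) : Prop :=
  Function.Injective f ∧ Function.Exact f g ∧ Function.Surjective g

/-- the short complex attached to a short exact sequence -/
abbrev SES.sc {A X C : ModuleCat.{0} R} {f : A →ₗ[R] X} {g : X →ₗ[R] C} (h : SES f g) :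
    ShortComplex (ModuleCat.{0} R) :=
  ShortComplex.mk (ModuleCat.ofHom f) (ModuleCat.ofHom g) (by
    ext x
    exact h.2.1.apply_apply_eq_zero x)

lemma SES.se {A X C : ModuleCat.{0} R} {f : A →ₗ[R] X} {g : X →ₗ[R] C} (h : SES f g) :
    h.sc.ShortExact :=
  ModuleCat.shortComplex_shortExact _ h.2.1 h.1 h.2.2

section
variable {A X C : ModuleCat.{0} R} {f : A →ₗ[R] X} {g : X →ₗ[R] C}

lemma SES.cov3 (h : SES f g) {M : ModuleCat.{0} R} {i : ℕ} (h1 : E0 M X i) (h2 : E0 M A (i+1)) :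
    E0 M C i := by
  intro e
  obtain ⟨x, hx⟩ := Abelian.Ext.covariant_sequence_exact₃ M h.se e (n₁ := i+1) rfl (h2 _)
  rw [← hx, show x = 0 from h1 x]
  simp

lemma SES.cov1 (h : SES f g) {M : ModuleCat.{0} R} {i : ℕ} (h1 : E0 M C i) (h2 : E0 M X (i+1)) :
    E0 M A (i+1) := by
  intro e
  obtain ⟨x, hx⟩ := Abelian.Ext.covariant_sequence_exact₁ M h.se e (h2 _) (n₀ := i) rfl
  rw [← hx, show x = 0 from h1 x]
  simp

lemma SES.cov2 (h : SES f g) {M : ModuleCat.{0} R} {i : ℕ} (h1 : E0 M A i) (h2 : E0 M C i) :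
    E0 M X i := by
  intro e
  obtain ⟨x, hx⟩ := Abelian.Ext.covariant_sequence_exact₂ M h.se e (h2 _)
  rw [← hx, show x = 0 from h1 x]
  simp

lemma SES.con1 (h : SES f g) {N : ModuleCat.{0} R} {i : ℕ} (h1 : E0 X N i) (h2 : E0 C N (i+1)) :
    E0 A N i := by
  intro e
  obtain ⟨x, hx⟩ := Abelian.Ext.contravariant_sequence_exact₁ h.se N e (n₁ := i+1)
    (add_comm _ _) (h2 _)
  rw [← hx, show x = 0 from h1 x]
  simp

lemma SES.con3 (h : SES f g) {N : ModuleCat.{0} R} {i : ℕ} (h1 : E0 A N i) (h2 : E0 X N (i+1)) :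
    E0 C N (i+1) := by
  intro e
  obtain ⟨x, hx⟩ := Abelian.Ext.contravariant_sequence_exact₃ h.se N e (h2 _) (n₀ := i)
    (add_comm _ _)
  rw [← hx, show x = 0 from h1 x]
  simp

lemma SES.extend (h : SES f g) {N : ModuleCat.{0} R} (h1 : E0 C N 1) (u : A →ₗ[R] N) :
    ∃ v : X →ₗ[R] N, v ∘ₗ f = u := by
  obtain ⟨x, hx⟩ := Abelian.Ext.contravariant_sequence_exact₁ h.se N
    (Abelian.Ext.mk₀ (ModuleCat.ofHom u)) (n₁ := 1) rfl (h1 _)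
  obtain ⟨v, rfl⟩ := Abelian.Ext.mk₀_bijective _ _ |>.2 x
  rw [Abelian.Ext.mk₀_comp_mk₀] at hx
  have := (Abelian.Ext.mk₀_bijective _ _).1 hx
  exact ⟨v.hom, congrArg ModuleCat.Hom.hom this⟩

lemma SES.lift (h : SES f g) {M : ModuleCat.{0} R} (h1 : E0 M A 1) (u : M →ₗ[R] C) :
    ∃ v : M →ₗ[R] X, g ∘ₗ v = u := by
  obtain ⟨x, hx⟩ := Abelian.Ext.covariant_sequence_exact₃ M h.se
    (Abelian.Ext.mk₀ (ModuleCat.ofHom u)) (n₁ := 1) rfl (h1 _)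
  obtain ⟨v, rfl⟩ := Abelian.Ext.mk₀_bijective _ _ |>.2 x
  rw [Abelian.Ext.mk₀_comp_mk₀] at hx
  have := (Abelian.Ext.mk₀_bijective _ _).1 hx
  exact ⟨v.hom, congrArg ModuleCat.Hom.hom this⟩

lemma SES.E0_of_lift (h : SES f g) {M : ModuleCat.{0} R} (h1 : E0 M X 1)
    (hl : ∀ u : M →ₗ[R] C, ∃ v : M →ₗ[R] X, g ∘ₗ v = u) : E0 M A 1 := by
  intro e
  obtain ⟨x, hx⟩ := Abelian.Ext.covariant_sequence_exact₁ M h.se e (h1 _) (n₀ := 0) rfl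
  obtain ⟨u, rfl⟩ := Abelian.Ext.mk₀_bijective _ _ |>.2 x
  obtain ⟨v, hv⟩ := hl u.hom
  let v' : M ⟶ h.sc.X₂ := ModuleCat.ofHom v
  have : u = v' ≫ h.sc.g := by
    ext x
    exact (LinearMap.congr_fun hv x).symm
  rw [this, ← Abelian.Ext.mk₀_comp_mk₀, Abelian.Ext.comp_assoc_of_second_deg_zero,
    ShortComplex.ShortExact.comp_extClass] at hx
  rw [← hx]; simp

end

lemma E0_src_of_sum {M M' N : ModuleCat.{0} R} {ι : Type} [Fintype ι] (p : ι → (M →ₗ[R] M'))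
    (q : ι → (M' →ₗ[R] M)) (hpq : ∑ j, q j ∘ₗ p j = LinearMap.id) {i : ℕ} (h : E0 M' N i) :
    E0 M N i := by
  intro e
  have h1 : 𝟙 M = ∑ j, ModuleCat.ofHom (p j) ≫ ModuleCat.ofHom (q j) := by
    apply ModuleCat.hom_ext
    rw [ModuleCat.hom_sum]
    exact hpq.symm
  rw [← Abelian.Ext.mk₀_id_comp e, h1, Abelian.Ext.mk₀_sum, Abelian.Ext.sum_comp]
  apply Finset.sum_eq_zero
  intro j _
  rw [← Abelian.Ext.mk₀_comp_mk₀_assoc, show (Abelian.Ext.mk₀ (ModuleCat.ofHom (q j))).comp e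
    (zero_add i) = 0 from h _]
  simp

lemma E0_tgt_of_sum {M M' N : ModuleCat.{0} R} {ι : Type} [Fintype ι] (p : ι → (M →ₗ[R] M'))
    (q : ι → (M' →ₗ[R] M)) (hpq : ∑ j, q j ∘ₗ p j = LinearMap.id) {i : ℕ} (h : E0 N M' i) :
    E0 N M i := by
  intro e
  have h1 : 𝟙 M = ∑ j, ModuleCat.ofHom (p j) ≫ ModuleCat.ofHom (q j) := by
    apply ModuleCat.hom_ext
    rw [ModuleCat.hom_sum]
    exact hpq.symm
  rw [← Abelian.Ext.comp_mk₀_id e, h1, Abelian.Ext.mk₀_sum, Abelian.Ext.comp_sum]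
  apply Finset.sum_eq_zero
  intro j _
  rw [← Abelian.Ext.mk₀_comp_mk₀, ← Abelian.Ext.comp_assoc_of_second_deg_zero,
    show e.comp (Abelian.Ext.mk₀ (ModuleCat.ofHom (p j))) (add_zero i) = 0 from h _]
  simp

lemma MemAdd.sum {T M : ModuleCat.{0} R} (h : MemAdd T M) :
    ∃ (a : ℕ) (p : Fin a → (M →ₗ[R] T)) (q : Fin a → (T →ₗ[R] M)),
      ∑ j, q j ∘ₗ p j = LinearMap.id := by
  obtain ⟨a, ι, π, hιπ⟩ := h
  refine ⟨a, fun j => LinearMap.proj j ∘ₗ ι, fun j => π ∘ₗ LinearMap.single R (fun _ => T) j, ?_⟩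
  rw [← hιπ]
  ext x
  simp only [LinearMap.coe_sum, Finset.sum_apply, LinearMap.comp_apply]
  rw [← map_sum]
  congr 1
  simp only [LinearMap.proj_apply]
  exact Finset.univ_sum_single (ι x)

lemma memAdd_pi (T : ModuleCat.{0} R) (a : ℕ) : MemAdd T (ModuleCat.of R (Fin a → T)) :=
  ⟨a, LinearMap.id, LinearMap.id, rfl⟩

lemma MemAdd.E0_src {T M N : ModuleCat.{0} R} (hm : MemAdd T M) {i : ℕ} (h : E0 T N i) :
    E0 M N i := by
  obtain ⟨a, p, q, hpq⟩ := MemAdd.sum hm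
  exact E0_src_of_sum p q hpq h

lemma MemAdd.E0_tgt {T M N : ModuleCat.{0} R} (hm : MemAdd T M) {i : ℕ} (h : E0 N T i) :
    E0 N M i := by
  obtain ⟨a, p, q, hpq⟩ := MemAdd.sum hm
  exact E0_tgt_of_sum p q hpq h

lemma E0_of_equiv_src {M M' N : ModuleCat.{0} R} (e : M ≃ₗ[R] M') {i : ℕ} (h : E0 M' N i) :
    E0 M N i :=
  E0_src_of_sum (ι := Unit) (fun _ => e.toLinearMap) (fun _ => e.symm.toLinearMap)
    (by ext; simp) h

lemma E0_of_equiv_tgt {M M' N : ModuleCat.{0} R} (e : M ≃ₗ[R] M') {i : ℕ} (h : E0 N M' i) :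
    E0 N M i :=
  E0_tgt_of_sum (ι := Unit) (fun _ => e.toLinearMap) (fun _ => e.symm.toLinearMap)
    (by ext; simp) h

lemma E0_of_projective (M N : ModuleCat.{0} R) (h : Module.Projective R M) (i : ℕ) (hi : 1 ≤ i) :
    E0 M N i := by
  intro e
  obtain ⟨i, rfl⟩ : ∃ j, i = j + 1 := ⟨i - 1, by omega⟩
  have : Projective M := inferInstance
  exact Abelian.Ext.eq_zero_of_projective e

lemma E0_of_injective (M N : ModuleCat.{0} R) (h : Module.Injective R N) (i : ℕ) (hi : 1 ≤ i) :
    E0 M N i := by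
  intro e
  obtain ⟨i, rfl⟩ : ∃ j, i = j + 1 := ⟨i - 1, by omega⟩
  have : Injective N := Module.injective_object_of_injective_module R N
  exact Abelian.Ext.eq_zero_of_injective e

/-- the derived-functor Ext and the Yoneda Ext vanish simultaneously -/
lemma E0_of_ExtZero (M N : ModuleCat.{0} R) (i : ℕ) (hi : 1 ≤ i) (h : ExtZero M N i) :
    E0 M N i := by
  intro e
  obtain ⟨i, rfl⟩ : ∃ j, i = j + 1 := ⟨i - 1, by omega⟩
  let P := projectiveResolution M
  obtain ⟨f, hf, rfl⟩ := P.extMk_surjective e (i+2) rfl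
  rw [P.extMk_eq_zero_iff f (i+2) rfl hf i rfl]
  have hz : Limits.IsZero ((P.complex.linearYonedaObj ℤ N).homology (i+1)) := by
    refine Limits.IsZero.of_iso ?_ (P.isoExt (R := ℤ) (i+1) N).symm
    have : Subsingleton (((_root_.Ext ℤ (ModuleCat.{0} R) (i+1)).obj (Opposite.op M)).obj N) := h
    exact ModuleCat.isZero_of_subsingleton _
  rw [← HomologicalComplex.exactAt_iff_isZero_homology,
    HomologicalComplex.exactAt_iff' _ i (i+1) (i+2) (by simp) (by simp),
    ShortComplex.moduleCat_exact_iff] at hz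
  obtain ⟨g, hg⟩ := hz f hf
  exact ⟨g, hg⟩

/-- projective dimension at most `d`, in terms of Ext -/
def PD (d : ℕ) (M : ModuleCat.{0} R) : Prop := ∀ i, d < i → ∀ N, E0 M N i

lemma PD.projective {M : ModuleCat.{0} R} (h : PD 0 M) : Module.Projective R M := by
  have : Projective M := projective_iff_subsingleton_ext_one.{0}.2 fun N =>
    ⟨fun a b => (h 1 (by omega) N a).trans (h 1 (by omega) N b).symm⟩
  infer_instance

lemma PD_zero_of_projective {M : ModuleCat.{0} R} (h : Module.Projective R M) : PD 0 M :=
  fun i hi N => E0_of_projective M N h i hi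

lemma PD.mono {M : ModuleCat.{0} R} {d e : ℕ} (h : PD d M) (hde : d ≤ e) : PD e M :=
  fun i hi N => h i (by omega) N

lemma SES.PD3 {A X C : ModuleCat.{0} R} {f : A →ₗ[R] X} {g : X →ₗ[R] C} (h : SES f g) {d : ℕ}
    (h1 : PD d A) (h2 : PD (d+1) X) : PD (d+1) C := by
  intro i hi N
  obtain ⟨i, rfl⟩ : ∃ j, i = j + 1 := ⟨i - 1, by omega⟩
  exact h.con3 (h1 i (by omega) N) (h2 _ hi N)

lemma SES.PD1 {A X C : ModuleCat.{0} R} {f : A →ₗ[R] X} {g : X →ₗ[R] C} (h : SES f g) {d : ℕ}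
    (h1 : PD d X) (h2 : PD (d+1) C) : PD d A := fun i hi N =>
  h.con1 (h1 i (by omega) N) (h2 _ (by omega) N)

/-! ### exact sequences -/

/-- kernel sequence of a surjection -/
lemma SES_ker {X C : ModuleCat.{0} R} (g : X →ₗ[R] C) (hg : Function.Surjective g) :
    SES (A := ModuleCat.of R (LinearMap.ker g)) (LinearMap.ker g).subtype g :=
  ⟨Subtype.val_injective, LinearMap.exact_subtype_ker_map g, hg⟩

/-- the tail of an exact sequence, starting with the cokernel of the first map -/
def tailY (Y : ℕ → ModuleCat.{0} R) (f : ∀ i, Y i →ₗ[R] Y (i+1)) : ℕ → ModuleCat.{0} R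
  | 0 => ModuleCat.of R (LinearMap.range (f 1))
  | (i+1) => Y (i+2)

/-- maps of the tail -/
def tailf (Y : ℕ → ModuleCat.{0} R) (f : ∀ i, Y i →ₗ[R] Y (i+1)) :
    ∀ i, tailY Y f i →ₗ[R] tailY Y f (i+1)
  | 0 => (LinearMap.range (f 1)).subtype
  | (i+1) => f (i+2)

lemma tail_ses {n : ℕ} {Y : ℕ → ModuleCat.{0} R} {f : ∀ i, Y i →ₗ[R] Y (i+1)}
    (h : IsExactSeq (n+2) Y f) :
    SES (A := Y 0) (X := Y 1) (C := tailY Y f 0) (f 0) (f 1).rangeRestrict := by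
  refine ⟨h.1, ?_, LinearMap.surjective_rangeRestrict _⟩
  intro y
  rw [← h.2.2 0 (by omega) y]
  exact Subtype.ext_iff

lemma tail_exact {n : ℕ} {Y : ℕ → ModuleCat.{0} R} {f : ∀ i, Y i →ₗ[R] Y (i+1)}
    (h : IsExactSeq (n+2) Y f) : IsExactSeq (n+1) (tailY Y f) (tailf Y f) := by
  refine ⟨Subtype.val_injective, ?_, ?_⟩
  · rcases n with _ | n
    · intro y
      obtain ⟨x, hx⟩ := h.2.1 y
      exact ⟨⟨y, ⟨x, hx⟩⟩, rfl⟩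
    · exact h.2.1
  · rintro (_ | i) hi
    · intro y
      refine (h.2.2 1 (by omega) y).trans ?_
      show y ∈ Set.range _ ↔ y ∈ Set.range _
      constructor
      · rintro ⟨x, hx⟩
        exact ⟨⟨f 1 x, ⟨x, rfl⟩⟩, hx⟩
      · rintro ⟨⟨_, ⟨x, rfl⟩⟩, hx⟩
        exact ⟨x, hx⟩
    · exact h.2.2 (i+2) (by omega)

/-- bijective first map for sequences of length one -/
def equivOfExactSeq {Y : ℕ → ModuleCat.{0} R} {f : ∀ i, Y i →ₗ[R] Y (i+1)}
    (h : IsExactSeq 1 Y f) : Y 0 ≃ₗ[R] Y 1 :=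
  LinearEquiv.ofBijective (f 0) ⟨h.1, h.2.1⟩

lemma PD_of_exactSeq (k : ℕ) : ∀ (d : ℕ) (Y : ℕ → ModuleCat.{0} R)
    (f : ∀ i, Y i →ₗ[R] Y (i+1)), IsExactSeq (k+1) Y f → PD d (Y 0) →
    (∀ i, 1 ≤ i → i ≤ k → Module.Projective R (Y i)) → PD (d+k) (Y (k+1)) := by
  induction k with
  | zero =>
    intro d Y f h h0 _ i hi N
    exact E0_of_equiv_src (equivOfExactSeq h).symm (h0 i hi N)
  | succ k ih =>
    intro d Y f h h0 hp
    have := ih (d+1) (tailY Y f) (tailf Y f) (tail_exact h)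
      ((tail_ses h).PD3 h0 ((PD_zero_of_projective (hp 1 le_rfl (by omega))).mono (by omega))) ?_
    · rw [show d + (k+1) = d + 1 + k by omega]
      exact this
    · rintro (_ | i) hi hi'
      · omega
      · exact hp (i+2) (by omega) (by omega)

lemma PdimLE.PD {k : ℕ} {M : ModuleCat.{0} R} (h : PdimLE k M) : PD k M := by
  obtain ⟨Y, f, hex, hp, rfl⟩ := h
  have := PD_of_exactSeq k 0 Y f hex (PD_zero_of_projective (hp 0 (by omega)))
    (fun i _ hi => hp i hi)
  rwa [zero_add] at this

lemma E0_of_idim (k : ℕ) : ∀ (Y : ℕ → ModuleCat.{0} R)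
    (f : ∀ i, Y i →ₗ[R] Y (i+1)), IsExactSeq (k+1) Y f →
    (∀ i, 1 ≤ i → i ≤ k+1 → Module.Injective R (Y i)) → ∀ i, k < i → ∀ M, E0 M (Y 0) i := by
  induction k with
  | zero =>
    intro Y f h hp i hi N
    exact E0_of_equiv_tgt (equivOfExactSeq h)
      (E0_of_injective _ _ (hp 1 le_rfl (by omega)) i hi)
  | succ k ih =>
    intro Y f h hp i hi M
    obtain ⟨i, rfl⟩ : ∃ j, i = j + 1 := ⟨i - 1, by omega⟩
    refine (tail_ses h).cov1 (ih (tailY Y f) (tailf Y f) (tail_exact h) ?_ i (by omega) M)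
      (E0_of_injective _ _ (hp 1 le_rfl (by omega)) _ (by omega))
    rintro (_ | i) hi hi'
    · omega
    · exact hp (i+2) (by omega) (by omega)

/-- existence of a partial resolution with given syzygy -/
def Rel (k : ℕ) (A M : ModuleCat.{0} R) : Prop :=
  ∃ (Y : ℕ → ModuleCat.{0} R) (f : ∀ i, Y i →ₗ[R] Y (i+1)),
    IsExactSeq (k+1) Y f ∧ (∀ i, 1 ≤ i → i ≤ k → Module.Projective R (Y i)) ∧
      Y 0 = A ∧ Y (k+1) = M

lemma Rel.zero (M : ModuleCat.{0} R) : Rel 0 M M :=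
  ⟨fun _ => M, fun _ => LinearMap.id, ⟨fun _ _ h => h, fun x => ⟨x, rfl⟩, by omega⟩, by omega,
    rfl, rfl⟩

/-- extension of a sequence to the left -/
def consY (A P : ModuleCat.{0} R) (Y : ℕ → ModuleCat.{0} R) : ℕ → ModuleCat.{0} R
  | 0 => A
  | 1 => P
  | (i+2) => Y (i+1)

/-- maps of the extension -/
def consf {A P : ModuleCat.{0} R} {Y : ℕ → ModuleCat.{0} R} (f : ∀ i, Y i →ₗ[R] Y (i+1))
    (u : A →ₗ[R] P) (v : P →ₗ[R] Y 0) : ∀ i, consY A P Y i →ₗ[R] consY A P Y (i+1)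
  | 0 => u
  | 1 => f 0 ∘ₗ v
  | (i+2) => f (i+1)

lemma Rel.succ {k : ℕ} {A' P A M : ModuleCat.{0} R} (h : Rel k A M) {u : A' →ₗ[R] P}
    {v : P →ₗ[R] A} (huv : SES u v) (hP : Module.Projective R P) : Rel (k+1) A' M := by
  obtain ⟨Y, f, hex, hp, rfl, rfl⟩ := h
  refine ⟨consY A' P Y, consf f u v, ⟨huv.1, ?_, ?_⟩, ?_, rfl, rfl⟩
  · rcases k with _ | k
    · exact hex.2.1.comp huv.2.2
    · exact hex.2.1
  · rintro (_ | _ | i) hi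
    · intro y
      refine Iff.trans ?_ (huv.2.1 y)
      exact map_eq_zero_iff (f 0) hex.1
    · intro y
      refine (hex.2.2 0 (by omega) y).trans ?_
      show y ∈ Set.range _ ↔ y ∈ Set.range _
      constructor
      · rintro ⟨x, hx⟩
        obtain ⟨z, rfl⟩ := huv.2.2 x
        exact ⟨z, hx⟩
      · rintro ⟨x, hx⟩
        exact ⟨v x, hx⟩
    · exact hex.2.2 (i+1) (by omega)
  · rintro (_ | _ | i) hi hi'
    · omega
    · exact hP
    · exact hp (i+1) (by omega) (by omega)

lemma exists_proj_ses (M : ModuleCat.{0} R) : ∃ (A P : ModuleCat.{0} R) (u : A →ₗ[R] P)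
    (v : P →ₗ[R] M), SES u v ∧ Module.Projective R P :=
  ⟨_, ModuleCat.of R (M →₀ R), _, _, SES_ker (X := ModuleCat.of R (M →₀ R))
    (Finsupp.linearCombination R (id : M → M)) (Finsupp.linearCombination_id_surjective R M),
    inferInstanceAs (Module.Projective R (M →₀ R))⟩

lemma exists_rel (M : ModuleCat.{0} R) (k : ℕ) :
    ∃ A, Rel k A M ∧ ∀ d, PD (d+k) M → PD d A := by
  induction k with
  | zero => exact ⟨M, Rel.zero M, fun d h => h⟩
  | succ k ih =>
    obtain ⟨A, hA, hd⟩ := ih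
    obtain ⟨A', P, u, v, huv, hP⟩ := exists_proj_ses A
    refine ⟨A', hA.succ huv hP, fun d h => huv.PD1 ((PD_zero_of_projective hP).mono (by omega))
      (hd (d+1) ?_)⟩
    rwa [show d + 1 + k = d + (k+1) by omega]

lemma PD.PdimLE {k : ℕ} {M : ModuleCat.{0} R} (h : PD k M) : PdimLE k M := by
  obtain ⟨A, ⟨Y, f, hex, hp, h0, h1⟩, hd⟩ := exists_rel M k
  refine ⟨Y, f, hex, ?_, h1⟩
  rintro (_ | i) hi
  · rw [h0]
    exact (hd 0 (by rwa [zero_add])).projective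
  · exact hp _ (by omega) hi

/-- finite coresolutions by `add T` -/
def Cores (T : ModuleCat.{0} R) : ℕ → ModuleCat.{0} R → Prop
  | 0, C => MemAdd T C
  | (s+1), C => ∃ (t C' : ModuleCat.{0} R) (u : C →ₗ[R] t) (v : t →ₗ[R] C'),
      SES u v ∧ MemAdd T t ∧ Cores T s C'

lemma cores_of_exactSeq (T : ModuleCat.{0} R) (k : ℕ) : ∀ (Y : ℕ → ModuleCat.{0} R)
    (f : ∀ i, Y i →ₗ[R] Y (i+1)), IsExactSeq (k+1) Y f →
    (∀ i, 1 ≤ i → i ≤ k+1 → MemAdd T (Y i)) → Cores T k (Y 0) := by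
  induction k with
  | zero =>
    intro Y f h hm
    obtain ⟨a, ι, π, hh⟩ := hm 1 le_rfl le_rfl
    let e := equivOfExactSeq h
    refine ⟨a, ι ∘ₗ e.toLinearMap, e.symm.toLinearMap ∘ₗ π, ?_⟩
    ext x
    have := LinearMap.congr_fun hh (e x)
    simp only [LinearMap.comp_apply, LinearMap.id_apply] at this
    simp [this]
  | succ k ih =>
    intro Y f h hm
    refine ⟨_, _, _, _, tail_ses h, hm 1 le_rfl (by omega), ih _ _ (tail_exact h) ?_⟩
    rintro (_ | i) hi hi'
    · omega
    · exact hm (i+2) (by omega) (by omega)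

lemma Cores.E0 {T X : ModuleCat.{0} R} (hX : ∀ i, 1 ≤ i → E0 T X i) (s : ℕ) :
    ∀ C, Cores T s C → ∀ i, 1 ≤ i → E0 C X i := by
  induction s with
  | zero => exact fun C h i hi => MemAdd.E0_src h (hX i hi)
  | succ s ih =>
    rintro C ⟨t, C', u, v, huv, ht, hC'⟩ i hi
    exact huv.con1 (MemAdd.E0_src ht (hX i hi)) (ih C' hC' (i+1) (by omega))

end Aux
end PS
end

set_option linter.unusedVariables false
set_option linter.style.haveILetI false

noncomputable section
namespace PS
namespace Aux

section dict

variable {Γ : Type} [Ring Γ]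

/-- the abelian group of homomorphisms from `T` to `X`, to be regarded as an `End(T)ᵒᵖ`-module -/
def Hm (T : ModuleCat.{0} Γ) (X : Type) [AddCommGroup X] [Module Γ X] : Type := T →ₗ[Γ] X

instance (T : ModuleCat.{0} Γ) (X : Type) [AddCommGroup X] [Module Γ X] :
    AddCommGroup (Hm T X) := inferInstanceAs (AddCommGroup (T →ₗ[Γ] X))

instance (T : ModuleCat.{0} Γ) (X : Type) [AddCommGroup X] [Module Γ X] :
    Module (Module.End Γ T)ᵐᵒᵖ (Hm T X) where
  smul b f := LinearMap.comp (f : T →ₗ[Γ] X) b.unop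
  one_smul f := LinearMap.comp_id (f : T →ₗ[Γ] X)
  mul_smul b c f := by
    show LinearMap.comp (f : T →ₗ[Γ] X) (c.unop * b.unop) = _
    rfl
  smul_zero b := LinearMap.zero_comp _
  smul_add b f g := LinearMap.add_comp _ _ _
  add_smul b c f := LinearMap.comp_add _ _ (f : T →ₗ[Γ] X)
  zero_smul f := LinearMap.comp_zero (f : T →ₗ[Γ] X)

variable (T : ModuleCat.{0} Γ)

/-- the identification map -/
def toH {X : Type} [AddCommGroup X] [Module Γ X] (f : T →ₗ[Γ] X) : Hm T X := f

/-- the inverse identification -/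
def ofH {X : Type} [AddCommGroup X] [Module Γ X] (f : Hm T X) : T →ₗ[Γ] X := f

variable {T}
variable {X Y Z : Type} [AddCommGroup X] [Module Γ X] [AddCommGroup Y] [Module Γ Y]
  [AddCommGroup Z] [Module Γ Z]

lemma ofH_smul (b : (Module.End Γ T)ᵐᵒᵖ) (f : Hm T X) : ofH T (b • f) = ofH T f ∘ₗ b.unop := rfl

lemma ofH_add (f g : Hm T X) : ofH T (f + g) = ofH T f + ofH T g := rfl

lemma ofH_sum {ι : Type} (s : Finset ι) (f : ι → Hm T X) :
    ofH T (∑ i ∈ s, f i) = ∑ i ∈ s, ofH T (f i) := rfl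

/-- postcomposition -/
def post (d : X →ₗ[Γ] Y) : Hm T X →ₗ[(Module.End Γ T)ᵐᵒᵖ] Hm T Y where
  toFun f := toH T (d ∘ₗ ofH T f)
  map_add' f g := LinearMap.comp_add _ _ _
  map_smul' b f := rfl

lemma post_apply (d : X →ₗ[Γ] Y) (f : Hm T X) : ofH T (post d f) = d ∘ₗ ofH T f := rfl

/-- the free module as a Hom module -/
def freeEquiv (T : ModuleCat.{0} Γ) (a : ℕ) :
    (Fin a → (Module.End Γ T)ᵐᵒᵖ) ≃ₗ[(Module.End Γ T)ᵐᵒᵖ] Hm T (Fin a → T) where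
  toFun b := toH T (LinearMap.pi fun i => (b i).unop)
  invFun f := fun i => MulOpposite.op (LinearMap.proj i ∘ₗ ofH T f)
  map_add' b c := rfl
  map_smul' b c := rfl
  left_inv b := rfl
  right_inv f := rfl

lemma Hm_projective (T : ModuleCat.{0} Γ) (a : ℕ) :
    Module.Projective (Module.End Γ T)ᵐᵒᵖ (Hm T (Fin a → T)) :=
  Module.Projective.of_equiv (freeEquiv T a)

/-- full faithfulness -/
lemma exists_post {a : ℕ} (φ : Hm T (Fin a → T) →ₗ[(Module.End Γ T)ᵐᵒᵖ] Hm T X) :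
    ∃ d : (Fin a → T) →ₗ[Γ] X, φ = post d := by
  let ι : Fin a → Hm T (Fin a → T) := fun i => toH T (LinearMap.single Γ (fun _ => T) i)
  refine ⟨∑ i, ofH T (φ (ι i)) ∘ₗ LinearMap.proj i, ?_⟩
  apply LinearMap.ext
  intro f
  have hf : f = ∑ i, MulOpposite.op (LinearMap.proj i ∘ₗ ofH T f) • ι i := by
    show ofH T f = ofH T (∑ i, MulOpposite.op (LinearMap.proj i ∘ₗ ofH T f) • ι i)
    rw [ofH_sum]
    apply LinearMap.ext
    intro x
    rw [LinearMap.sum_apply]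
    exact (Finset.univ_sum_single (ofH T f x)).symm
  have h2 := congrArg φ hf
  rw [map_sum] at h2
  rw [h2]
  show ofH T (∑ i, φ (MulOpposite.op (LinearMap.proj i ∘ₗ ofH T f) • ι i)) = ofH T _
  rw [ofH_sum, post_apply]
  apply LinearMap.ext
  intro x
  simp only [LinearMap.sum_apply, LinearMap.comp_apply, map_smul, ofH_smul]
  rfl

lemma post_injective_of_free {a : ℕ} {d d' : (Fin a → T) →ₗ[Γ] X}
    (h : (post d : Hm T (Fin a → T) →ₗ[_] Hm T X) = post d') : d = d' := by
  apply LinearMap.pi_ext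
  intro i x
  have := LinearMap.congr_fun h (toH T (LinearMap.single Γ (fun _ => T) i))
  exact LinearMap.congr_fun (show d ∘ₗ _ = d' ∘ₗ _ from this) x

lemma SES_coker {R : Type} [Ring R] {X Y Z : ModuleCat.{0} R} (f : X →ₗ[R] Y) (g : Y →ₗ[R] Z)
    (h : Function.Exact f g) :
    SES (A := ModuleCat.of R (Y ⧸ LinearMap.range f)) (X := Z)
      (C := ModuleCat.of R (Z ⧸ LinearMap.range g))
      ((LinearMap.range f).liftQ g (by rw [h.linearMap_ker_eq])) (LinearMap.range g).mkQ := by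
  refine ⟨?_, ?_, Submodule.mkQ_surjective _⟩
  · rw [← LinearMap.ker_eq_bot]
    exact Submodule.ker_liftQ_eq_bot _ _ _ (by rw [h.linearMap_ker_eq])
  · rw [LinearMap.exact_iff, Submodule.ker_mkQ]
    exact (Submodule.range_liftQ _ _ _).symm

end dict

section fin

lemma noeth_ring (K : Type) [Field K] {Γ : Type} [Ring Γ] [Algebra K Γ]
    [FiniteDimensional K Γ] : IsNoetherianRing Γ := 
  isNoetherian_of_tower K inferInstance

lemma noeth_Hm (K : Type) [Field K] {Γ : Type} [Ring Γ] [Algebra K Γ]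
    [FiniteDimensional K Γ]
    (T : ModuleCat.{0} Γ) (X : Type) [AddCommGroup X] [Module Γ X]
    [Module.Finite Γ T] [Module.Finite Γ X] :
    IsNoetherian (Module.End Γ T)ᵐᵒᵖ (Hm T X) := by
  letI : Module K T := Module.compHom T (algebraMap K Γ)
  letI : Module K X := Module.compHom X (algebraMap K Γ)
  haveI : IsScalarTower K Γ T := ⟨fun c r x => by
    rw [Algebra.smul_def, mul_smul]; rfl⟩
  haveI : IsScalarTower K Γ X := ⟨fun c r x => by
    rw [Algebra.smul_def, mul_smul]; rfl⟩
  haveI : Module.Finite K T := Module.Finite.trans Γ T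
  haveI : Module.Finite K X := Module.Finite.trans Γ X
  let F : Submodule (Module.End Γ T)ᵐᵒᵖ (Hm T X) → Submodule K (T →ₗ[K] X) := fun S =>
    { carrier := {h | ∃ f ∈ S, (ofH T f).restrictScalars K = h}
      zero_mem' := ⟨0, S.zero_mem, rfl⟩
      add_mem' := by
        rintro _ _ ⟨f, hf, rfl⟩ ⟨g, hg, rfl⟩
        exact ⟨f + g, S.add_mem hf hg, rfl⟩
      smul_mem' := by
        rintro c _ ⟨f, hf, rfl⟩
        let cc : Module.End Γ T :=
          { toFun := fun x => algebraMap K Γ c • x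
            map_add' := smul_add _
            map_smul' := fun r x => by
              simp only [RingHom.id_apply, ← mul_smul, Algebra.commutes] }
        refine ⟨MulOpposite.op cc • f, S.smul_mem _ hf, ?_⟩
        ext x
        exact (ofH T f).map_smul (algebraMap K Γ c) x }
  have hF : ∀ S S', F S ≤ F S' → S ≤ S' := by
    intro S S' h f hf
    obtain ⟨g, hg, hgf⟩ := h ⟨f, hf, rfl⟩
    have : g = f := LinearMap.restrictScalars_injective K hgf
    rwa [← this]
  have hF' : ∀ S S', S ≤ S' → F S ≤ F S' := by
    rintro S S' h _ ⟨f, hf, rfl⟩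
    exact ⟨f, h hf, rfl⟩
  have hw : WellFoundedGT (Submodule K (T →ₗ[K] X)) := inferInstance
  rw [isNoetherian_iff']
  have hsm : StrictMono F := fun S S' h => ⟨hF' _ _ h.1, fun h' => h.2 (hF _ _ h')⟩
  exact hsm.wellFoundedGT

/-- finite `B`-modules are covered by `Hom(T, T^a)` -/
lemma exists_cover {Γ : Type} [Ring Γ] (T : ModuleCat.{0} Γ) (N : Type) [AddCommGroup N]
    [Module (Module.End Γ T)ᵐᵒᵖ N]
    [Module.Finite (Module.End Γ T)ᵐᵒᵖ N] :
    ∃ (a : ℕ) (π : Hm T (Fin a → T) →ₗ[(Module.End Γ T)ᵐᵒᵖ] N), Function.Surjective π := by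
  obtain ⟨a, f, hf⟩ := Module.Finite.exists_fin' (Module.End Γ T)ᵐᵒᵖ N
  exact ⟨a, f ∘ₗ (freeEquiv T a).symm.toLinearMap, hf.comp (freeEquiv T a).symm.surjective⟩

lemma exists_range (K : Type) [Field K] {Γ : Type} [Ring Γ] [Algebra K Γ]
    [FiniteDimensional K Γ]
    (T : ModuleCat.{0} Γ) [Module.Finite Γ T] (a : ℕ)
    (S : Submodule (Module.End Γ T)ᵐᵒᵖ (Hm T (Fin a → T))) :
    ∃ (b : ℕ) (d : (Fin b → T) →ₗ[Γ] (Fin a → T)), LinearMap.range (post d) = S := by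
  haveI := noeth_Hm K T (Fin a → T)
  obtain ⟨b, π, hπ⟩ := exists_cover T S
  obtain ⟨d, hd⟩ := exists_post (S.subtype ∘ₗ π)
  refine ⟨b, d, ?_⟩
  rw [← hd, LinearMap.range_comp, LinearMap.range_eq_top.2 hπ, Submodule.map_top,
    Submodule.range_subtype]

lemma exists_resolution (K : Type) [Field K] {Γ : Type} [Ring Γ] [Algebra K Γ]
    [FiniteDimensional K Γ]
    (T : ModuleCat.{0} Γ) [Module.Finite Γ T] (N : Type) [AddCommGroup N]
    [Module (Module.End Γ T)ᵐᵒᵖ N]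
    [Module.Finite (Module.End Γ T)ᵐᵒᵖ N] :
    ∃ (A : ℕ → ℕ) (d : ∀ i, (Fin (A (i+1)) → T) →ₗ[Γ] (Fin (A i) → T))
      (π : Hm T (Fin (A 0) → T) →ₗ[(Module.End Γ T)ᵐᵒᵖ] N),
      Function.Surjective π ∧ LinearMap.ker π = LinearMap.range (post (d 0)) ∧
      ∀ i, Function.Exact (post (T := T) (d (i+1))) (post (T := T) (d i)) := by
  obtain ⟨a, π, hπ⟩ := exists_cover T N
  choose b D hD using exists_range K T
  let st : ℕ → Σ a : ℕ, Submodule (Module.End Γ T)ᵐᵒᵖ (Hm T (Fin a → T)) := fun i =>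
    Nat.rec ⟨a, LinearMap.ker π⟩ (fun _ s => ⟨b s.1 s.2, LinearMap.ker (post (D s.1 s.2))⟩) i
  refine ⟨fun i => (st i).1, fun i => D (st i).1 (st i).2, π, hπ, (hD a (LinearMap.ker π)).symm, ?_⟩
  intro i
  rw [LinearMap.exact_iff]
  exact (hD (st (i+1)).1 (st (i+1)).2).symm

end fin

end Aux
end PS
end

set_option linter.unusedVariables false
set_option linter.style.haveILetI false

noncomputable section
namespace PS
namespace Aux

section upper

variable {Γ : Type} [Ring Γ] {T : ModuleCat.{0} Γ} {A : ℕ → ℕ}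

/-- the Hom complex out of `C` is exact from degree `s` on -/
def EP (d : ∀ i, (Fin (A (i+1)) → T) →ₗ[Γ] (Fin (A i) → T)) (C : ModuleCat.{0} Γ) (s : ℕ) : Prop :=
  ∀ i, s ≤ i → ∀ u : C →ₗ[Γ] (Fin (A (i+1)) → T), d i ∘ₗ u = 0 →
    ∃ v : C →ₗ[Γ] (Fin (A (i+2)) → T), d (i+1) ∘ₗ v = u

variable {d : ∀ i, (Fin (A (i+1)) → T) →ₗ[Γ] (Fin (A i) → T)}

lemma dd_zero (hd : ∀ i, Function.Exact (post (T := T) (d (i+1))) (post (T := T) (d i))) (i : ℕ) :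
    d i ∘ₗ d (i+1) = 0 := by
  apply post_injective_of_free (T := T)
  apply LinearMap.ext
  intro f
  have := (hd i).apply_apply_eq_zero f
  refine Eq.trans this ?_
  exact (LinearMap.zero_comp _).symm

lemma EP_T (hd : ∀ i, Function.Exact (post (T := T) (d (i+1))) (post (T := T) (d i))) :
    EP d T 0 := by
  intro i _ u hu
  obtain ⟨v, hv⟩ := (hd i (toH T u)).1 hu
  exact ⟨ofH T v, hv⟩

lemma EP_add (hd : ∀ i, Function.Exact (post (T := T) (d (i+1))) (post (T := T) (d i)))
    {C : ModuleCat.{0} Γ} (hC : MemAdd T C) : EP d C 0 := by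
  obtain ⟨a, p, q, hpq⟩ := MemAdd.sum hC
  intro i _ u hu
  have h1 : ∀ j, ∃ v : T →ₗ[Γ] (Fin (A (i+2)) → T), d (i+1) ∘ₗ v = u ∘ₗ q j := by
    intro j
    refine EP_T hd i (by omega) _ ?_
    rw [← LinearMap.comp_assoc, hu, LinearMap.zero_comp]
  choose v hv using h1
  refine ⟨∑ j, v j ∘ₗ p j, ?_⟩
  apply LinearMap.ext
  intro x
  have h3 := LinearMap.congr_fun hpq x
  simp only [LinearMap.sum_apply, LinearMap.comp_apply, LinearMap.id_apply] at h3
  simp only [LinearMap.sum_apply, LinearMap.comp_apply, map_sum]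
  conv_rhs => rw [← h3, map_sum]
  refine Finset.sum_congr rfl fun j _ => ?_
  exact LinearMap.congr_fun (hv j) (p j x)

lemma EP_cores (hd : ∀ i, Function.Exact (post (T := T) (d (i+1))) (post (T := T) (d i)))
    (hTT : ∀ i, 1 ≤ i → E0 T T i) (s : ℕ) :
    ∀ C : ModuleCat.{0} Γ, Cores T s C → EP d C s := by
  induction s with
  | zero => exact fun C hC => EP_add hd hC
  | succ s ih =>
    rintro C ⟨t, C', u0, v0, huv, ht, hC'⟩ i hi u hu
    obtain ⟨i, rfl⟩ : ∃ j, i = j + 1 := ⟨i - 1, by omega⟩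
    have hE : E0 C' (ModuleCat.of Γ (Fin (A (i+1+1)) → T)) 1 :=
      Cores.E0 (fun j hj => MemAdd.E0_tgt (memAdd_pi T _) (hTT j hj)) s C' hC' 1 le_rfl
    obtain ⟨u', hu'⟩ := huv.extend hE u
    have hux2 : ∀ x, u' (u0 x) = u x := fun x => LinearMap.congr_fun hu' x
    have hu2 : ∀ x, d (i+1) (u x) = 0 := fun x => LinearMap.congr_fun hu x
    -- factor `d u'` through `v0`
    obtain ⟨w, hw⟩ : ∃ w : C' →ₗ[Γ] (Fin (A (i+1)) → T), w ∘ₗ v0 = d (i+1) ∘ₗ u' := by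
      let e := (LinearMap.quotKerEquivOfSurjective v0 huv.2.2)
      refine ⟨(LinearMap.ker v0).liftQ (d (i+1) ∘ₗ u') ?_ ∘ₗ e.symm.toLinearMap, ?_⟩
      · intro x hx
        obtain ⟨y, rfl⟩ := (huv.2.1 x).1 hx
        show d (i+1) (u' (u0 y)) = 0
        rw [hux2, hu2]
      · apply LinearMap.ext
        intro x
        have : e.symm (v0 x) = (LinearMap.ker v0).mkQ x := by
          rw [LinearEquiv.symm_apply_eq]
          rfl
        simp only [LinearMap.comp_apply, LinearEquiv.coe_coe, this]
        rfl
    have hw2 : ∀ x, w (v0 x) = d (i+1) (u' x) := fun x => LinearMap.congr_fun hw x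
    obtain ⟨w', hw'⟩ := ih C' hC' i (by omega) w (by
      apply LinearMap.ext
      intro y
      obtain ⟨x, rfl⟩ := huv.2.2 y
      show d i (w (v0 x)) = 0
      rw [hw2]
      exact LinearMap.congr_fun (dd_zero hd i) (u' x))
    have hwx2 : ∀ x, d (i+1) (w' x) = w x := fun x => LinearMap.congr_fun hw' x
    obtain ⟨v, hv⟩ := EP_add hd ht (i+1) (by omega) (u' - w' ∘ₗ v0) (by
      apply LinearMap.ext
      intro x
      show d (i+1) (u' x - w' (v0 x)) = 0
      rw [map_sub, hwx2, hw2, sub_self])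
    refine ⟨v ∘ₗ u0, ?_⟩
    apply LinearMap.ext
    intro x
    have := LinearMap.congr_fun hv (u0 x)
    refine this.trans ?_
    show u' (u0 x) - w' (v0 (u0 x)) = u x
    rw [huv.2.1.apply_apply_eq_zero, map_zero, sub_zero, hux2]

lemma exact_d (hd : ∀ i, Function.Exact (post (T := T) (d (i+1))) (post (T := T) (d i)))
    (hTT : ∀ i, 1 ≤ i → E0 T T i) {k : ℕ} (hc : Cores T k (reg Γ)) (i : ℕ) (hi : k ≤ i) :
    Function.Exact (d (i+1)) (d i) := by
  intro x
  constructor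
  · intro hx
    obtain ⟨v, hv⟩ := EP_cores hd hTT k _ hc i hi (LinearMap.toSpanSingleton Γ _ x) (by
      apply LinearMap.ext
      intro r
      show d i ((show Γ from r) • x) = 0
      rw [map_smul, hx, smul_zero])
    refine ⟨v (1 : Γ), (LinearMap.congr_fun hv (1 : Γ)).trans ?_⟩
    exact one_smul Γ x
  · rintro ⟨y, rfl⟩
    exact LinearMap.congr_fun (dd_zero hd i) y

/-- the cokernels of the complex -/
abbrev Q (d : ∀ i, (Fin (A (i+1)) → T) →ₗ[Γ] (Fin (A i) → T)) (i : ℕ) : ModuleCat.{0} Γ :=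
  ModuleCat.of Γ ((Fin (A i) → T) ⧸ LinearMap.range (d i))

lemma Q_ses (i : ℕ) (h : Function.Exact (d (i+1)) (d i)) :
    ∃ f : Q d (i+1) →ₗ[Γ] (Fin (A i) → T),
    SES (A := Q d (i+1)) (X := ModuleCat.of Γ (Fin (A i) → T)) (C := Q d i) f
      (LinearMap.range (d i)).mkQ :=
  ⟨_, SES_coker (X := ModuleCat.of Γ (Fin (A (i+2)) → T)) (Y := ModuleCat.of Γ (Fin (A (i+1)) → T))
    (Z := ModuleCat.of Γ (Fin (A i) → T)) (d (i+1)) (d i) h⟩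

lemma E0_Q_T {k m : ℕ} (hex : ∀ i, k ≤ i → Function.Exact (d (i+1)) (d i))
    (hTT : ∀ i, 1 ≤ i → E0 T T i) (hid : ∀ i, m < i → ∀ M, E0 M T i) (j : ℕ) :
    ∀ i, 1 ≤ i → m + 1 ≤ i + j → E0 (Q d (k+j)) T i := by
  induction j with
  | zero => exact fun i _ hi => hid i (by omega) _
  | succ j ih =>
    intro i hi hij
    obtain ⟨f, hf⟩ := Q_ses (k+j) (hex _ (by omega))
    exact hf.con1 (MemAdd.E0_src (memAdd_pi T _) (hTT i hi)) (ih (i+1) (by omega) (by omega))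

lemma E0_W_Q {k n : ℕ} (hex : ∀ i, k ≤ i → Function.Exact (d (i+1)) (d i))
    {W : ModuleCat.{0} Γ} (hW : ∀ i, 1 ≤ i → E0 W T i) (hn : PD n W) (s : ℕ) :
    ∀ l i, k ≤ l → 1 ≤ i → n < i + s → E0 W (Q d l) i := by
  induction s with
  | zero => exact fun l i _ _ hi => hn i hi _
  | succ s ih =>
    intro l i hl hi hs
    obtain ⟨f, hf⟩ := Q_ses l (hex _ hl)
    exact hf.cov3 (MemAdd.E0_tgt (memAdd_pi T _) (hW i hi)) (ih (l+1) (i+1) (by omega) (by omega)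
      (by omega))

/-- the endomorphism splitting the complex at a late stage -/
lemma exists_psi {k m n : ℕ} [Module.Finite Γ T]
    (hd : ∀ i, Function.Exact (post (T := T) (d (i+1))) (post (T := T) (d i)))
    (hc : Cores T k (reg Γ))
    (hTT : ∀ i, 1 ≤ i → E0 T T i) (hid : ∀ i, m < i → ∀ M, E0 M T i)
    (hgl : ∀ M : ModuleCat.{0} Γ, Module.Finite Γ M → PD n M) :
    ∃ ψ : (Fin (A (k+m)) → T) →ₗ[Γ] (Fin (A (k+m)) → T), ψ ∘ₗ d (k+m) = 0 ∧
      ∀ u : T →ₗ[Γ] (Fin (A (k+m)) → T), ∃ v : T →ₗ[Γ] (Fin (A (k+m+1)) → T),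
        u - ψ ∘ₗ u = d (k+m) ∘ₗ v := by
  have hex := exact_d hd hTT hc
  have hW : E0 (Q d (k+m)) (Q d (k+m+1)) 1 := E0_W_Q hex (W := Q d (k+m)) (n := n)
    (fun i hi => E0_Q_T hex hTT hid m i hi (by omega)) (hgl _ inferInstance) n _ _ (by omega)
    le_rfl (by omega)
  have hT1 : E0 T (Q d (k+m+2)) 1 := E0_W_Q hex (W := T) (n := n) hTT (hgl _ inferInstance) n _ _
    (by omega) le_rfl (by omega)
  obtain ⟨f, hf⟩ := Q_ses (k+m) (hex _ (by omega))
  obtain ⟨s, hs⟩ := hf.lift hW LinearMap.id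
  have hs2 : ∀ x, (LinearMap.range (d (k+m))).mkQ (s x) = x := fun x => LinearMap.congr_fun hs x
  refine ⟨s ∘ₗ (LinearMap.range (d (k+m))).mkQ, ?_, ?_⟩
  · apply LinearMap.ext
    intro x
    show s ((LinearMap.range (d (k+m))).mkQ (d (k+m) x)) = 0
    rw [show (LinearMap.range (d (k+m))).mkQ (d (k+m) x) = 0 from
      (Submodule.Quotient.mk_eq_zero _).2 ⟨x, rfl⟩, map_zero]
  · intro u
    obtain ⟨f', hf'⟩ := Q_ses (k+m+1) (hex _ (by omega))
    -- the map into `Q (k+m+1)`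
    have hmem : ∀ x : T, u x - s ((LinearMap.range (d (k+m))).mkQ (u x)) ∈
        LinearMap.range (d (k+m)) := by
      intro x
      rw [← Submodule.Quotient.mk_eq_zero]
      show (LinearMap.range (d (k+m))).mkQ _ = 0
      rw [map_sub, hs2, sub_self]
    let w : T →ₗ[Γ] LinearMap.range (d (k+m)) :=
      LinearMap.codRestrict _ (u - (s ∘ₗ (LinearMap.range (d (k+m))).mkQ) ∘ₗ u) hmem
    have hses : SES (A := Q d (k+m+2)) (X := ModuleCat.of Γ (Fin (A (k+m+1)) → T))
        (C := ModuleCat.of Γ (LinearMap.range (d (k+m)))) f' (d (k+m)).rangeRestrict := by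
      refine ⟨hf'.1, ?_, LinearMap.surjective_rangeRestrict _⟩
      intro y
      refine Iff.trans ?_ (hf'.2.1 y)
      refine Iff.trans Subtype.ext_iff ?_
      refine (hex (k+m) (by omega) y).trans ?_
      exact (Submodule.Quotient.mk_eq_zero (LinearMap.range (d (k+m+1)))).symm
    obtain ⟨v, hv⟩ := hses.lift hT1 w
    refine ⟨v, ?_⟩
    apply LinearMap.ext
    intro x
    exact (congrArg Subtype.val (LinearMap.congr_fun hv x)).symm

end upper

lemma PD_of_equiv {R : Type} [Ring R] {M M' : ModuleCat.{0} R} {e : ℕ} (h : M ≃ₗ[R] M')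
    (hM : PD e M') : PD e M := fun i hi N => E0_of_equiv_src h (hM i hi N)

lemma upper_bound (K : Type) [Field K] {Γ : Type} [Ring Γ] [Algebra K Γ]
    [FiniteDimensional K Γ] {T : ModuleCat.{0} Γ} [Module.Finite Γ T] {k m n : ℕ}
    (hc : Cores T k (reg Γ))
    (hTT : ∀ i, 1 ≤ i → E0 T T i) (hid : ∀ i, m < i → ∀ M, E0 M T i)
    (hgl : ∀ M : ModuleCat.{0} Γ, Module.Finite Γ M → PD n M) :
    GldimLE ((Module.End Γ T)ᵐᵒᵖ) (m + k) := by
  intro N hN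
  apply PD.PdimLE
  obtain ⟨A, d, π, hπ, hker, hd⟩ := exists_resolution K T N
  obtain ⟨ψ, hψ1, hψ2⟩ := exists_psi hd hc hTT hid hgl
  let B := (Module.End Γ T)ᵐᵒᵖ
  let F : ℕ → ModuleCat.{0} B := fun i => ModuleCat.of B (Hm T (Fin (A i) → T))
  let D : ∀ i, F (i+1) →ₗ[B] F i := fun i => post (d i)
  let QB : ℕ → ModuleCat.{0} B := fun i => ModuleCat.of B (F i ⧸ LinearMap.range (D i))
  have hproj : Module.Projective B (QB (k+m)) := by
    haveI := Hm_projective T (A (k+m))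
    refine Module.Projective.of_split (M := Hm T (Fin (A (k+m)) → T))
      ((LinearMap.range (D (k+m))).liftQ (post ψ) ?_) (LinearMap.range (D (k+m))).mkQ ?_
    · rintro _ ⟨x, rfl⟩
      show ψ ∘ₗ (d (k+m) ∘ₗ ofH T x) = 0
      rw [← LinearMap.comp_assoc, hψ1, LinearMap.zero_comp]
    · apply LinearMap.ext
      intro x
      obtain ⟨x, rfl⟩ := Submodule.mkQ_surjective _ x
      obtain ⟨v, hv⟩ := hψ2 (ofH T x)
      show Submodule.Quotient.mk (p := LinearMap.range (D (k+m))) (post ψ x) =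
        Submodule.Quotient.mk (p := LinearMap.range (D (k+m))) x
      refine Eq.symm ?_
      rw [Submodule.Quotient.eq]
      exact ⟨toH T v, hv.symm⟩
  have key : ∀ j i, i + j = k + m → PD j (QB i) := by
    intro j
    induction j with
    | zero =>
      intro i hi
      obtain rfl : i = k + m := by omega
      exact PD_zero_of_projective hproj
    | succ j ih =>
      intro i hi
      have hs := SES_coker (X := F (i+2)) (Y := F (i+1)) (Z := F i) (D (i+1)) (D i) (hd i)
      exact hs.PD3 (ih (i+1) (by omega))
        ((PD_zero_of_projective (Hm_projective T (A i))).mono (by omega))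
  have h0 := key (k+m) 0 (by omega)
  rw [add_comm m k]
  refine PD_of_equiv ?_ h0
  exact (LinearMap.quotKerEquivOfSurjective π hπ).symm.trans
    (Submodule.quotEquivOfEq _ _ hker)

end Aux
end PS
end

set_option linter.unusedVariables false
set_option linter.style.haveILetI false

noncomputable section
namespace PS
namespace Aux

section lower

variable {Γ : Type} [Ring Γ] {T : ModuleCat.{0} Γ}

lemma gen_of_perp {k : ℕ} (hc : Cores T k (reg Γ)) {X : ModuleCat.{0} Γ}
    (hX : ∀ i, 1 ≤ i → E0 T X i) (x : X) :
    ∃ (a : ℕ) (y : Fin a → T) (q : Fin a → (T →ₗ[Γ] X)), ∑ j, q j (y j) = x := by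
  obtain ⟨t, ht, u, v, huv⟩ : ∃ (t : ModuleCat.{0} Γ) (_ : MemAdd T t) (u : reg Γ →ₗ[Γ] t)
      (v : t →ₗ[Γ] X), v (u (1 : Γ)) = x := by
    let x' : reg Γ →ₗ[Γ] X := LinearMap.toSpanSingleton Γ X x
    have hx' : x' (1 : Γ) = x := one_smul Γ x
    rcases k with _ | k
    · exact ⟨reg Γ, hc, LinearMap.id, x', hx'⟩
    · obtain ⟨t, C', u, v, hs, ht, hC'⟩ := hc
      obtain ⟨w, hw⟩ := hs.extend (Cores.E0 hX k C' hC' 1 le_rfl) x'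
      exact ⟨t, ht, u, w, (LinearMap.congr_fun hw (1 : Γ)).trans hx'⟩
  obtain ⟨a, p, q, hpq⟩ := MemAdd.sum ht
  refine ⟨a, fun j => p j (u (1 : Γ)), fun j => v ∘ₗ q j, ?_⟩
  have h3 := LinearMap.congr_fun hpq (u (1 : Γ))
  simp only [LinearMap.sum_apply, LinearMap.comp_apply, LinearMap.id_apply] at h3
  simp only [LinearMap.comp_apply]
  rw [← map_sum, h3, huv]

lemma exists_approx (K : Type) [Field K] [Algebra K Γ]
    [FiniteDimensional K Γ] [Module.Finite Γ T] {k : ℕ} (hc : Cores T k (reg Γ))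
    {X : ModuleCat.{0} Γ} [Module.Finite Γ X] (hX : ∀ i, 1 ≤ i → E0 T X i) :
    ∃ (a : ℕ) (p : (Fin a → T) →ₗ[Γ] X), Function.Surjective p ∧
      Function.Surjective (post (T := T) p) := by
  haveI := noeth_Hm K T X
  obtain ⟨a, π, hπ⟩ := exists_cover T (Hm T X)
  obtain ⟨p, rfl⟩ := exists_post π
  refine ⟨a, p, ?_, hπ⟩
  intro x
  obtain ⟨b, y, q, hx⟩ := gen_of_perp hc hX x
  choose w hw using fun j => hπ (toH T (q j))
  refine ⟨∑ j, ofH T (w j) (y j), ?_⟩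
  rw [map_sum, ← hx]
  refine Finset.sum_congr rfl fun j _ => ?_
  exact LinearMap.congr_fun (show p ∘ₗ ofH T (w j) = q j from hw j) (y j)

lemma post_ses {A X C : ModuleCat.{0} Γ} {f : A →ₗ[Γ] X} {g : X →ₗ[Γ] C} (h : SES f g)
    (hg : Function.Surjective (post (T := T) g)) :
    SES (A := ModuleCat.of (Module.End Γ T)ᵐᵒᵖ (Hm T A)) (X := ModuleCat.of _ (Hm T X))
      (C := ModuleCat.of _ (Hm T C)) (post f) (post g) := by
  refine ⟨?_, ?_, hg⟩
  · intro u v huv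
    apply LinearMap.ext
    intro x
    exact h.1 (LinearMap.congr_fun (show f ∘ₗ ofH T u = f ∘ₗ ofH T v from huv) x)
  · intro u
    constructor
    · intro hu
      have hu2 : ∀ x, g (ofH T u x) = 0 := fun x =>
        LinearMap.congr_fun (show g ∘ₗ ofH T u = 0 from hu) x
      have hu3 : ∀ x, ofH T u x ∈ LinearMap.range f := fun x => (h.2.1 _).1 (hu2 x)
      let e := LinearEquiv.ofInjective f h.1
      refine ⟨toH T (e.symm.toLinearMap ∘ₗ LinearMap.codRestrict _ (ofH T u) hu3), ?_⟩
      apply LinearMap.ext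
      intro x
      show f (e.symm (LinearMap.codRestrict _ (ofH T u) hu3 x)) = ofH T u x
      exact congrArg Subtype.val (e.apply_symm_apply (LinearMap.codRestrict _ (ofH T u) hu3 x))
    · rintro ⟨v, rfl⟩
      apply LinearMap.ext
      intro x
      exact h.2.1.apply_apply_eq_zero (ofH T v x)

lemma key_lemma (K : Type) [Field K] [Algebra K Γ]
    [FiniteDimensional K Γ] [Module.Finite Γ T] {k : ℕ} (hc : Cores T k (reg Γ))
    (hTT : ∀ i, 1 ≤ i → E0 T T i) (hpd : PD k T) (g : ℕ) :
    ∀ X : ModuleCat.{0} Γ, Module.Finite Γ X → (∀ i, 1 ≤ i → E0 T X i) →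
      PD g (ModuleCat.of (Module.End Γ T)ᵐᵒᵖ (Hm T X)) → PD (g+k) X := by
  have hpi : ∀ a, PD k (ModuleCat.of Γ (Fin a → T)) := fun a i hi N =>
    MemAdd.E0_src (memAdd_pi T a) (hpd i hi N)
  haveI : IsNoetherianRing Γ := noeth_ring K
  induction g with
  | zero =>
    intro X hXf hX hP
    obtain ⟨a, p, hp, hpp⟩ := exists_approx K hc hX
    have hses := SES_ker (X := ModuleCat.of Γ (Fin a → T)) p hp
    have hX1 : ∀ i, 1 ≤ i → E0 T (ModuleCat.of Γ (LinearMap.ker p)) i := by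
      intro i hi
      rcases Nat.lt_or_ge 1 i with h | h
      · obtain ⟨i, rfl⟩ : ∃ j, i = j + 1 := ⟨i - 1, by omega⟩
        exact hses.cov1 (hX i (by omega)) (MemAdd.E0_tgt (memAdd_pi T a) (hTT _ hi))
      · obtain rfl : i = 1 := by omega
        refine hses.E0_of_lift (MemAdd.E0_tgt (memAdd_pi T a) (hTT _ hi)) ?_
        intro u
        obtain ⟨v, hv⟩ := hpp (toH T u)
        exact ⟨ofH T v, hv⟩
    haveI : Module.Projective (Module.End Γ T)ᵐᵒᵖ (Hm T X) := hP.projective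
    obtain ⟨σ, hσ⟩ := Module.projective_lifting_property (post (T := T) p) LinearMap.id hpp
    obtain ⟨ψ, hψ⟩ := exists_post (σ ∘ₗ post p)
    have hψp : p ∘ₗ ψ = p := by
      apply post_injective_of_free (T := T)
      apply LinearMap.ext
      intro f
      have h1 := LinearMap.congr_fun hψ f
      have h2 := LinearMap.congr_fun hσ (post p f)
      show post p (post ψ f) = post p f
      rw [← h1]
      exact h2
    have hψk : LinearMap.ker p ≤ LinearMap.ker ψ := by
      intro x hx
      obtain ⟨b, y, q, hxy⟩ := gen_of_perp hc hX1 ⟨x, hx⟩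
      have h1 : x = ∑ j, (q j (y j) : Fin a → T) := by
        have := congrArg (LinearMap.ker p).subtype hxy
        rw [map_sum] at this
        exact this.symm
      rw [LinearMap.mem_ker, h1, map_sum]
      refine Finset.sum_eq_zero fun j _ => ?_
      let f : Hm T (Fin a → T) := toH T ((LinearMap.ker p).subtype ∘ₗ q j)
      have h2 : post p f = 0 := by
        apply LinearMap.ext
        intro z
        exact (q j z).2
      have h3 := LinearMap.congr_fun hψ f
      rw [LinearMap.comp_apply, h2, map_zero] at h3
      exact (LinearMap.congr_fun (show (0 : T →ₗ[Γ] (Fin a → T)) = ψ ∘ₗ ofH T f from h3)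
        (y j)).symm
    let e := LinearMap.quotKerEquivOfSurjective p hp
    have hmem : MemAdd T X := by
      refine ⟨a, (LinearMap.ker p).liftQ ψ hψk ∘ₗ e.symm.toLinearMap, p, ?_⟩
      apply LinearMap.ext
      intro x
      obtain ⟨z, rfl⟩ := hp x
      have : e.symm (p z) = (LinearMap.ker p).mkQ z := by
        rw [LinearEquiv.symm_apply_eq]
        rfl
      show p ((LinearMap.ker p).liftQ ψ hψk (e.symm (p z))) = p z
      rw [this]
      exact LinearMap.congr_fun hψp z
    rw [zero_add]
    exact fun i hi N => MemAdd.E0_src hmem (hpd i hi N)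
  | succ g ih =>
    intro X hXf hX hP
    obtain ⟨a, p, hp, hpp⟩ := exists_approx K hc hX
    have hses := SES_ker (X := ModuleCat.of Γ (Fin a → T)) p hp
    have hX1 : ∀ i, 1 ≤ i → E0 T (ModuleCat.of Γ (LinearMap.ker p)) i := by
      intro i hi
      rcases Nat.lt_or_ge 1 i with h | h
      · obtain ⟨i, rfl⟩ : ∃ j, i = j + 1 := ⟨i - 1, by omega⟩
        exact hses.cov1 (hX i (by omega)) (MemAdd.E0_tgt (memAdd_pi T a) (hTT _ hi))
      · obtain rfl : i = 1 := by omega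
        refine hses.E0_of_lift (MemAdd.E0_tgt (memAdd_pi T a) (hTT _ hi)) ?_
        intro u
        obtain ⟨v, hv⟩ := hpp (toH T u)
        exact ⟨ofH T v, hv⟩
    have hB := post_ses hses hpp
    have h1 := ih (ModuleCat.of Γ (LinearMap.ker p))
      (inferInstanceAs (Module.Finite Γ (LinearMap.ker p))) hX1
      (hB.PD1 ((PD_zero_of_projective (Hm_projective T a)).mono (by omega)) hP)
    rw [show g + 1 + k = g + k + 1 by omega]
    exact hses.PD3 h1 ((hpi a).mono (by omega))

end lower

/-- the coextension `Hom_K(Γ, M)` -/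
def Co (K Γ M : Type) [Field K] [Ring Γ] [Algebra K Γ] [AddCommGroup M] [Module K M] : Type :=
  Γ →ₗ[K] M

section co
variable (K Γ M : Type) [Field K] [Ring Γ] [Algebra K Γ] [AddCommGroup M] [Module K M]

instance : AddCommGroup (Co K Γ M) := inferInstanceAs (AddCommGroup (Γ →ₗ[K] M))
instance : Module K (Co K Γ M) := inferInstanceAs (Module K (Γ →ₗ[K] M))

variable {K Γ M} in
/-- the underlying linear map -/
def co (φ : Co K Γ M) : Γ →ₗ[K] M := φ

instance : Module Γ (Co K Γ M) where
  smul r φ := LinearMap.comp (co φ) (LinearMap.mulRight K r)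
  one_smul φ := LinearMap.ext fun s => congrArg (co φ) (mul_one s)
  mul_smul r r' φ := LinearMap.ext fun s => congrArg (co φ) (mul_assoc s r r').symm
  smul_zero r := LinearMap.ext fun s => rfl
  smul_add r φ φ' := LinearMap.ext fun s => rfl
  add_smul r r' φ := LinearMap.ext fun s =>
    (congrArg (co φ) (mul_add s r r')).trans ((co φ).map_add _ _)
  zero_smul φ := LinearMap.ext fun s => show co φ (s * 0) = 0 from
    (congrArg (co φ) (mul_zero s)).trans ((co φ).map_zero)

instance : IsScalarTower K Γ (Co K Γ M) := ⟨fun c r φ => LinearMap.ext fun s =>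
  show co φ (s * c • r) = c • co φ (s * r) from (congrArg (co φ) (mul_smul_comm c s r)).trans ((co φ).map_smul _ _)⟩

instance [Module.Finite K Γ] [Module.Finite K M] : Module.Finite K (Co K Γ M) :=
  inferInstanceAs (Module.Finite K (Γ →ₗ[K] M))

lemma co_injective : Module.Injective Γ (Co K Γ M) where
  out X Y _ _ _ _ f hf g := by
    letI : Module K X := Module.compHom X (algebraMap K Γ)
    letI : Module K Y := Module.compHom Y (algebraMap K Γ)
    haveI : IsScalarTower K Γ X := ⟨fun c r x => by
      rw [Algebra.smul_def, mul_smul]; rfl⟩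
    haveI : IsScalarTower K Γ Y := ⟨fun c r x => by
      rw [Algebra.smul_def, mul_smul]; rfl⟩
    obtain ⟨l, hl⟩ := LinearMap.exists_leftInverse_of_injective (f.restrictScalars K)
      (LinearMap.ker_eq_bot.2 hf)
    have hl2 : ∀ x, l (f x) = x := fun x => LinearMap.congr_fun hl x
    let ev : Co K Γ M →ₗ[K] M := LinearMap.applyₗ (1 : Γ)
    have hev : ∀ (φ : Co K Γ M) (s : Γ), ev (s • φ) = (co φ) s := fun φ s =>
      congrArg (co φ) (one_mul s)
    let h0 : Y →ₗ[K] M := ev ∘ₗ g.restrictScalars K ∘ₗ l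
    let h : Y →ₗ[Γ] Co K Γ M :=
      { toFun := fun y => (h0 ∘ₗ (LinearMap.toSpanSingleton Γ Y y).restrictScalars K :
          Γ →ₗ[K] M)
        map_add' := fun y y' => LinearMap.ext fun s =>
          (congrArg h0 (smul_add s y y')).trans (h0.map_add _ _)
        map_smul' := fun r y => LinearMap.ext fun s =>
          show h0 (s • r • y) = h0 ((s * r) • y) from congrArg h0 (mul_smul s r y).symm }
    refine ⟨h, fun x => LinearMap.ext fun s => ?_⟩
    show h0 (s • f x) = co (g x) s
    rw [← hev, ← map_smul f, ← map_smul g]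
    show ev (g (l (f (s • x)))) = _
    rw [hl2]

end co

/-- enough finitely generated injectives -/
lemma exists_injective (K : Type) [Field K] {Γ : Type} [Ring Γ] [Algebra K Γ]
    [FiniteDimensional K Γ] (M : ModuleCat.{0} Γ) [Module.Finite Γ M] :
    ∃ (I : ModuleCat.{0} Γ) (f : M →ₗ[Γ] I), Module.Finite Γ I ∧ Module.Injective Γ I ∧
      Function.Injective f := by
  letI : Module K M := Module.compHom M (algebraMap K Γ)
  haveI : IsScalarTower K Γ M := ⟨fun c r x => by
    rw [Algebra.smul_def, mul_smul]; rfl⟩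
  haveI : Module.Finite K M := Module.Finite.trans Γ M
  let f : M →ₗ[Γ] Co K Γ M :=
    { toFun := fun y => ((LinearMap.toSpanSingleton Γ M y).restrictScalars K : Γ →ₗ[K] M)
      map_add' := fun y y' => LinearMap.ext fun s => smul_add s y y'
      map_smul' := fun r y => LinearMap.ext fun s =>
        show s • r • y = (s * r) • y from (mul_smul s r y).symm }
  refine ⟨ModuleCat.of Γ (Co K Γ M), f, Module.Finite.of_restrictScalars_finite K Γ (Co K Γ M),
    co_injective K Γ M, ?_⟩
  intro x y hxy
  have : (1 : Γ) • x = (1 : Γ) • y :=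
    LinearMap.congr_fun (show (LinearMap.toSpanSingleton Γ M x).restrictScalars K =
      (LinearMap.toSpanSingleton Γ M y).restrictScalars K from hxy) (1 : Γ)
  rwa [one_smul, one_smul] at this

lemma lower_bound (K : Type) [Field K] {Γ : Type} [Ring Γ] [Algebra K Γ]
    [FiniteDimensional K Γ] {T : ModuleCat.{0} Γ} [Module.Finite Γ T] {k n g : ℕ}
    (hc : Cores T k (reg Γ))
    (hTT : ∀ i, 1 ≤ i → E0 T T i) (hpd : PD k T)
    (hgl : ∀ M : ModuleCat.{0} Γ, Module.Finite Γ M → PD n M)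
    (hg : GldimLE ((Module.End Γ T)ᵐᵒᵖ) g) :
    GldimLE Γ (g + k) := by
  have key : ∀ (s : ℕ) (M : ModuleCat.{0} Γ), Module.Finite Γ M → PD (g+k+(n-s)) M := by
    intro s
    induction s with
    | zero => exact fun M hM => (hgl M hM).mono (by omega)
    | succ s ih =>
      rcases Nat.lt_or_ge s n with hs | hs
      · intro M hM
        obtain ⟨I, f, hIf, hI, hf⟩ := exists_injective K M
        have hses : SES (A := M) (X := I) (C := ModuleCat.of Γ (I ⧸ LinearMap.range f)) f
            (LinearMap.range f).mkQ := by
          refine ⟨hf, ?_, Submodule.mkQ_surjective _⟩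
          rw [LinearMap.exact_iff, Submodule.ker_mkQ]
        have h1 := ih (ModuleCat.of Γ (I ⧸ LinearMap.range f))
          (inferInstanceAs (Module.Finite Γ (I ⧸ LinearMap.range f)))
        rw [show g+k+(n-s) = g+k+(n-(s+1))+1 by omega] at h1
        haveI := noeth_Hm K T I
        have h2 : PD (g+k) I := key_lemma K hc hTT hpd g I hIf
          (fun i hi => E0_of_injective _ _ hI i hi)
          (PdimLE.PD (hg _ (inferInstanceAs (Module.Finite (Module.End Γ T)ᵐᵒᵖ (Hm T I)))))
        exact hses.PD1 (h2.mono (by omega)) h1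
      · rw [show n - (s+1) = n - s by omega]
        exact ih
  intro M hM
  apply PD.PdimLE
  have := key n M hM
  rwa [Nat.sub_self, add_zero] at this

end Aux
end PS
end

open PS in
/-- Theorem `tilt-idim`.
Let `Γ` be finite-dimensional with `gldim Γ = n < ∞`, and let `T` be a `k`-tilting `Γ`-module
with injective dimension `m`.  Let `B = End_Γ(T)ᵒᵖ`.  Then `n - k ≤ gldim B ≤ m + k`. -/
theorem statement6 (K : Type) [Field K] (Γ : Type) [Ring Γ] [Algebra K Γ]
    [FiniteDimensional K Γ] (n k m : ℕ) (hgl : GldimEq Γ n)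
    (T : ModuleCat.{0} Γ) (hT : IsTilting k T) (hid : IdimEq m T) :
    GldimLE ((Module.End Γ T)ᵐᵒᵖ) (m + k) ∧
    (∀ g : ℕ, GldimLE ((Module.End Γ T)ᵐᵒᵖ) g → n ≤ g + k) := by
  obtain ⟨hTf, hTpd, hTT, Y, f, hex, hY0, hYm⟩ := hT
  have hTT' : ∀ i, 1 ≤ i → PS.Aux.E0 T T i := fun i hi => PS.Aux.E0_of_ExtZero T T i hi (hTT i hi)
  have hc : PS.Aux.Cores T k (reg Γ) := by
    rw [← hY0]
    exact PS.Aux.cores_of_exactSeq T k Y f hex hYm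
  have hpd : PS.Aux.PD k T := PS.Aux.PdimLE.PD hTpd
  have hgl' : ∀ M : ModuleCat.{0} Γ, Module.Finite Γ M → PS.Aux.PD n M :=
    fun M hM => PS.Aux.PdimLE.PD (hgl.1 M hM)
  have hid' : ∀ i, m < i → ∀ M, PS.Aux.E0 M T i := by
    obtain ⟨Z, g, hZ, hinj, rfl⟩ := hid.1
    exact PS.Aux.E0_of_idim m Z g hZ hinj
  exact ⟨PS.Aux.upper_bound K hc hTT' hid' hgl',
    fun g hg => hgl.2 _ (PS.Aux.lower_bound K hc hTT' hpd hgl' hg)⟩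
end

section
/- Let Γ be a d-Auslander–Gorenstein finite-dimensional algebra over a field. Then the shifted and coshifted modules of Γ coincide; more precisely, T_k ≅ C^{d+1−k} for all 0 ≤ k ≤ d+1. -/
/-!
Formalization of definitions from "Special tilting modules for algebras with positive
dominant dimension" (Pressland–Sauter), together with one of its statements.
-/

open CategoryTheory

namespace PSX
open PS

/-- short name for Abelian Ext vanishing -/
def EZ {R : Type} [Ring R] (M N : ModuleCat.{0} R) (j : ℕ) : Prop :=
  Subsingleton (Abelian.Ext.{0} M N j)

theorem ez_of_extZero {R : Type} [Ring R] (M N : ModuleCat.{0} R) (j : ℕ) (hj : 1 ≤ j)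
    (h : ExtZero M N j) : EZ M N j := by
  obtain ⟨p, rfl⟩ : ∃ p, j = p + 1 := ⟨j - 1, by omega⟩
  let P : ProjectiveResolution M := ProjectiveResolution.of M
  have h1 : Limits.IsZero ((P.complex.linearYonedaObj ℤ N).homology (p+1)) := by
    refine Limits.IsZero.of_iso ?_ (P.isoExt (p+1) N).symm
    have := h
    unfold ExtZero PS.ext at this
    exact ModuleCat.isZero_of_subsingleton _
  rw [← HomologicalComplex.exactAt_iff_isZero_homology] at h1
  rw [HomologicalComplex.exactAt_iff' _ p (p+1) (p+2) (by simp) (by simp)] at h1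
  rw [ShortComplex.moduleCat_exact_iff] at h1
  refine ⟨fun a b => ?_⟩
  suffices H : ∀ a : Abelian.Ext.{0} M N (p+1), a = 0 by rw [H a, H b]
  intro a
  obtain ⟨f, hf, rfl⟩ := P.extMk_surjective a (p+2) rfl
  rw [P.extMk_eq_zero_iff _ _ _ _ p rfl]
  obtain ⟨g, hg⟩ := h1 f hf
  exact ⟨g, hg⟩

section ExtPart
variable {R : Type} [Ring R]

/-- `0 → A → B → C → 0` is exact. -/
def SES {A B C : Type} [AddCommGroup A] [AddCommGroup B] [AddCommGroup C]
    [Module R A] [Module R B] [Module R C] (f : A →ₗ[R] B) (g : B →ₗ[R] C) : Prop :=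
  Function.Injective f ∧ Function.Exact f g ∧ Function.Surjective g

/-- the short complex of a short exact sequence -/
abbrev SES.sc {A B C : ModuleCat.{0} R} {f : A →ₗ[R] B} {g : B →ₗ[R] C} (h : SES f g) :
    ShortComplex (ModuleCat.{0} R) :=
  ShortComplex.mk (ModuleCat.ofHom f) (ModuleCat.ofHom g) (by
    ext x; exact h.2.1.apply_apply_eq_zero x)

theorem SES.se {A B C : ModuleCat.{0} R} {f : A →ₗ[R] B} {g : B →ₗ[R] C} (h : SES f g) :
    h.sc.ShortExact where
  exact := (ShortComplex.ShortExact.moduleCat_exact_iff_function_exact _).2 h.2.1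
  mono_f := (ModuleCat.mono_iff_injective _).2 h.1
  epi_g := (ModuleCat.epi_iff_surjective _).2 h.2.2

theorem EZ.eq {M N : ModuleCat.{0} R} {j : ℕ} (h : EZ M N j) (a : Abelian.Ext.{0} M N j) : a = 0 :=
  @Subsingleton.elim _ h _ _

theorem EZ.mk {M N : ModuleCat.{0} R} {j : ℕ} (h : ∀ a : Abelian.Ext.{0} M N j, a = 0) : EZ M N j :=
  ⟨fun a b => by rw [h a, h b]⟩

open Abelian

variable {A B C : ModuleCat.{0} R} {f : A →ₗ[R] B} {g : B →ₗ[R] C}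

theorem ez_mid (h : SES f g) {N : ModuleCat.{0} R} {j : ℕ} (hA : EZ A N j) (hC : EZ C N j) :
    EZ B N j := by
  refine EZ.mk fun a => ?_
  obtain ⟨x, rfl⟩ := Ext.contravariant_sequence_exact₂ h.se N a (hA.eq _)
  rw [EZ.eq (M := C) hC x, Ext.comp_zero]

theorem ez_third (h : SES f g) {N : ModuleCat.{0} R} {j : ℕ} (hA : EZ A N j) (hB : EZ B N (j+1)) :
    EZ C N (j+1) := by
  refine EZ.mk fun a => ?_
  obtain ⟨x, rfl⟩ := Ext.contravariant_sequence_exact₃ h.se N a (hB.eq _) (add_comm 1 j)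
  rw [EZ.eq (M := A) hA x, Ext.comp_zero]

theorem ez_first (h : SES f g) {N : ModuleCat.{0} R} {j : ℕ} (hB : EZ B N j) (hC : EZ C N (j+1)) :
    EZ A N j := by
  refine EZ.mk fun a => ?_
  obtain ⟨x, rfl⟩ := Ext.contravariant_sequence_exact₁ h.se N a (add_comm 1 j) (hC.eq _)
  rw [EZ.eq (M := B) hB x, Ext.comp_zero]

theorem ez_extend (h : SES f g) {N : ModuleCat.{0} R} (hC : EZ C N 1) (u : A →ₗ[R] N) :
    ∃ v : B →ₗ[R] N, v ∘ₗ f = u := by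
  obtain ⟨x, hx⟩ := Ext.contravariant_sequence_exact₁ h.se N (Ext.mk₀ (ModuleCat.ofHom u))
    (add_comm 1 0) (hC.eq _)
  obtain ⟨v, rfl⟩ := (Ext.mk₀_bijective _ _).2 x
  rw [Ext.mk₀_comp_mk₀] at hx
  have := (Ext.mk₀_bijective _ _).1 hx
  exact ⟨v.hom, congrArg ModuleCat.Hom.hom this⟩

theorem ez_of_extend (h : SES f g) {N : ModuleCat.{0} R} (hB : EZ B N 1)
    (H : ∀ u : A →ₗ[R] N, ∃ v : B →ₗ[R] N, v ∘ₗ f = u) : EZ C N 1 := by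
  refine EZ.mk fun a => ?_
  obtain ⟨x, rfl⟩ := Ext.contravariant_sequence_exact₃ h.se N a (hB.eq _) (add_comm 1 0)
  obtain ⟨u, rfl⟩ := (Ext.mk₀_bijective _ _).2 x
  obtain ⟨v, hv⟩ := H u.hom
  have : u = h.sc.f ≫ ModuleCat.ofHom v := by
    ext y; exact (LinearMap.congr_fun hv y).symm
  rw [this, ← Ext.mk₀_comp_mk₀, h.se.extClass_comp_assoc]
  
theorem ezr_mid (h : SES f g) {N : ModuleCat.{0} R} {j : ℕ} (hA : EZ N A j) (hC : EZ N C j) :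
    EZ N B j := by
  refine EZ.mk fun a => ?_
  obtain ⟨x, rfl⟩ := Ext.covariant_sequence_exact₂ N h.se a (hC.eq _)
  rw [EZ.eq (N := A) hA x, Ext.zero_comp]

theorem ezr_first (h : SES f g) {N : ModuleCat.{0} R} {j : ℕ} (hC : EZ N C j) (hB : EZ N B (j+1)) :
    EZ N A (j+1) := by
  refine EZ.mk fun a => ?_
  obtain ⟨x, rfl⟩ := Ext.covariant_sequence_exact₁ N h.se a (hB.eq _) rfl
  rw [EZ.eq (N := C) hC x, Ext.zero_comp]

theorem ezr_third (h : SES f g) {N : ModuleCat.{0} R} {j : ℕ} (hB : EZ N B j) (hA : EZ N A (j+1)) :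
    EZ N C j := by
  refine EZ.mk fun a => ?_
  obtain ⟨x, rfl⟩ := Ext.covariant_sequence_exact₃ N h.se a rfl (hA.eq _)
  rw [EZ.eq (N := B) hB x, Ext.zero_comp]

theorem ez_lift (h : SES f g) {N : ModuleCat.{0} R} (hA : EZ N A 1) (u : N →ₗ[R] C) :
    ∃ v : N →ₗ[R] B, g ∘ₗ v = u := by
  obtain ⟨x, hx⟩ := Ext.covariant_sequence_exact₃ N h.se (Ext.mk₀ (ModuleCat.ofHom u))
    rfl (hA.eq _)
  obtain ⟨v, rfl⟩ := (Ext.mk₀_bijective _ _).2 x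
  rw [Ext.mk₀_comp_mk₀] at hx
  have := (Ext.mk₀_bijective _ _).1 hx
  exact ⟨v.hom, congrArg ModuleCat.Hom.hom this⟩

theorem ez_of_lift (h : SES f g) {N : ModuleCat.{0} R} (hB : EZ N B 1)
    (H : ∀ u : N →ₗ[R] C, ∃ v : N →ₗ[R] B, g ∘ₗ v = u) : EZ N A 1 := by
  refine EZ.mk fun a => ?_
  obtain ⟨x, rfl⟩ := Ext.covariant_sequence_exact₁ N h.se a (hB.eq _) rfl
  obtain ⟨u, rfl⟩ := (Ext.mk₀_bijective _ _).2 x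
  obtain ⟨v, hv⟩ := H u.hom
  have : u = ModuleCat.ofHom v ≫ h.sc.g := by
    ext y; exact (LinearMap.congr_fun hv y).symm
  rw [this, ← Ext.mk₀_comp_mk₀, Ext.comp_assoc_of_second_deg_zero, h.se.comp_extClass, Ext.comp_zero]

theorem ez_proj {P N : ModuleCat.{0} R} (hP : Module.Projective R P) (j : ℕ) : EZ P N (j+1) := by
  have : Projective P := (IsProjective.iff_projective (R := R) P).1 hP
  exact EZ.mk fun a => Ext.eq_zero_of_projective a

theorem ez_inj {P N : ModuleCat.{0} R} (hP : Module.Injective R P) (j : ℕ) : EZ N P (j+1) := by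
  have : Injective P := Module.injective_object_of_injective_module R P
  exact EZ.mk fun a => Ext.eq_zero_of_injective a

theorem ez_summ {M M' N : ModuleCat.{0} R} (h : IsSummand M M') {j : ℕ} (hM : EZ M' N j) :
    EZ M N j := by
  obtain ⟨i, p, hip⟩ := h
  refine EZ.mk fun a => ?_
  have h1 : a = (Ext.mk₀ (ModuleCat.ofHom i)).comp
      ((Ext.mk₀ (ModuleCat.ofHom p)).comp a (zero_add j)) (zero_add j) := by
    rw [Ext.mk₀_comp_mk₀_assoc, ← ModuleCat.ofHom_comp, hip]
    exact (Ext.mk₀_id_comp a).symm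
  rw [h1, hM.eq ((Ext.mk₀ (ModuleCat.ofHom p)).comp a (zero_add j)), Ext.comp_zero]

theorem ezr_summ {M M' N : ModuleCat.{0} R} (h : IsSummand M M') {j : ℕ} (hM : EZ N M' j) :
    EZ N M j := by
  obtain ⟨i, p, hip⟩ := h
  refine EZ.mk fun a => ?_
  have h1 : a = (a.comp (Ext.mk₀ (ModuleCat.ofHom i)) (add_zero j)).comp
      (Ext.mk₀ (ModuleCat.ofHom p)) (add_zero j) := by
    rw [Ext.comp_assoc_of_third_deg_zero, Ext.mk₀_comp_mk₀, ← ModuleCat.ofHom_comp, hip]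
    exact (Ext.comp_mk₀_id a).symm
  rw [h1, hM.eq (a.comp (Ext.mk₀ (ModuleCat.ofHom i)) (add_zero j)), Ext.zero_comp]

/-- the split sequence `X → X^(n+1) → X^n`. -/
theorem ses_pi (X : ModuleCat.{0} R) (n : ℕ) :
    SES (R := R) (A := X) (B := ModuleCat.of R (Fin (n+1) → X)) (C := ModuleCat.of R (Fin n → X))
     (LinearMap.single R (fun _ : Fin (n+1) => X) 0) (LinearMap.funLeft R X Fin.succ) := by
  refine ⟨fun a b h => by simpa using congrFun h 0, ?_, ?_⟩
  · intro x
    constructor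
    · intro h
      refine ⟨x 0, ?_⟩
      funext i
      refine Fin.cases ?_ (fun i => ?_) i
      · simp
      · have := congrFun h i
        simp [LinearMap.funLeft] at this
        simp [this]
        rfl
    · rintro ⟨y, rfl⟩
      funext i
      simp [LinearMap.funLeft]
      rfl
  · intro x
    refine ⟨Fin.cons 0 x, ?_⟩
    funext i
    simp [LinearMap.funLeft]

theorem ez_subsingleton {P N : ModuleCat.{0} R} [Subsingleton P] {j : ℕ} (hj : 1 ≤ j) : EZ P N j := by
  obtain ⟨p, rfl⟩ : ∃ p, j = p + 1 := ⟨j - 1, by omega⟩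
  exact ez_proj (Module.Projective.of_free) _

theorem inj_subsingleton {P : Type} [AddCommGroup P] [Module R P] [Subsingleton P] :
    Module.Injective R P :=
  ⟨fun _ _ _ _ _ _ _ _ _ => ⟨0, fun _ => Subsingleton.elim _ _⟩⟩

theorem ez_pi {M N : ModuleCat.{0} R} {j : ℕ} (hj : 1 ≤ j) (hM : EZ M N j) (n : ℕ) :
    EZ (ModuleCat.of R (Fin n → M)) N j := by
  induction n with
  | zero =>
    have : Subsingleton (ModuleCat.of R (Fin 0 → M)) := inferInstanceAs (Subsingleton (Fin 0 → M))
    exact ez_subsingleton hj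
  | succ n ih => exact ez_mid (ses_pi M n) hM ih

theorem ezr_pi {M N : ModuleCat.{0} R} {j : ℕ} (hj : 1 ≤ j) (hM : EZ N M j) (n : ℕ) :
    EZ N (ModuleCat.of R (Fin n → M)) j := by
  induction n with
  | zero =>
    have : Subsingleton (ModuleCat.of R (Fin 0 → M)) := inferInstanceAs (Subsingleton (Fin 0 → M))
    obtain ⟨p, rfl⟩ : ∃ p, j = p + 1 := ⟨j - 1, by omega⟩
    exact ez_inj inj_subsingleton _
  | succ n ih => exact ezr_mid (ses_pi M n) hM ih

theorem ez_add {M X N : ModuleCat.{0} R} {j : ℕ} (hj : 1 ≤ j) (hM : EZ M N j) (h : MemAdd M X) :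
    EZ X N j := by
  obtain ⟨n, h⟩ := h
  exact ez_summ h (ez_pi hj hM n)

theorem ezr_add {M X N : ModuleCat.{0} R} {j : ℕ} (hj : 1 ≤ j) (hM : EZ N M j) (h : MemAdd M X) :
    EZ N X j := by
  obtain ⟨n, h⟩ := h
  exact ezr_summ h (ezr_pi hj hM n)

end ExtPart
end PSX

namespace PSX
open PS

section SummPart
variable (R : Type) [Ring R]

/-- `N` is a direct summand of `M`. -/
def Summ (N M : Type) [AddCommGroup N] [AddCommGroup M] [Module R N] [Module R M] : Prop :=
  ∃ (i : N →ₗ[R] M) (p : M →ₗ[R] N), ∀ x, p (i x) = x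

/-- `M` is in `add X`. -/
def Add (X M : Type) [AddCommGroup X] [AddCommGroup M] [Module R X] [Module R M] : Prop :=
  ∃ n : ℕ, Summ R M (Fin n → X)

variable {R}
variable {L M N X A B C : Type} [AddCommGroup L] [AddCommGroup M] [AddCommGroup N] [AddCommGroup X]
  [Module R L] [Module R M] [Module R N] [Module R X] [AddCommGroup A] [AddCommGroup B]
  [Module R A] [Module R B] [AddCommGroup C] [Module R C]

theorem isSummand_iff {M N : ModuleCat.{0} R} : IsSummand N M ↔ Summ R N M := by
  constructor
  · rintro ⟨i, p, h⟩
    exact ⟨i, p, fun x => LinearMap.congr_fun h x⟩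
  · rintro ⟨i, p, h⟩
    exact ⟨i, p, LinearMap.ext h⟩

theorem memAdd_iff {M N : ModuleCat.{0} R} : MemAdd N M ↔ Add R N M := by
  constructor
  · rintro ⟨n, h⟩
    exact ⟨n, isSummand_iff.1 h⟩
  · rintro ⟨n, h⟩
    exact ⟨n, isSummand_iff.2 h⟩

theorem Summ.refl : Summ R M M := ⟨LinearMap.id, LinearMap.id, fun _ => rfl⟩

theorem Summ.of_equiv (e : M ≃ₗ[R] N) : Summ R M N :=
  ⟨e.toLinearMap, e.symm.toLinearMap, fun x => by simp⟩

theorem Summ.trans (h : Summ R L M) (h' : Summ R M N) : Summ R L N := by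
  obtain ⟨i, p, h⟩ := h
  obtain ⟨i', p', h'⟩ := h'
  exact ⟨i' ∘ₗ i, p ∘ₗ p', fun x => by simp [h, h']⟩

theorem Summ.prod_mono (h : Summ R A B) (h' : Summ R M N) : Summ R (A × M) (B × N) := by
  obtain ⟨i, p, h⟩ := h
  obtain ⟨i', p', h'⟩ := h'
  exact ⟨i.prodMap i', p.prodMap p', fun x => by simp [h, h']⟩

theorem Summ.pi_mono (h : Summ R A B) (n : ℕ) : Summ R (Fin n → A) (Fin n → B) := by
  obtain ⟨i, p, h⟩ := h
  exact ⟨i.compLeft (Fin n), p.compLeft (Fin n), fun x => by ext; simp [h]⟩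

theorem Summ.fst : Summ R A (A × B) := ⟨LinearMap.inl R A B, LinearMap.fst R A B, fun x => by simp⟩
theorem Summ.snd : Summ R B (A × B) := ⟨LinearMap.inr R A B, LinearMap.snd R A B, fun x => by simp⟩

theorem summ_submodule {p q : Submodule R M} (h : IsCompl p q) : Summ R p M :=
  ⟨p.subtype, p.projectionOnto q h, fun x => by simp⟩

theorem Summ.inj_of (h : Summ R N M) : ∃ i : N →ₗ[R] M, Function.Injective i := by
  obtain ⟨i, p, h⟩ := h
  exact ⟨i, Function.LeftInverse.injective h⟩

theorem Summ.surj_of (h : Summ R N M) : ∃ i : M →ₗ[R] N, Function.Surjective i := by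
  obtain ⟨i, p, h⟩ := h
  exact ⟨p, Function.RightInverse.surjective h⟩

theorem Summ.finite (h : Summ R N M) [Module.Finite R M] : Module.Finite R N := by
  obtain ⟨p, hp⟩ := h.surj_of
  exact Module.Finite.of_surjective p hp

theorem Summ.proj (h : Summ R N M) (hM : Module.Projective R M) : Module.Projective R N := by
  obtain ⟨i, p, h⟩ := h
  exact Module.Projective.of_split i p (LinearMap.ext h)

theorem Summ.injective (h : Summ R N M) (hM : Module.Injective R M) : Module.Injective R N := by
  obtain ⟨i, p, h⟩ := h
  refine ⟨fun X Y _ _ _ _ f hf g => ?_⟩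
  obtain ⟨k, hk⟩ := hM.out f hf (i ∘ₗ g)
  exact ⟨p ∘ₗ k, fun x => by simp [hk, h]⟩

theorem inj_pi (hM : Module.Injective R M) (n : ℕ) : Module.Injective R (Fin n → M) := by
  refine ⟨fun X Y _ _ _ _ f hf g => ?_⟩
  choose k hk using fun i : Fin n => hM.out f hf (LinearMap.proj i ∘ₗ g)
  exact ⟨LinearMap.pi k, fun x => by ext i; simp [hk]⟩

theorem inj_prod (hM : Module.Injective R M) (hN : Module.Injective R N) :
    Module.Injective R (M × N) := by
  refine ⟨fun X Y _ _ _ _ f hf g => ?_⟩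
  obtain ⟨k, hk⟩ := hM.out f hf (LinearMap.fst R M N ∘ₗ g)
  obtain ⟨k', hk'⟩ := hN.out f hf (LinearMap.snd R M N ∘ₗ g)
  exact ⟨k.prod k', fun x => by ext <;> simp [hk, hk']⟩

theorem Add.of_summ (h : Summ R M X) : Add R X M :=
  ⟨1, h.trans (Summ.of_equiv (LinearEquiv.funUnique (Fin 1) R X).symm)⟩

theorem Add.refl : Add R X X := Add.of_summ Summ.refl

theorem Add.summ (h : Add R X M) (h' : Summ R N M) : Add R X N := by
  obtain ⟨n, h⟩ := h
  exact ⟨n, h'.trans h⟩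

theorem Add.pi (h : Add R X M) (n : ℕ) : Add R X (Fin n → M) := by
  obtain ⟨m, h⟩ := h
  refine ⟨n * m, (h.pi_mono n).trans (Summ.of_equiv ?_)⟩
  exact (LinearEquiv.curry R X (Fin n) (Fin m)).symm.trans (LinearEquiv.funCongrLeft R X finProdFinEquiv.symm)

theorem Add.trans (h : Add R X M) (h' : Add R M N) : Add R X N := by
  obtain ⟨n, h'⟩ := h'
  exact (h.pi n).summ h'

theorem Add.prod (h : Add R X M) (h' : Add R X N) : Add R X (M × N) := by
  obtain ⟨m, h⟩ := h
  obtain ⟨n, h'⟩ := h'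
  refine ⟨m + n, (h.prod_mono h').trans (Summ.of_equiv ?_)⟩
  exact (LinearEquiv.sumArrowLequivProdArrow (Fin m) (Fin n) R X).symm.trans
    (LinearEquiv.funCongrLeft R X finSumFinEquiv.symm)

theorem Add.proj (h : Add R X M) (hM : Module.Projective R X) : Module.Projective R M := by
  obtain ⟨n, h⟩ := h
  exact h.proj (Module.Projective.of_equiv (DFinsupp.linearEquivFunOnFintype (R := R) (M := fun _ : Fin n => X)))

theorem Add.injective (h : Add R X M) (hM : Module.Injective R X) : Module.Injective R M := by
  obtain ⟨n, h⟩ := h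
  exact h.injective (inj_pi hM n)

theorem Add.finite (h : Add R X M) [Module.Finite R X] : Module.Finite R M := by
  obtain ⟨n, h⟩ := h
  exact h.finite

theorem Add.fst : Add R (A × B) A := Add.of_summ Summ.fst
theorem Add.snd : Add R (A × B) B := Add.of_summ Summ.snd

/-- the product decomposition coming from a summand -/
theorem Summ.compl (h : Summ R N M) : ∃ (N' : Type) (_ : AddCommGroup N') (_ : Module R N'),
    Nonempty (M ≃ₗ[R] N × N') := by
  obtain ⟨i, p, h⟩ := h
  have hs : SES (R := R) (p.ker.subtype) p :=
    ⟨Subtype.val_injective, by intro x; simp, Function.RightInverse.surjective h⟩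
  refine ⟨p.ker, inferInstance, inferInstance, ⟨?_⟩⟩
  refine LinearEquiv.ofBijective (p.prod ((LinearMap.id - i ∘ₗ p).codRestrict p.ker
    (fun x => by simp [h]))) ⟨?_, ?_⟩
  · rw [injective_iff_map_eq_zero]
    intro x hx
    replace hx := Prod.mk_eq_zero.1 hx
    have := congrArg Subtype.val hx.2
    simpa [hx.1] using this
  · rintro ⟨a, b, hb⟩
    refine ⟨i a + b, ?_⟩
    have hb' : p b = 0 := hb
    ext <;> simp [h, hb']

/-- splitting from a retraction -/
theorem SES.split_left {f : A →ₗ[R] B} {g : B →ₗ[R] C} (h : SES f g) (r : B →ₗ[R] A)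
    (hr : ∀ x, r (f x) = x) : Nonempty (B ≃ₗ[R] A × C) := by
  refine ⟨LinearEquiv.ofBijective (r.prod g) ⟨?_, ?_⟩⟩
  · rw [injective_iff_map_eq_zero]
    intro x hx
    replace hx := Prod.mk_eq_zero.1 hx
    obtain ⟨a, rfl⟩ := (h.2.1 x).1 hx.2
    rw [hr] at hx
    simp [hx.1]
  · rintro ⟨a, c⟩
    obtain ⟨b, rfl⟩ := h.2.2 c
    refine ⟨b - f (r b) + f a, ?_⟩
    ext <;> simp [hr, h.2.1.apply_apply_eq_zero]

theorem SES.split_right {f : A →ₗ[R] B} {g : B →ₗ[R] C} (h : SES f g) (s : C →ₗ[R] B)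
    (hs : ∀ x, g (s x) = x) : Nonempty (B ≃ₗ[R] A × C) := by
  refine ⟨(LinearEquiv.ofBijective (f.coprod s) ⟨?_, ?_⟩).symm⟩
  · rw [injective_iff_map_eq_zero]
    rintro ⟨a, c⟩ hx
    simp only [LinearMap.coprod_apply] at hx
    have h2 := congrArg g hx
    simp only [map_add, h.2.1.apply_apply_eq_zero, hs, zero_add, map_zero] at h2
    subst h2
    simp only [map_zero, add_zero] at hx
    have := h.1 (hx.trans (map_zero f).symm)
    simp [this]
  · intro b
    have : g (b - s (g b)) = 0 := by simp [hs]
    obtain ⟨a, ha⟩ := (h.2.1 _).1 this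
    exact ⟨(a, g b), by simp [ha]⟩

theorem SES.equiv_left {f : A →ₗ[R] B} {g : B →ₗ[R] C} (h : SES f g) (e : X ≃ₗ[R] A) :
    SES (f ∘ₗ e.toLinearMap) g := by
  refine ⟨h.1.comp e.injective, ?_, h.2.2⟩
  intro x
  rw [h.2.1 x]
  constructor
  · rintro ⟨a, rfl⟩
    exact ⟨e.symm a, by simp⟩
  · rintro ⟨a, rfl⟩
    exact ⟨e a, by simp⟩

theorem SES.equiv_right {f : A →ₗ[R] B} {g : B →ₗ[R] C} (h : SES f g) (e : C ≃ₗ[R] X) :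
    SES f (e.toLinearMap ∘ₗ g) := by
  refine ⟨h.1, ?_, e.surjective.comp h.2.2⟩
  intro x
  rw [← h.2.1 x]
  simp

theorem ses_of_surj (g : B →ₗ[R] C) (hg : Function.Surjective g) :
    SES (R := R) (g.ker.subtype) g :=
  ⟨Subtype.val_injective, by intro x; simp, hg⟩

theorem ses_of_inj (f : A →ₗ[R] B) (hf : Function.Injective f) :
    SES (R := R) f (f.range.mkQ) :=
  ⟨hf, by intro x; simp, Submodule.mkQ_surjective _⟩

end SummPart

section Chains
variable {R : Type} [Ring R]

/-- `A → Q₁ → ... → Qₙ → B` exact with `Qᵢ` in the class. -/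
inductive Ch (q : ModuleCat.{0} R → Prop) : ℕ → ModuleCat.{0} R → ModuleCat.{0} R → Prop
  | zero {A B : ModuleCat.{0} R} (e : A ≃ₗ[R] B) : Ch q 0 A B
  | succ {n : ℕ} {A Q A' B : ModuleCat.{0} R} (f : A →ₗ[R] Q) (g : Q →ₗ[R] A') (h : SES f g)
      (hq : q Q) (c : Ch q n A' B) : Ch q (n+1) A B

variable {q : ModuleCat.{0} R → Prop} {A A' B B' : ModuleCat.{0} R} {n m : ℕ}

theorem Ch.equiv_left (c : Ch q n A B) (e : A' ≃ₗ[R] A) : Ch q n A' B := by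
  cases c with
  | zero e' => exact Ch.zero (e.trans e')
  | succ f g h hq c => exact Ch.succ (f ∘ₗ e.toLinearMap) g (h.equiv_left e) hq c

theorem Ch.trans {C : ModuleCat.{0} R} (c : Ch q n A B) (c' : Ch q m B C) : Ch q (n+m) A C := by
  induction c with
  | zero e => rw [zero_add]; exact c'.equiv_left e
  | succ f g h hq c ih =>
    rw [Nat.succ_add]
    exact Ch.succ f g h hq (ih c')

theorem Ch.equiv_right (c : Ch q n A B) (e : B ≃ₗ[R] B') : Ch q n A B' :=
  c.trans (Ch.zero e)

theorem Ch.split {a b : ℕ} (c : Ch q (a+b) A B) : ∃ X, Ch q a A X ∧ Ch q b X B := by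
  induction a generalizing A with
  | zero => rw [zero_add] at c; exact ⟨A, Ch.zero (LinearEquiv.refl R A), c⟩
  | succ a ih =>
    rw [Nat.succ_add] at c
    cases c with
    | succ f g h hq c =>
      obtain ⟨X, h1, h2⟩ := ih c
      exact ⟨X, Ch.succ f g h hq h1, h2⟩

theorem Ch.mono {q' : ModuleCat.{0} R → Prop} (hq : ∀ Q, q Q → q' Q) (c : Ch q n A B) :
    Ch q' n A B := by
  induction c with
  | zero e => exact Ch.zero e
  | succ f g h h1 c ih => exact Ch.succ f g h (hq _ h1) ih

theorem ch_of_seq {k : ℕ} {Y : ℕ → ModuleCat.{0} R} {f : ∀ i, Y i →ₗ[R] Y (i+1)}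
    (h : IsExactSeq (k+1) Y f) (hq : ∀ i, 1 ≤ i → i ≤ k → q (Y i)) : Ch q k (Y 0) (Y (k+1)) := by
  obtain ⟨h0, hs, he⟩ := h
  replace hs : Function.Surjective (f k) := hs
  have key : ∀ n j, j + n = k → Ch q n (ModuleCat.of R (f j).range) (Y (k+1)) := by
    intro n
    induction n with
    | zero =>
      intro j hj
      obtain rfl : j = k := by omega
      exact Ch.zero (LinearEquiv.ofTop _ (LinearMap.range_eq_top.2 hs))
    | succ n ih =>
      intro j hj
      refine Ch.succ (Q := Y (j+1)) (A' := ModuleCat.of R (f (j+1)).range)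
        (f j).range.subtype (f (j+1)).rangeRestrict ⟨Subtype.val_injective, ?_, ?_⟩
        (hq _ (by omega) (by omega)) (ih (j+1) (by omega))
      · intro x
        have := he j (by omega) x
        simp only [Submodule.coe_subtype, Subtype.range_coe_subtype]
        rw [← LinearMap.mem_ker, LinearMap.ker_rangeRestrict, LinearMap.mem_ker, this]
        rfl
      · exact LinearMap.surjective_rangeRestrict _
  exact (key k 0 (by omega)).equiv_left (LinearEquiv.ofInjective (f 0) h0)

theorem ez_equiv {M M' N : ModuleCat.{0} R} (e : M ≃ₗ[R] M') {j : ℕ} (h : EZ M' N j) : EZ M N j :=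
  ez_summ (isSummand_iff.2 (Summ.of_equiv e)) h

theorem ezr_equiv {M M' N : ModuleCat.{0} R} (e : M ≃ₗ[R] M') {j : ℕ} (h : EZ N M' j) : EZ N M j :=
  ezr_summ (isSummand_iff.2 (Summ.of_equiv e)) h

theorem Ch.ez_right {N : ModuleCat.{0} R} (hq : ∀ Q, q Q → ∀ j, 1 ≤ j → EZ Q N j)
    (c : Ch q n A B) : ∀ i, (∀ j, i < j → EZ A N j) → ∀ j, i + n < j → EZ B N j := by
  induction c with
  | zero e => exact fun i hA j hj => ez_equiv e.symm (hA j hj)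
  | succ f g h h1 c ih =>
    intro i hA j hj
    refine ih (i+1) (fun j hj => ?_) j (by omega)
    obtain ⟨p, rfl⟩ : ∃ p, j = p + 1 := ⟨j - 1, by omega⟩
    exact ez_third h (hA _ (by omega)) (hq _ h1 _ (by omega))

theorem Ch.ez_left {N : ModuleCat.{0} R} (hq : ∀ Q, q Q → ∀ j, 1 ≤ j → EZ Q N j)
    (c : Ch q n A B) : (∀ j, 1 ≤ j → EZ B N j) → ∀ j, 1 ≤ j → EZ A N j := by
  induction c with
  | zero e => exact fun hA j hj => ez_equiv e (hA j hj)
  | succ f g h h1 c ih =>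
    intro hA j hj
    exact ez_first h (hq _ h1 _ (by omega)) (ih hA (j+1) (by omega))

theorem Ch.ezr_left {N : ModuleCat.{0} R} (hq : ∀ Q, q Q → ∀ j, 1 ≤ j → EZ N Q j)
    (c : Ch q n A B) : ∀ i, (∀ j, i < j → EZ N B j) → ∀ j, i + n < j → EZ N A j := by
  induction c with
  | zero e => exact fun i hA j hj => ezr_equiv e (hA j hj)
  | succ f g h h1 c ih =>
    intro i hA j hj
    obtain ⟨p, rfl⟩ : ∃ p, j = p + 1 := ⟨j - 1, by omega⟩
    exact ezr_first h (ih i hA p (by omega)) (hq _ h1 _ (by omega))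

theorem Ch.ezr_right {N : ModuleCat.{0} R} (hq : ∀ Q, q Q → ∀ j, 1 ≤ j → EZ N Q j)
    (c : Ch q n A B) : ∀ i, (∀ j, i + n < j → EZ N A j) → ∀ j, i < j → EZ N B j := by
  induction c with
  | zero e => exact fun i hA j hj => ezr_equiv e.symm (hA j hj)
  | succ f g h h1 c ih =>
    intro i hA j hj
    refine ih i (fun j hj => ?_) j hj
    exact ezr_third h (hq _ h1 _ (by omega)) (hA _ (by omega))

end Chains
end PSX

namespace PSX
open PS

section FinDim
variable (K : Type) [Field K] {R : Type} [Ring R] [Algebra K R]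

/-- restriction of scalars -/
abbrev kRes (M : Type) [AddCommGroup M] [Module R M] : Module K M :=
  Module.compHom M (algebraMap K R)

theorem kRes_tower (M : Type) [AddCommGroup M] [Module R M] :
    letI := kRes K (R := R) M; IsScalarTower K R M := by
  let _ := kRes K (R := R) M
  constructor
  intro c r m
  change (c • r) • m = algebraMap K R c • r • m
  rw [Algebra.smul_def, mul_smul]

/-- multiplication with a central element -/
def cmul (M : Type) [AddCommGroup M] [Module R M] (c : K) : M →ₗ[R] M where
  toFun m := algebraMap K R c • m
  map_add' := smul_add _
  map_smul' r m := by
    simp only [RingHom.id_apply, ← mul_smul, Algebra.commutes]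

theorem hom_fg [FiniteDimensional K R] (M N : Type) [AddCommGroup M] [Module R M] [AddCommGroup N] [Module R N]
    [Module.Finite R M] [Module.Finite R N] :
    ∃ (n : ℕ) (f : Fin n → (M →ₗ[R] N)), ∀ g : M →ₗ[R] N, ∃ c : Fin n → K,
      ∀ x, g x = ∑ i, algebraMap K R (c i) • f i x := by
  let _ := kRes K (R := R) M
  let _ := kRes K (R := R) N
  have := kRes_tower K (R := R) M
  have := kRes_tower K (R := R) N
  have : Module.Finite K M := Module.Finite.trans R M
  have : Module.Finite K N := Module.Finite.trans R N
  have : SMulCommClass R K N := SMulCommClass.symm K R N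
  have : Module.Finite K (M →ₗ[R] N) :=
    Module.Finite.of_injective (LinearMap.restrictScalarsₗ K R M N K)
      (LinearMap.restrictScalars_injective K)
  obtain ⟨n, f, hf⟩ := Module.Finite.exists_fin (R := K) (M := M →ₗ[R] N)
  refine ⟨n, f, fun g => ?_⟩
  have hg : g ∈ Submodule.span K (Set.range f) := by rw [hf]; trivial
  obtain ⟨c, hc⟩ := (Submodule.mem_span_range_iff_exists_fun K).1 hg
  refine ⟨c, fun x => ?_⟩
  rw [← hc, LinearMap.sum_apply]
  rfl

end FinDim
section FinDim2

theorem right_approx (K : Type) [Field K] {R : Type} [Ring R] [Algebra K R] [FiniteDimensional K R] (T W : Type) [AddCommGroup T] [Module R T] [AddCommGroup W] [Module R W]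
    [Module.Finite R T] [Module.Finite R W] :
    ∃ (n : ℕ) (F : (Fin n → T) →ₗ[R] W), ∀ g : T →ₗ[R] W, ∃ h : T →ₗ[R] (Fin n → T),
      ∀ x, F (h x) = g x := by
  obtain ⟨n, f, hf⟩ := hom_fg K (R := R) T W
  refine ⟨n, ∑ i, f i ∘ₗ LinearMap.proj i, fun g => ?_⟩
  obtain ⟨c, hc⟩ := hf g
  refine ⟨LinearMap.pi fun i => cmul K T (c i), fun x => ?_⟩
  rw [hc, LinearMap.sum_apply]
  refine Finset.sum_congr rfl fun i _ => ?_
  simp [cmul]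

theorem left_approx (K : Type) [Field K] {R : Type} [Ring R] [Algebra K R] [FiniteDimensional K R] (W T : Type) [AddCommGroup T] [Module R T] [AddCommGroup W] [Module R W]
    [Module.Finite R T] [Module.Finite R W] :
    ∃ (n : ℕ) (F : W →ₗ[R] (Fin n → T)), ∀ g : W →ₗ[R] T, ∃ h : (Fin n → T) →ₗ[R] T,
      ∀ x, h (F x) = g x := by
  obtain ⟨n, f, hf⟩ := hom_fg K (R := R) W T
  refine ⟨n, LinearMap.pi f, fun g => ?_⟩
  obtain ⟨c, hc⟩ := hf g
  refine ⟨∑ i, cmul K T (c i) ∘ₗ LinearMap.proj i, fun x => ?_⟩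
  rw [hc, LinearMap.sum_apply]
  refine Finset.sum_congr rfl fun i _ => ?_
  simp [cmul]

theorem noeth (K : Type) [Field K] {R : Type} [Ring R] [Algebra K R] [FiniteDimensional K R] : IsNoetherianRing R := IsNoetherianRing.of_finite K R
theorem artin (K : Type) [Field K] {R : Type} [Ring R] [Algebra K R] [FiniteDimensional K R] : IsArtinianRing R := IsArtinianRing.of_finite K R

/-- generic tilting lemma -/
theorem tilting_lemma (K : Type) [Field K] {R : Type} [Ring R] [Algebra K R] [FiniteDimensional K R] {k : ℕ} {T T' t : ModuleCat.{0} R} [Module.Finite R T]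
    (hTT : ∀ j, 1 ≤ j → EZ T T j) (hpd : ∀ N j, k < j → EZ T N j)
    (hT' : MemAdd T T') (ht : MemAdd T' t) {m : ℕ} (c : Ch (MemAdd T') m (reg R) t) :
    MemAdd T' T := by
  have := noeth K (R := R)
  have fT' : Module.Finite R T' := (memAdd_iff.1 hT').finite
  -- surjectivity
  have h0 : ∃ (T0 : ModuleCat.{0} R) (i : R →ₗ[R] T0), MemAdd T' T0 ∧
      ∀ W : ModuleCat.{0} R, (∀ j, 1 ≤ j → EZ T' W j) → ∀ u : R →ₗ[R] W, ∃ v : T0 →ₗ[R] W,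
        ∀ x, v (i x) = u x := by
    cases c with
    | zero e =>
      exact ⟨t, e.toLinearMap, ht, fun W _ u => ⟨u ∘ₗ e.symm.toLinearMap,
        fun x => congrArg u (e.symm_apply_apply x)⟩⟩
    | @succ n _ Q A' _ f g h hq c =>
      refine ⟨Q, f, hq, fun W hW u => ?_⟩
      have h1 := c.ez_left (N := W) (fun Q hQ j hj => ez_add hj (hW j hj) hQ)
        (fun j hj => ez_add hj (hW j hj) ht)
      obtain ⟨v, hv⟩ := ez_extend h (h1 1 le_rfl) u
      exact ⟨v, fun x => LinearMap.congr_fun hv x⟩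
  obtain ⟨T0, i0, hT0, h0⟩ := h0
  have key : ∀ W : ModuleCat.{0} R, Module.Finite R W → (∀ j, 1 ≤ j → EZ T' W j) →
      ∃ (n : ℕ) (W' : ModuleCat.{0} R) (f : W' →ₗ[R] ModuleCat.of R (Fin n → T'))
        (g : ModuleCat.of R (Fin n → T') →ₗ[R] W), SES f g ∧
        Module.Finite R W' ∧ (∀ j, 1 ≤ j → EZ T' W' j) := by
    intro W fW hW
    obtain ⟨n, F, hF⟩ := right_approx K (R := R) T' W
    have hs : Function.Surjective F := by
      intro w
      obtain ⟨v, hv⟩ := h0 W hW (LinearMap.toSpanSingleton R W w)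
      obtain ⟨m, a, b, hab⟩ := memAdd_iff.1 hT0
      choose h hh using fun l : Fin m =>
        hF (v ∘ₗ b ∘ₗ LinearMap.single R (fun _ : Fin m => (T' : Type)) l)
      refine ⟨∑ l, h l (a (i0 1) l), ?_⟩
      rw [map_sum]
      simp only [hh]
      have : w = v (b (∑ l, Pi.single l (a (i0 1) l))) := by
        rw [Finset.univ_sum_single, hab, hv]; simp
      conv_rhs => rw [this]
      simp [map_sum]
    refine ⟨n, ModuleCat.of R F.ker, F.ker.subtype, F, ses_of_surj F hs,
      inferInstanceAs (Module.Finite R F.ker), fun j hj => ?_⟩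
    have e1 : ∀ j, 1 ≤ j → EZ T' (ModuleCat.of R (Fin n → T')) j := fun j hj =>
      ezr_pi hj (ezr_add hj (ez_add hj (hTT j hj) hT') hT') n
    obtain ⟨p, rfl⟩ : ∃ p, j = p + 1 := ⟨j - 1, by omega⟩
    rcases Nat.eq_zero_or_pos p with rfl | hp
    · refine ez_of_lift (B := ModuleCat.of R (Fin n → T')) (ses_of_surj F hs) (e1 1 le_rfl) fun u => ?_
      obtain ⟨h, hh⟩ := hF u
      exact ⟨h, LinearMap.ext hh⟩
    · exact ezr_first (B := ModuleCat.of R (Fin n → T')) (ses_of_surj F hs) (hW p hp) (e1 _ hj)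
  have key2 : ∀ i j, 1 ≤ j → k < j + i → ∀ W : ModuleCat.{0} R, Module.Finite R W →
      (∀ j, 1 ≤ j → EZ T' W j) → EZ T W j := by
    intro i
    induction i with
    | zero => exact fun j hj h W _ _ => hpd W j h
    | succ i ih =>
      intro j hj h W fW hW
      obtain ⟨n, W', f, g, hs, fW', hW'⟩ := key W fW hW
      exact ezr_third hs (ezr_pi hj (ezr_add hj (hTT j hj) hT') n)
        (ih (j+1) (by omega) (by omega) W' fW' hW')
  obtain ⟨n, W', f, g, hs, fW', hW'⟩ := key T inferInstance (fun j hj => ez_add hj (hTT j hj) hT')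
  obtain ⟨v, hv⟩ := ez_lift hs (key2 k 1 le_rfl (by omega) W' fW' hW') LinearMap.id
  exact ⟨n, v, g, hv⟩

/-- generic cotilting lemma -/
theorem cotilting_lemma (K : Type) [Field K] {R : Type} [Ring R] [Algebra K R] [FiniteDimensional K R] {k : ℕ} {T T' t D : ModuleCat.{0} R} [Module.Finite R T]
    (hD : ∀ W : ModuleCat.{0} R, Module.Finite R W → ∃ (n : ℕ) (u : W →ₗ[R] (Fin n → D)),
      Function.Injective u)
    (hTT : ∀ j, 1 ≤ j → EZ T T j) (hpd : ∀ N j, k < j → EZ N T j)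
    (hT' : MemAdd T T') (ht : MemAdd T' t) {m : ℕ} (c : Ch (MemAdd T') m t D) :
    MemAdd T' T := by
  have := noeth K (R := R)
  have fT' : Module.Finite R T' := (memAdd_iff.1 hT').finite
  have h0 : ∃ (T0 : ModuleCat.{0} R) (i : T0 →ₗ[R] D), MemAdd T' T0 ∧
      ∀ W : ModuleCat.{0} R, (∀ j, 1 ≤ j → EZ W T' j) → ∀ u : W →ₗ[R] D, ∃ v : W →ₗ[R] T0,
        ∀ x, i (v x) = u x := by
    rcases Nat.eq_zero_or_pos m with rfl | hm
    · cases c with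
      | zero e =>
        exact ⟨t, e.toLinearMap, ht, fun W _ u => ⟨e.symm.toLinearMap ∘ₗ u,
          fun x => e.apply_symm_apply (u x)⟩⟩
    · obtain ⟨p, rfl⟩ : ∃ p, m = p + 1 := ⟨m - 1, by omega⟩
      obtain ⟨X, c1, c2⟩ := c.split
      cases c2 with
      | @succ _ _ Q A' _ f g h hq c =>
        cases c with
        | zero e =>
        refine ⟨Q, e.toLinearMap ∘ₗ g, hq, fun W hW u => ?_⟩
        have h1 := c1.ezr_right (N := W) (fun Q hQ j hj => ezr_add hj (hW j hj) hQ) 0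
          (fun j hj => ezr_add (by omega) (hW j (by omega)) ht)
        obtain ⟨v, hv⟩ := ez_lift (h.equiv_right e) (h1 1 (by omega)) u
        exact ⟨v, fun x => LinearMap.congr_fun hv x⟩
  obtain ⟨T0, i0, hT0, h0⟩ := h0
  have key : ∀ W : ModuleCat.{0} R, Module.Finite R W → (∀ j, 1 ≤ j → EZ W T' j) →
      ∃ (n : ℕ) (W' : ModuleCat.{0} R) (f : W →ₗ[R] ModuleCat.of R (Fin n → T'))
        (g : ModuleCat.of R (Fin n → T') →ₗ[R] W'), SES f g ∧
        Module.Finite R W' ∧ (∀ j, 1 ≤ j → EZ W' T' j) := by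
    intro W fW hW
    obtain ⟨n, F, hF⟩ := left_approx K (R := R) W T'
    have hs : Function.Injective F := by
      rw [injective_iff_map_eq_zero]
      intro w hw
      obtain ⟨r, u, hu⟩ := hD W fW
      obtain ⟨m, a, b, hab⟩ := memAdd_iff.1 hT0
      apply hu
      rw [map_zero]
      funext l
      obtain ⟨v, hv⟩ := h0 W hW (LinearMap.proj l ∘ₗ u)
      have h1 : v w = 0 := by
        rw [← hab (v w)]
        suffices a (v w) = 0 by rw [this, map_zero]
        funext s
        obtain ⟨h, hh⟩ := hF (LinearMap.proj s ∘ₗ a ∘ₗ v)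
        have := hh w
        rw [hw, map_zero] at this
        exact this.symm
      have := hv w
      rw [h1, map_zero] at this
      exact this.symm
    refine ⟨n, ModuleCat.of R ((Fin n → T') ⧸ F.range), F, F.range.mkQ, ses_of_inj F hs,
      inferInstanceAs (Module.Finite R ((Fin n → T') ⧸ F.range)), fun j hj => ?_⟩
    have e1 : ∀ j, 1 ≤ j → EZ (ModuleCat.of R (Fin n → T')) T' j := fun j hj =>
      ez_pi hj (ezr_add hj (ez_add hj (hTT j hj) hT') hT') n
    obtain ⟨p, rfl⟩ : ∃ p, j = p + 1 := ⟨j - 1, by omega⟩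
    rcases Nat.eq_zero_or_pos p with rfl | hp
    · refine ez_of_extend (B := ModuleCat.of R (Fin n → T'))
        (C := ModuleCat.of R ((Fin n → T') ⧸ F.range)) (ses_of_inj F hs) (e1 1 le_rfl) fun u => ?_
      obtain ⟨h, hh⟩ := hF u
      exact ⟨h, LinearMap.ext hh⟩
    · exact ez_third (B := ModuleCat.of R (Fin n → T'))
        (C := ModuleCat.of R ((Fin n → T') ⧸ F.range)) (ses_of_inj F hs) (hW p hp) (e1 _ hj)
  have key2 : ∀ i j, 1 ≤ j → k < j + i → ∀ W : ModuleCat.{0} R, Module.Finite R W →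
      (∀ j, 1 ≤ j → EZ W T' j) → EZ W T j := by
    intro i
    induction i with
    | zero => exact fun j hj h W _ _ => hpd W j h
    | succ i ih =>
      intro j hj h W fW hW
      obtain ⟨n, W', f, g, hs, fW', hW'⟩ := key W fW hW
      exact ez_first hs (ez_pi hj (ez_add hj (hTT j hj) hT') n)
        (ih (j+1) (by omega) (by omega) W' fW' hW')
  obtain ⟨n, W', f, g, hs, fW', hW'⟩ := key T inferInstance (fun j hj => ezr_add hj (hTT j hj) hT')
  obtain ⟨v, hv⟩ := ez_extend hs (key2 k 1 le_rfl (by omega) W' fW' hW') LinearMap.id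
  exact ⟨n, f, v, hv⟩

theorem pd_ez {R : Type} [Ring R] {k : ℕ} {T : ModuleCat.{0} R} (h : PdimLE k T) (N : ModuleCat.{0} R) (j : ℕ)
    (hj : k < j) : EZ T N j := by
  obtain ⟨Y, f, h, hp, rfl⟩ := h
  have c := ch_of_seq (q := fun Q => Module.Projective R Q) h (fun i _ hi => hp i hi)
  refine c.ez_right (N := N) (fun Q hQ j hj => ?_) 0 (fun j hj => ?_) j (by omega)
  · obtain ⟨p, rfl⟩ : ∃ p, j = p + 1 := ⟨j - 1, by omega⟩
    exact ez_proj hQ p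
  · obtain ⟨p, rfl⟩ : ∃ p, j = p + 1 := ⟨j - 1, by omega⟩
    exact ez_proj (hp 0 (by omega)) p

theorem id_ez {R : Type} [Ring R] {k : ℕ} {T : ModuleCat.{0} R} (h : IdimLE k T) (N : ModuleCat.{0} R) (j : ℕ)
    (hj : k < j) : EZ N T j := by
  obtain ⟨Y, f, h, hp, rfl⟩ := h
  have c := ch_of_seq (q := fun Q => Module.Injective R Q) h (fun i h1 hi => hp i h1 (by omega))
  refine c.ezr_left (N := N) (fun Q hQ j hj => ?_) 0 (fun j hj => ?_) j (by omega)
  · obtain ⟨p, rfl⟩ : ∃ p, j = p + 1 := ⟨j - 1, by omega⟩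
    exact ez_inj hQ p
  · obtain ⟨p, rfl⟩ : ∃ p, j = p + 1 := ⟨j - 1, by omega⟩
    exact ez_inj (hp (k+1) (by omega) le_rfl) p

end FinDim2

section DualReg
variable (K : Type) [Field K] {R : Type} [Ring R] [Algebra K R]

/-- underlying functional -/
def ev (φ : Dreg K R) : R →ₗ[K] K := φ

theorem ev_ext {φ ψ : Dreg K R} (h : ∀ r, ev K φ r = ev K ψ r) : φ = ψ :=
  LinearMap.ext (M := R) (M₃ := K) h

theorem dreg_smul (r : R) (φ : Dreg K R) (m : R) : ev K (r • φ) m = ev K φ (m * r) := rfl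

/-- the module map to the dual of the regular module given by a functional -/
def toD {M : Type} [AddCommGroup M] [Module R M] [Module K M] [IsScalarTower K R M]
    (ψ : M →ₗ[K] K) : M →ₗ[R] Dreg K R where
  toFun m := show R →ₗ[K] K from ψ ∘ₗ (LinearMap.toSpanSingleton R M m).restrictScalars K
  map_add' x y := by
    refine ev_ext K fun r => ?_
    change ψ (r • (x + y)) = ψ (r • x) + ψ (r • y)
    rw [smul_add, map_add]
  map_smul' s x := by
    refine ev_ext K fun r => ?_
    change ψ (r • s • x) = ψ ((r * s) • x)
    rw [mul_smul]

theorem toD_apply {M : Type} [AddCommGroup M] [Module R M] [Module K M] [IsScalarTower K R M]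
    (ψ : M →ₗ[K] K) (m : M) (r : R) : ev K (toD K ψ m) r = ψ (r • m) := rfl

theorem dreg_inj : Module.Injective R (Dreg K R) := by
  refine ⟨fun X Y _ _ _ _ f hf g => ?_⟩
  let _ := kRes K (R := R) X
  let _ := kRes K (R := R) Y
  have := kRes_tower K (R := R) X
  have := kRes_tower K (R := R) Y
  obtain ⟨l, hl⟩ := LinearMap.exists_leftInverse_of_injective (f.restrictScalars K)
    (LinearMap.ker_eq_bot.2 hf)
  let φ : X →ₗ[K] K :=
    { toFun := fun x => ev K (g x) 1
      map_add' := fun x y => by rw [map_add]; rfl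
      map_smul' := fun c x => by
        change ev K (g (algebraMap K R c • x)) 1 = _
        rw [map_smul, dreg_smul, one_mul, Algebra.algebraMap_eq_smul_one, map_smul]
        rfl }
  refine ⟨toD K (φ ∘ₗ l), fun x => ?_⟩
  refine ev_ext K fun r => ?_
  change φ (l (r • f x)) = _
  rw [← map_smul f]
  have : l (f (r • x)) = r • x := LinearMap.congr_fun hl (r • x)
  rw [this]
  change ev K (g (r • x)) 1 = _
  rw [map_smul, dreg_smul, one_mul]

variable [FiniteDimensional K R]

theorem dreg_cogen (W : Type) [AddCommGroup W] [Module R W] [Module.Finite R W] :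
    ∃ (n : ℕ) (u : W →ₗ[R] (Fin n → Dreg K R)), Function.Injective u := by
  let _ := kRes K (R := R) W
  have := kRes_tower K (R := R) W
  have : Module.Finite K W := Module.Finite.trans R W
  let b := Module.finBasis K W
  refine ⟨_, LinearMap.pi fun i => toD K (b.coord i), ?_⟩
  rw [injective_iff_map_eq_zero]
  intro w hw
  refine b.forall_coord_eq_zero_iff.1 fun i => ?_
  have h1 : toD K (b.coord i) w = 0 := congrFun hw i
  have h2 := toD_apply K (b.coord i) w (1 : R)
  rw [h1, one_smul] at h2
  exact h2.symm

theorem dreg_finite : Module.Finite R (Dreg K R) := by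
  let i1 : Module K (Dreg K R) := inferInstanceAs (Module K (R →ₗ[K] K))
  have : IsScalarTower K R (Dreg K R) := by
    constructor
    intro c r φ
    refine ev_ext K fun m => ?_
    change ev K φ (m * (c • r)) = c • ev K φ (m * r)
    rw [mul_smul_comm, map_smul]
  have : Module.Finite K (Dreg K R) := inferInstanceAs (Module.Finite K (R →ₗ[K] K))
  exact Module.Finite.of_restrictScalars_finite K R _

end DualReg
end PSX

namespace PSX
open PS

section SESlemmas
variable {R : Type} [Ring R]
variable {A B C X : Type} [AddCommGroup X] [Module R X] [AddCommGroup A] [AddCommGroup B]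
  [Module R A] [Module R B] [AddCommGroup C] [Module R C]

theorem SES.desc {f : A →ₗ[R] B} {g : B →ₗ[R] C} (h : SES f g) (φ : B →ₗ[R] X)
    (hφ : ∀ x, φ (f x) = 0) : ∃ ψ : C →ₗ[R] X, ∀ x, ψ (g x) = φ x := by
  have hk : g.ker ≤ φ.ker := by
    intro x hx
    obtain ⟨a, rfl⟩ := (h.2.1 x).1 hx
    exact hφ a
  refine ⟨g.ker.liftQ φ hk ∘ₗ (g.quotKerEquivOfSurjective h.2.2).symm.toLinearMap, fun x => ?_⟩
  have : (g.quotKerEquivOfSurjective h.2.2).symm (g x) = g.ker.mkQ x := by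
    rw [LinearEquiv.symm_apply_eq]; rfl
  simp only [LinearMap.comp_apply, LinearEquiv.coe_coe, this]
  rfl

theorem SES.lft {f : A →ₗ[R] B} {g : B →ₗ[R] C} (h : SES f g) (φ : X →ₗ[R] B)
    (hφ : ∀ x, g (φ x) = 0) : ∃ ψ : X →ₗ[R] A, ∀ x, f (ψ x) = φ x := by
  have hr : ∀ x, φ x ∈ f.range := fun x => (h.2.1 _).1 (hφ x)
  refine ⟨(LinearEquiv.ofInjective f h.1).symm.toLinearMap ∘ₗ φ.codRestrict f.range hr, fun x => ?_⟩
  have := LinearEquiv.apply_symm_apply (LinearEquiv.ofInjective f h.1) (φ.codRestrict f.range hr x)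
  exact congrArg Subtype.val this

theorem SES.pi {f : A →ₗ[R] B} {g : B →ₗ[R] C} (h : SES f g) (n : ℕ) :
    SES (f.compLeft (Fin n)) (g.compLeft (Fin n)) := by
  refine ⟨fun x y hxy => ?_, fun x => ?_, fun x => ?_⟩
  · funext i
    exact h.1 (congrFun hxy i)
  · constructor
    · intro hx
      choose y hy using fun i => (h.2.1 (x i)).1 (congrFun hx i)
      exact ⟨y, funext hy⟩
    · rintro ⟨y, rfl⟩
      funext i
      exact h.2.1.apply_apply_eq_zero (y i)
  · choose y hy using fun i => h.2.2 (x i)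
    exact ⟨y, funext hy⟩

theorem SES.prod_right {f : A →ₗ[R] B} {g : B →ₗ[R] C} (h : SES f g) (X : Type) [AddCommGroup X]
    [Module R X] : SES (LinearMap.inl R B X ∘ₗ f) (g.prodMap (LinearMap.id : X →ₗ[R] X)) := by
  refine ⟨fun x y hxy => h.1 (congrArg Prod.fst hxy), fun x => ?_, fun x => ?_⟩
  · constructor
    · intro hx
      obtain ⟨y, hy⟩ := (h.2.1 x.1).1 (congrArg Prod.fst hx)
      have h2 : x.2 = 0 := congrArg Prod.snd hx
      exact ⟨y, by ext <;> simp [hy, h2]⟩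
    · rintro ⟨y, rfl⟩
      ext <;> simp [h.2.1.apply_apply_eq_zero]
  · obtain ⟨y, hy⟩ := h.2.2 x.1
    exact ⟨(y, x.2), by ext <;> simp [hy]⟩

theorem SES.prod_left {f : A →ₗ[R] B} {g : B →ₗ[R] C} (h : SES f g) (X : Type) [AddCommGroup X]
    [Module R X] : SES (f.prodMap (LinearMap.id : X →ₗ[R] X)) (g ∘ₗ LinearMap.fst R B X) := by
  refine ⟨fun x y hxy => ?_, fun x => ?_, fun x => ?_⟩
  · have h1 := h.1 (congrArg Prod.fst hxy)
    have h2 : x.2 = y.2 := by simpa using congrArg Prod.snd hxy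
    exact Prod.ext h1 h2
  · constructor
    · intro hx
      obtain ⟨y, hy⟩ := (h.2.1 x.1).1 hx
      exact ⟨(y, x.2), by ext <;> simp [hy]⟩
    · rintro ⟨y, rfl⟩
      simp [h.2.1.apply_apply_eq_zero]
  · obtain ⟨y, hy⟩ := h.2.2 x
    exact ⟨(y, 0), by simp [hy]⟩

variable {A' Q B' S : Type} [AddCommGroup A'] [Module R A'] [AddCommGroup B'] [Module R B']
  [AddCommGroup Q] [Module R Q] [AddCommGroup S] [Module R S]
  {a : A →ₗ[R] Q} {a' : Q →ₗ[R] A'} {b : B →ₗ[R] S} {b' : S →ₗ[R] B'}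

theorem schanuel_core (hA : SES a a') (hB : SES b b') (hQ : Module.Injective R Q)
    (hS : Module.Injective R S) (h : Summ R A B) : Summ R A' (B' × Q) := by
  obtain ⟨i, p, hip⟩ := h
  obtain ⟨α, hα⟩ := hS.out a hA.1 (b ∘ₗ i)
  obtain ⟨β, hβ⟩ := hQ.out b hB.1 (a ∘ₗ p)
  obtain ⟨α', hα'⟩ := hA.desc (b' ∘ₗ α) (fun x => by simp [hα, hB.2.1.apply_apply_eq_zero])
  obtain ⟨β', hβ'⟩ := hB.desc (a' ∘ₗ β) (fun x => by simp [hβ, hA.2.1.apply_apply_eq_zero])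
  obtain ⟨γ, hγ⟩ := hA.desc (LinearMap.id - β ∘ₗ α) (fun x => by simp [hα, hβ, hip])
  refine ⟨α'.prod γ, β'.coprod a', fun x => ?_⟩
  obtain ⟨y, rfl⟩ := hA.2.2 x
  simp [hα', hβ', hγ]

theorem schanuel_core' (hA : SES a a') (hB : SES b b') (hQ : Module.Projective R Q)
    (hS : Module.Projective R S) (h : Summ R A' B') : Summ R A (B × Q) := by
  obtain ⟨i, p, hip⟩ := h
  obtain ⟨α, hα⟩ := Module.projective_lifting_property b' (i ∘ₗ a') hB.2.2
  obtain ⟨β, hβ⟩ := Module.projective_lifting_property a' (p ∘ₗ b') hA.2.2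
  replace hα : ∀ x, b' (α x) = i (a' x) := fun x => LinearMap.congr_fun hα x
  replace hβ : ∀ x, a' (β x) = p (b' x) := fun x => LinearMap.congr_fun hβ x
  obtain ⟨α', hα'⟩ := hB.lft (α ∘ₗ a) (fun x => by simp [hα, hA.2.1.apply_apply_eq_zero])
  obtain ⟨β', hβ'⟩ := hA.lft (β ∘ₗ b) (fun x => by simp [hβ, hB.2.1.apply_apply_eq_zero])
  obtain ⟨γ, hγ⟩ := hA.lft (LinearMap.id - β ∘ₗ α) (fun x => by simp [hα, hβ, hip])
  refine ⟨α'.prod a, β'.coprod γ, fun x => ?_⟩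
  apply hA.1
  have h1 : ∀ x, b (α' x) = α (a x) := hα'
  have h2 : ∀ x, a (β' x) = β (b x) := hβ'
  simp [h1, h2, hγ]

theorem Add.prod_mono_left {X M N : Type} [AddCommGroup X] [Module R X] [AddCommGroup M]
    [Module R M] [AddCommGroup N] [Module R N] (h : Add R M N) : Add R (M × X) (N × X) :=
  Add.prod (Add.fst.trans h) Add.snd

theorem schanuel (hA : SES a a') (hB : SES b b') (hX : Module.Injective R X)
    (hQ : Add R X Q) (hS : Add R X S) (h : Add R (B × X) A) : Add R (B' × X) A' := by
  obtain ⟨n, h⟩ := h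
  have hS' := inj_pi (inj_prod (hS.injective hX) hX) n
  have h1 := schanuel_core hA ((hB.prod_left X).pi n) (hQ.injective hX) hS' h
  refine Add.summ ?_ h1
  exact (Add.fst.pi n).prod (Add.snd.trans hQ)

theorem schanuel' (hA : SES a a') (hB : SES b b') (hX : Module.Projective R X)
    (hQ : Add R X Q) (hS : Add R X S) (h : Add R (B' × X) A') : Add R (B × X) A := by
  obtain ⟨n, h⟩ := h
  have hS2 := hS.proj hX
  have hS' : Module.Projective R (Fin n → S × X) :=
    (Add.refl.pi n : Add R (S × X) (Fin n → S × X)).proj inferInstance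
  have h1 := schanuel_core' hA ((hB.prod_right X).pi n) (hQ.proj hX) hS' h
  refine Add.summ ?_ h1
  exact (Add.fst.pi n).prod (Add.snd.trans hQ)

end SESlemmas

section ChSchanuel
variable {R : Type} [Ring R] {X : ModuleCat.{0} R} {n : ℕ}

theorem Ch.schanuel (hX : ProjInj X) {A A' B B' : ModuleCat.{0} R} (c : Ch (MemAdd X) n A A')
    (c' : Ch (MemAdd X) n B B') (h : Add R (B × X) A) : Add R (B' × X) A' := by
  induction c generalizing B with
  | zero e =>
    cases c' with
    | zero e' =>
      refine (Add.trans ?_ h).summ (Summ.of_equiv e.symm)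
      exact Add.of_summ (Summ.prod_mono (Summ.of_equiv e') Summ.refl)
  | succ f g hs hq c ih =>
    cases c' with
    | succ f' g' hs' hq' c' =>
      exact ih c' (PSX.schanuel hs hs' hX.2 (memAdd_iff.1 hq) (memAdd_iff.1 hq') h)

theorem Ch.schanuel' (hX : ProjInj X) {A A' B B' : ModuleCat.{0} R} (c : Ch (MemAdd X) n A A')
    (c' : Ch (MemAdd X) n B B') (h : Add R (B' × X) A') : Add R (B × X) A := by
  induction c generalizing B with
  | zero e =>
    cases c' with
    | zero e' =>
      refine (Add.trans ?_ h).summ (Summ.of_equiv e)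
      exact Add.of_summ (Summ.prod_mono (Summ.of_equiv e'.symm) Summ.refl)
  | succ f g hs hq c ih =>
    cases c' with
    | succ f' g' hs' hq' c' =>
      exact PSX.schanuel' hs hs' hX.1 (memAdd_iff.1 hq) (memAdd_iff.1 hq') (ih c' h)

end ChSchanuel

section Fitting
variable {R : Type} [Ring R]
variable {M : Type} [AddCommGroup M] [Module R M]

/-- `N` is a retract of `M`. -/
def Ret (N : Submodule R M) : Prop := ∃ p : M →ₗ[R] N, ∀ x : N, p x = x

theorem Ret.summ {N : Submodule R M} (h : Ret N) : Summ R N M := by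
  obtain ⟨p, h⟩ := h
  exact ⟨N.subtype, p, h⟩

theorem ret_range {N : Type} [AddCommGroup N] [Module R N] (i : N →ₗ[R] M) (p : M →ₗ[R] N)
    (h : ∀ x, p (i x) = x) : Ret i.range := by
  refine ⟨i.rangeRestrict ∘ₗ p, ?_⟩
  rintro ⟨_, y, rfl⟩
  apply Subtype.ext
  simp [h]

theorem ret_top : Ret (⊤ : Submodule R M) :=
  ⟨LinearMap.id.codRestrict ⊤ (fun _ => trivial), fun _ => rfl⟩

theorem ret_map {N : Submodule R M} (h : Ret N) {S T : Submodule R N} (hS : IsCompl S T) :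
    Ret (S.map N.subtype) := by
  obtain ⟨p, hp⟩ := h
  have := ret_range (N.subtype ∘ₗ S.subtype) (S.projectionOnto T hS ∘ₗ p) (fun x => by
    simp [hp])
  rwa [LinearMap.range_comp, Submodule.range_subtype] at this

theorem fitting [IsArtinian R M] [IsNoetherian R M] (g : Module.End R M) :
    ∃ n, 1 ≤ n ∧ IsCompl (g ^ n).range (g ^ n).ker := by
  have := (g.eventually_isCompl_ker_pow_range_pow.and (Filter.eventually_ge_atTop 1)).exists
  obtain ⟨n, h, hn⟩ := this
  exact ⟨n, hn, h.symm⟩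

theorem fitting_unit {g : Module.End R M} {n : ℕ} (hn : 1 ≤ n)
    (h : IsCompl (g ^ n).range (g ^ n).ker) (ht : (g ^ n).range = ⊤) : IsUnit g := by
  have hk : (g ^ n).ker = ⊥ := by
    have := h.inf_eq_bot
    rwa [ht, top_inf_eq] at this
  rw [← isUnit_pow_iff (n := n) (by omega), Module.End.isUnit_iff]
  exact ⟨LinearMap.ker_eq_bot.1 hk, LinearMap.range_eq_top.1 ht⟩

theorem exists_min_ret [IsArtinian R M] (P : Submodule R M → Prop) (hP : P ⊤) :
    ∃ N : Submodule R M, Ret N ∧ P N ∧ ∀ N', N' ≤ N → Ret N' → P N' → N' = N := by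
  obtain ⟨N, hN, hm⟩ := IsArtinian.set_has_minimal {N : Submodule R M | Ret N ∧ P N}
    ⟨⊤, ret_top, hP⟩
  refine ⟨N, hN.1, hN.2, fun N' h1 h2 h3 => ?_⟩
  by_contra hne
  exact hm N' ⟨h2, h3⟩ (lt_of_le_of_ne h1 hne)

theorem min_dichotomy [IsArtinian R M] [IsNoetherian R M] {P : Submodule R M → Prop}
    {N : Submodule R M} (hN : Ret N) (hm : ∀ N', N' ≤ N → Ret N' → P N' → N' = N)
    (g : Module.End R N) (hg : ∀ n, P ((g ^ n).range.map N.subtype)) : IsUnit g := by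
  obtain ⟨n, hn, hc⟩ := fitting g
  refine fitting_unit hn hc ?_
  have := hm _ (Submodule.map_subtype_le _ _) (ret_map hN hc) (hg n)
  apply Submodule.map_injective_of_injective N.subtype_injective
  rw [this, Submodule.map_subtype_top]

end Fitting

section KrullSchmidt
variable (R : Type) [Ring R]
/-- strongly indecomposable -/
def Indec (X : Type) [AddCommGroup X] [Module R X] : Prop :=
  Nontrivial X ∧ ∀ g : Module.End R X, IsNilpotent g ∨ IsUnit g

variable {R}
variable {M X Y A B C : Type} [AddCommGroup M] [Module R M] [AddCommGroup X] [Module R X]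
  [AddCommGroup Y] [Module R Y] [AddCommGroup A] [Module R A] [AddCommGroup B] [Module R B]
  [AddCommGroup C] [Module R C]

theorem exists_indec [IsArtinian R M] [IsNoetherian R M] [Nontrivial M] :
    ∃ N : Submodule R M, Ret N ∧ Indec R N := by
  obtain ⟨N, hN, h0, hm⟩ := exists_min_ret (R := R) (M := M) (fun N => N ≠ ⊥) top_ne_bot
  refine ⟨N, hN, Submodule.nontrivial_iff_ne_bot.2 h0, fun g => ?_⟩
  obtain ⟨n, hn, hc⟩ := fitting g
  by_cases hb : (g ^ n).range = ⊥
  · exact Or.inl ⟨n, LinearMap.range_eq_bot.1 hb⟩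
  · refine Or.inr (fitting_unit hn hc ?_)
    have := hm _ (Submodule.map_subtype_le _ _) (ret_map hN hc) (fun h0 => hb (by
        apply Submodule.map_injective_of_injective N.subtype_injective
        rw [h0, Submodule.map_bot]))
    apply Submodule.map_injective_of_injective N.subtype_injective
    rw [this, Submodule.map_subtype_top]

theorem Summ.of_unit (i : X →ₗ[R] A) (p : A →ₗ[R] X) (h : IsUnit (p ∘ₗ i : Module.End R X)) :
    Summ R X A := by
  obtain ⟨u, hu⟩ := h
  refine ⟨i, ((u⁻¹ : (Module.End R X)ˣ) : Module.End R X) ∘ₗ p, fun x => ?_⟩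
  have : ((u⁻¹ : (Module.End R X)ˣ) : Module.End R X) * (p ∘ₗ i) = 1 := by rw [← hu]; simp
  exact LinearMap.congr_fun this x

theorem Indec.prod (hX : Indec R X) (h : Summ R X (A × B)) : Summ R X A ∨ Summ R X B := by
  obtain ⟨i, p, h⟩ := h
  let a : Module.End R X := (p ∘ₗ LinearMap.inl R A B) ∘ₗ (LinearMap.fst R A B ∘ₗ i)
  let b : Module.End R X := (p ∘ₗ LinearMap.inr R A B) ∘ₗ (LinearMap.snd R A B ∘ₗ i)
  have hab : b = 1 - a := by
    rw [eq_sub_iff_add_eq]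
    ext x
    change p (0, (i x).2) + p ((i x).1, 0) = x
    rw [← map_add]
    simpa using h x
  rcases hX.2 a with ha | ha
  · right
    exact Summ.of_unit _ _ (hab ▸ ha.isUnit_one_sub : IsUnit b)
  · left
    exact Summ.of_unit _ _ ha

theorem Indec.add (hX : Indec R X) (h : Add R C X) : Summ R X C := by
  obtain ⟨n, h⟩ := h
  induction n with
  | zero =>
    obtain ⟨i, hi⟩ := h.inj_of
    have := hX.1
    exact absurd (hi.subsingleton) (not_subsingleton X)
  | succ n ih =>
    rcases hX.prod (h.trans (Summ.of_equiv (Fin.consLinearEquiv R (fun _ : Fin (n+1) => C)).symm)) with h | h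
    · exact h
    · exact ih h

theorem Indec.equiv_of_summ (hX : Indec R X) [Nontrivial Y] (h : Summ R Y X) :
    Nonempty (Y ≃ₗ[R] X) := by
  obtain ⟨i, p, h⟩ := h
  rcases hX.2 (i ∘ₗ p) with ⟨n, hn⟩ | hu
  · exfalso
    have h1 : ∀ n y, ((i ∘ₗ p : Module.End R X) ^ n) (i y) = i y := by
      intro n y
      induction n with
      | zero => rfl
      | succ n ih => rw [pow_succ, Module.End.mul_apply]; simpa [h] using ih
    obtain ⟨y, hy⟩ := exists_ne (0 : Y)
    have h2 := h1 n y
    rw [hn] at h2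
    apply hy
    rw [← h y, ← h2]
    simp
  · rw [Module.End.isUnit_iff] at hu
    refine ⟨LinearEquiv.ofBijective i ⟨Function.LeftInverse.injective h, fun x => ?_⟩⟩
    obtain ⟨z, hz⟩ := hu.2 x
    exact ⟨p z, hz⟩

theorem Indec.of_equiv (hX : Indec R X) (e : X ≃ₗ[R] Y) : Indec R Y := by
  have := hX.1
  refine ⟨e.symm.toEquiv.nontrivial, fun g => ?_⟩
  have h := hX.2 (LinearEquiv.conjRingEquiv e.symm g)
  rcases h with h | h
  · left; exact (IsNilpotent.map_iff (LinearEquiv.conjRingEquiv e.symm).injective).1 h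
  · right; simpa using h

theorem mutual_equiv [IsArtinian R A] [IsArtinian R B] (h : Summ R A B) (h' : Summ R B A) :
    Nonempty (A ≃ₗ[R] B) := by
  obtain ⟨i, hi⟩ := h.inj_of
  obtain ⟨j, hj⟩ := h'.inj_of
  have := IsArtinian.surjective_of_injective_endomorphism (i ∘ₗ j) (hi.comp hj)
  refine ⟨LinearEquiv.ofBijective i ⟨hi, fun x => ?_⟩⟩
  obtain ⟨y, hy⟩ := this x
  exact ⟨j y, hy⟩

theorem summ_of_basic [IsArtinian R A] [IsNoetherian R A]
    (hb : ∀ (X : Type) [AddCommGroup X] [Module R X], Summ R (X × X) A → Subsingleton X)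
    (h : ∀ (X : Type) [AddCommGroup X] [Module R X], Indec R X → Summ R X A → Summ R X C) :
    Summ R A C := by
  obtain ⟨N, ⟨hN, hNC⟩, hm⟩ := set_has_maximal_iff_noetherian.2 (inferInstance : IsNoetherian R A)
    {N : Submodule R A | Ret N ∧ Summ R N C} ⟨⊥, ⟨0, fun x => Subsingleton.elim _ _⟩,
      ⟨0, 0, fun x => Subsingleton.elim _ _⟩⟩
  by_cases hT : N = ⊤
  · subst hT
    exact (Summ.of_equiv Submodule.topEquiv.symm).trans hNC
  exfalso
  obtain ⟨p, hp⟩ := hN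
  have hc := LinearMap.isCompl_of_proj hp
  have hne : p.ker ≠ ⊥ := by
    intro h0
    rw [h0] at hc
    exact hT (by simpa using hc.sup_eq_top)
  have := Submodule.nontrivial_iff_ne_bot.2 hne
  obtain ⟨X, hX, hXI⟩ := exists_indec (R := R) (M := p.ker)
  have hXA : Summ R X A := hX.summ.trans (summ_submodule hc.symm)
  obtain ⟨e1, he1⟩ : ∃ e1 : (N × p.ker) ≃ₗ[R] A, ∀ x, e1 x = x.1 + x.2 :=
    ⟨Submodule.prodEquivOfIsCompl _ _ hc, fun _ => rfl⟩
  obtain ⟨C', _, _, ⟨e⟩⟩ := hNC.compl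
  rcases hXI.prod ((h X hXI hXA).trans (Summ.of_equiv e)) with h1 | h1
  · have := hb X ((h1.prod_mono hX.summ).trans (Summ.of_equiv e1))
    have := hXI.1
    exact not_subsingleton X inferInstance
  · obtain ⟨q, hq⟩ := hX
    let f : (N × X) →ₗ[R] A := e1.toLinearMap ∘ₗ LinearMap.prodMap LinearMap.id X.subtype
    have hf : ∀ x, (LinearMap.prodMap LinearMap.id q ∘ₗ e1.symm.toLinearMap) (f x) = x := fun x => by
      simp [f, hq]
    have hfv : ∀ (n : N) (x : X), f (n, x) = (n : A) + ((x : p.ker) : A) := fun n x => by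
      simp [f, he1]
    have hle : N ≤ f.range := fun n hn => ⟨(⟨n, hn⟩, 0), by rw [hfv]; simp⟩
    refine hm f.range ⟨ret_range f _ hf, ?_⟩ (lt_of_le_of_ne hle fun heq => ?_)
    · refine (Summ.of_equiv (LinearEquiv.ofInjective f (Function.LeftInverse.injective hf)).symm).trans ?_
      exact (Summ.refl.prod_mono h1).trans (Summ.of_equiv e.symm)
    · have := hXI.1
      obtain ⟨x, hx⟩ := exists_ne (0 : X)
      have hxN : ((x : p.ker) : A) ∈ N := by
        refine heq.ge ⟨(0, x), ?_⟩
        rw [hfv]; simp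
      have h0 : ((x : p.ker) : A) = 0 := by
        have := Submodule.mem_inf.2 ⟨hxN, (x : p.ker).2⟩
        rwa [hc.inf_eq_bot, Submodule.mem_bot] at this
      exact hx (Subtype.ext (Subtype.ext h0))

end KrullSchmidt
end PSX

namespace PSX
open PS

section Hulls
variable {R : Type} [Ring R] [IsArtinianRing R]
variable {A B A' B' Z Y Z' I Q : Type} [AddCommGroup A] [Module R A] [AddCommGroup B] [Module R B]
  [AddCommGroup Z] [Module R Z] [AddCommGroup Y] [Module R Y] [AddCommGroup Z'] [Module R Z']
  [AddCommGroup I] [Module R I] [AddCommGroup Q] [Module R Q] [AddCommGroup B'] [Module R B']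

theorem pow_fix {M : Type} [AddCommGroup M] [Module R M] (g : Module.End R M) (x : M)
    (h : g x = x) (n : ℕ) : (g ^ n) x = x := by
  induction n with
  | zero => rfl
  | succ n ih => rw [pow_succ, Module.End.mul_apply, h, ih]

theorem hull_step [Module.Finite R I] (hI : Module.Injective R I) (u : A →ₗ[R] I)
    (hu : Function.Injective u) (h : Summ R A Z) {z : Z →ₗ[R] Y} {y : Y →ₗ[R] Z'} (hs : SES z y)
    (hY : Module.Injective R Y) :
    ∃ (H A' : ModuleCat.{0} R) (a : A →ₗ[R] H) (a' : H →ₗ[R] A'), SES a a' ∧ Module.Finite R H ∧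
      Summ R H Y ∧ Summ R A' Z' := by
  obtain ⟨i, p, hip⟩ := h
  obtain ⟨N, hN, hP, hm⟩ := exists_min_ret (R := R) (M := I) (fun N => u.range ≤ N) le_top
  have hNinj : Module.Injective R N := hN.summ.injective hI
  let u' : A →ₗ[R] N := u.codRestrict N (fun x => hP ⟨x, rfl⟩)
  have hu' : Function.Injective u' := fun x y hxy => hu (congrArg Subtype.val hxy)
  obtain ⟨α, hα⟩ := hY.out u' hu' (z ∘ₗ i)
  obtain ⟨β, hβ⟩ := hNinj.out z hs.1 (u' ∘ₗ p)
  have hg : ∀ x, (β ∘ₗ α) (u' x) = u' x := fun x => by simp [hα, hβ, hip]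
  have hunit : IsUnit (β ∘ₗ α : Module.End R N) := by
    refine min_dichotomy (P := fun N => u.range ≤ N) hN hm _ fun n => ?_
    rintro _ ⟨x, rfl⟩
    exact ⟨u' x, ⟨u' x, pow_fix _ _ (hg x) n⟩, rfl⟩
  obtain ⟨v, hv⟩ := hunit
  let w : Module.End R N := ((v⁻¹ : (Module.End R N)ˣ) : Module.End R N)
  have hw : ∀ x, w (β (α x)) = x := by
    intro x
    have : w * (β ∘ₗ α) = 1 := by rw [← hv]; simp [w]
    exact LinearMap.congr_fun this x
  have hwu : ∀ x, w (u' x) = u' x := by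
    intro x
    conv_lhs => rw [← hg x]
    exact hw _
  have hse := ses_of_inj u' hu'
  obtain ⟨α', hα'⟩ := hse.desc (y ∘ₗ α) (fun x => by simp [hα, hs.2.1.apply_apply_eq_zero])
  obtain ⟨β', hβ'⟩ := hs.desc (u'.range.mkQ ∘ₗ w ∘ₗ β) (fun x => by
    simp only [LinearMap.comp_apply, hβ, hwu]
    exact hse.2.1.apply_apply_eq_zero _)
  refine ⟨ModuleCat.of R N, ModuleCat.of R (N ⧸ u'.range), u', u'.range.mkQ, hse,
    inferInstanceAs (Module.Finite R N), ⟨α, w ∘ₗ β, hw⟩, ⟨α', β', fun x => ?_⟩⟩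
  obtain ⟨t, rfl⟩ := hse.2.2 x
  rw [hα', LinearMap.comp_apply, hβ']
  simp only [LinearMap.comp_apply, hw]

theorem cover_step [Module.Finite R Q] (hQ : Module.Projective R Q) {a : A →ₗ[R] Q} {b : Q →ₗ[R] B}
    (hs : SES a b) (h : Summ R B' B) :
    ∃ (A' H : ModuleCat.{0} R) (a' : A' →ₗ[R] H) (b' : H →ₗ[R] B'), SES a' b' ∧
      Summ R H Q ∧ Summ R A' A := by
  obtain ⟨i, p, hip⟩ := h
  have hps : Function.Surjective (p ∘ₗ b) :=
    (Function.RightInverse.surjective hip).comp hs.2.2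
  obtain ⟨N, hN, hP, hm⟩ := exists_min_ret (R := R) (M := Q) (fun N => N.map (p ∘ₗ b) = ⊤) (by
    rw [Submodule.map_top]; exact LinearMap.range_eq_top.2 hps)
  have hNproj : Module.Projective R N := hN.summ.proj hQ
  let v : N →ₗ[R] B' := (p ∘ₗ b) ∘ₗ N.subtype
  have hv : Function.Surjective v := by
    rw [← LinearMap.range_eq_top, LinearMap.range_comp, Submodule.range_subtype, hP]
  obtain ⟨α, hα⟩ := Module.projective_lifting_property b (i ∘ₗ v) hs.2.2
  obtain ⟨β, hβ⟩ := Module.projective_lifting_property v (p ∘ₗ b) hv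
  replace hα : ∀ x, b (α x) = i (v x) := fun x => LinearMap.congr_fun hα x
  replace hβ : ∀ x, v (β x) = p (b x) := fun x => LinearMap.congr_fun hβ x
  have hg : ∀ x, v ((β ∘ₗ α) x) = v x := fun x =>
    (hβ (α x)).trans (by rw [hα, hip])
  have hgn : ∀ n x, v (((β ∘ₗ α : Module.End R N) ^ n) x) = v x := by
    intro n
    induction n with
    | zero => exact fun x => rfl
    | succ n ih => intro x; rw [pow_succ, Module.End.mul_apply, ih, hg]
  have hunit : IsUnit (β ∘ₗ α : Module.End R N) := by
    refine min_dichotomy (P := fun N => N.map (p ∘ₗ b) = ⊤) hN hm _ fun n => ?_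
    rw [eq_top_iff]
    intro x _
    obtain ⟨t, rfl⟩ := hv x
    rw [← hgn n t]
    exact ⟨_, ⟨_, ⟨t, rfl⟩, rfl⟩, rfl⟩
  obtain ⟨s, hs'⟩ := hunit
  let w : Module.End R N := ((s⁻¹ : (Module.End R N)ˣ) : Module.End R N)
  have hw : ∀ x, w (β (α x)) = x := by
    intro x
    have : w * (β ∘ₗ α) = 1 := by rw [← hs']; simp [w]
    exact LinearMap.congr_fun this x
  have hw2 : ∀ x, (β ∘ₗ α) (w x) = x := by
    intro x
    have : (β ∘ₗ α) * w = 1 := by rw [← hs']; simp [w]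
    exact LinearMap.congr_fun this x
  have hwv : ∀ x, v (w x) = v x := by
    intro x
    rw [← hg (w x), hw2]
  have hse := ses_of_surj v hv
  obtain ⟨α', hα'⟩ := hs.lft (α ∘ₗ v.ker.subtype) (fun x => by
    have : v x = 0 := x.2
    simp [hα, this])
  obtain ⟨β', hβ'⟩ := hse.lft (w ∘ₗ β ∘ₗ a) (fun x => by
    simp only [LinearMap.comp_apply, hwv, hβ, hs.2.1.apply_apply_eq_zero, map_zero])
  refine ⟨ModuleCat.of R v.ker, ModuleCat.of R N, v.ker.subtype, v, hse, hN.summ,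
    ⟨α', β', fun x => ?_⟩⟩
  apply hse.1
  rw [hβ']
  simp only [LinearMap.comp_apply, hα', hw]

theorem ret_extend {N : Submodule R A} [Module.Finite R A] (hN : Ret N) (hT : N ≠ ⊤) :
    ∃ N' X : Submodule R A, N < N' ∧ Ret N' ∧ Ret X ∧ Indec R X ∧ Nonempty (N' ≃ₗ[R] N × X) := by
  obtain ⟨p, hp⟩ := hN
  have hc := LinearMap.isCompl_of_proj hp
  have hne : p.ker ≠ ⊥ := by
    intro h0
    rw [h0] at hc
    exact hT (by simpa using hc.sup_eq_top)
  have := Submodule.nontrivial_iff_ne_bot.2 hne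
  obtain ⟨X, hX, hXI⟩ := exists_indec (R := R) (M := p.ker)
  obtain ⟨e1, he1⟩ : ∃ e1 : (N × p.ker) ≃ₗ[R] A, ∀ x, e1 x = x.1 + x.2 :=
    ⟨Submodule.prodEquivOfIsCompl _ _ hc, fun _ => rfl⟩
  obtain ⟨q, hq⟩ := hX
  let f : (N × X) →ₗ[R] A := e1.toLinearMap ∘ₗ LinearMap.prodMap LinearMap.id X.subtype
  have hf : ∀ x, (LinearMap.prodMap LinearMap.id q ∘ₗ e1.symm.toLinearMap) (f x) = x := fun x => by
    simp [f, hq]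
  have hfv : ∀ (n : N) (x : X), f (n, x) = (n : A) + ((x : p.ker) : A) := fun n x => by
    simp [f, he1]
  have hle : N ≤ f.range := fun n hn => ⟨(⟨n, hn⟩, 0), by rw [hfv]; simp⟩
  let g : X →ₗ[R] A := f ∘ₗ LinearMap.inr R N X
  have hg : ∀ x, (LinearMap.snd R N X ∘ₗ LinearMap.prodMap LinearMap.id q ∘ₗ e1.symm.toLinearMap) (g x) = x :=
    fun x => by
      have := congrArg Prod.snd (hf (0, x))
      exact this
  let eg : X ≃ₗ[R] g.range := LinearEquiv.ofInjective g (Function.LeftInverse.injective hg)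
  refine ⟨f.range, g.range, lt_of_le_of_ne hle fun heq => ?_, ret_range f _ hf, ret_range g _ hg,
    hXI.of_equiv eg, ⟨(LinearEquiv.ofInjective f (Function.LeftInverse.injective hf)).symm.trans
      ((LinearEquiv.refl R N).prodCongr eg)⟩⟩
  have := hXI.1
  obtain ⟨x, hx⟩ := exists_ne (0 : X)
  have hxN : ((x : p.ker) : A) ∈ N := by
    refine heq.ge ⟨(0, x), ?_⟩
    rw [hfv]; simp
  have h0 : ((x : p.ker) : A) = 0 := by
    have := Submodule.mem_inf.2 ⟨hxN, (x : p.ker).2⟩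
    rwa [hc.inf_eq_bot, Submodule.mem_bot] at this
  exact hx (Subtype.ext (Subtype.ext h0))

theorem ret_induct [Module.Finite R A] (P : Submodule R A → Prop) (h0 : P ⊥)
    (hs : ∀ N X N' : Submodule R A, P N → Ret X → Indec R X → Nonempty (N' ≃ₗ[R] N × X) → P N') :
    P ⊤ := by
  obtain ⟨N, ⟨hN, hNP⟩, hm⟩ := set_has_maximal_iff_noetherian.2 (inferInstance : IsNoetherian R A)
    {N : Submodule R A | Ret N ∧ P N} ⟨⊥, ⟨0, fun x => Subsingleton.elim _ _⟩, h0⟩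
  by_cases hT : N = ⊤
  · rwa [hT] at hNP
  obtain ⟨N', X, h1, h2, h3, h4, h5⟩ := ret_extend hN hT
  exact absurd h1 (hm N' ⟨h2, hs N X N' hNP h3 h4 h5⟩)

theorem add_of_indec [Module.Finite R A]
    (h : ∀ X : Submodule R A, Ret X → Indec R X → Add R Z X) : Add R Z A := by
  have := ret_induct (R := R) (A := A) (fun N => Add R Z N) ⟨0, 0, 0, fun x => Subsingleton.elim _ _⟩
    (fun N X N' hN hX hI ⟨e⟩ => (hN.prod (h X hX hI)).summ (Summ.of_equiv e))
  exact this.summ (Summ.of_equiv Submodule.topEquiv.symm)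

theorem finite_indec (A : Type) [AddCommGroup A] [Module R A] [Module.Finite R A] :
    ∃ s : Set (Submodule R A), s.Finite ∧ (∀ S ∈ s, Ret S ∧ Indec R S) ∧
      ∀ X : Submodule R A, Ret X → Indec R X → ∃ S ∈ s, Nonempty (X ≃ₗ[R] S) := by
  have := ret_induct (R := R) (A := A) (fun N =>
    ∃ s : Set (Submodule R A), s.Finite ∧ (∀ S ∈ s, Ret S ∧ Indec R S) ∧
      ∀ X : Submodule R A, Indec R X → Summ R X N → ∃ S ∈ s, Nonempty (X ≃ₗ[R] S)) ?_ ?_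
  · obtain ⟨s, h1, h2, h3⟩ := this
    exact ⟨s, h1, h2, fun X hX hI => h3 X hI (hX.summ.trans (Summ.of_equiv Submodule.topEquiv.symm))⟩
  · refine ⟨∅, Set.finite_empty, by simp, fun X hI hX => ?_⟩
    obtain ⟨i, hi⟩ := hX.inj_of
    have := hI.1
    exact absurd hi.subsingleton (not_subsingleton X)
  · rintro N X N' ⟨s, h1, h2, h3⟩ hX hI ⟨e⟩
    refine ⟨insert X s, h1.insert X, ?_, fun Y hY hYN => ?_⟩
    · rintro S (rfl | hS)
      · exact ⟨hX, hI⟩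
      · exact h2 S hS
    · rcases hY.prod (hYN.trans (Summ.of_equiv e)) with h | h
      · obtain ⟨S, hS, h⟩ := h3 Y hY h
        exact ⟨S, Or.inr hS, h⟩
      · have := hY.1
        exact ⟨X, Or.inl rfl, hI.equiv_of_summ h⟩

theorem proj_add [Module.Finite R A] (hA : Module.Projective R A) : Add R R A := by
  obtain ⟨n, f, hf⟩ := Module.Finite.exists_fin' R A
  obtain ⟨g, hg⟩ := Module.projective_lifting_property f LinearMap.id hf
  exact ⟨n, g, f, fun x => LinearMap.congr_fun hg x⟩

theorem projinj_add {P : ModuleCat.{0} R} (hP : IsMaxProjInjSummand P) [Module.Finite R A]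
    (h1 : Module.Projective R A) (h2 : Module.Injective R A) : Add R P A := by
  refine add_of_indec fun X hX hI => ?_
  have h3 := hX.summ.proj h1
  have h4 := hX.summ.injective h2
  have h5 : Module.Finite R X := hX.summ.finite
  have h6 : Summ R X R := hI.add (proj_add h3)
  exact memAdd_iff.1 (hP.2.2 (ModuleCat.of R X) (isSummand_iff.2 h6) ⟨h3, h4⟩)

end Hulls

section DomChain
variable {R : Type} [Ring R]

theorem domch {d : ℕ} (h : DomdimGE R (d+1)) : ∃ W, Ch (R := R) ProjInj (d+1) (reg R) W := by
  obtain ⟨Y, g, f, hg, hgf, he, hi, hp⟩ := h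
  have sesr : ∀ {A B C : Type} [AddCommGroup A] [AddCommGroup B] [AddCommGroup C] [Module R A]
      [Module R B] [Module R C] (a : A →ₗ[R] B) (b : B →ₗ[R] C), Function.Injective a →
      Function.Exact a b → SES a b.rangeRestrict := by
    intro A B C _ _ _ _ _ _ a b ha hab
    refine ⟨ha, fun x => ?_, LinearMap.surjective_rangeRestrict _⟩
    rw [← hab x, ← LinearMap.mem_ker, LinearMap.ker_rangeRestrict, LinearMap.mem_ker]
  have key : ∀ n j, j + n ≤ d → ∃ W, Ch ProjInj n (ModuleCat.of R (f j).range) W := by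
    intro n
    induction n with
    | zero => exact fun j _ => ⟨_, Ch.zero (LinearEquiv.refl R _)⟩
    | succ n ih =>
      intro j hj
      obtain ⟨W, hW⟩ := ih (j+1) (by omega)
      refine ⟨W, Ch.succ (Q := Y (j+1)) (A' := ModuleCat.of R (f (j+1)).range)
        (f j).range.subtype (f (j+1)).rangeRestrict (sesr _ _ Subtype.val_injective ?_)
        ⟨hp _ (by omega), hi _⟩ hW⟩
      intro x
      rw [he j x]
      simp
  obtain ⟨W, hW⟩ := key d 0 (by omega)
  exact ⟨W, Ch.succ (Q := Y 0) (A' := ModuleCat.of R (f 0).range) g (f 0).rangeRestrict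
    (sesr _ _ hg hgf) ⟨hp 0 (by omega), hi 0⟩ hW⟩

theorem dreg_add (K : Type) [Field K] {R : Type} [Ring R] [Algebra K R] [FiniteDimensional K R] {W : Type} [AddCommGroup W] [Module R W] [Module.Finite R W]
    (hW : Module.Injective R W) : Add R (Dreg K R) W := by
  obtain ⟨n, u, hu⟩ := dreg_cogen K (R := R) W
  obtain ⟨r, hr⟩ := hW.out u hu LinearMap.id
  exact ⟨n, u, r, hr⟩

theorem dom_step (K : Type) [Field K] {R : Type} [Ring R] [Algebra K R] [FiniteDimensional K R] {P : ModuleCat.{0} R} (hP : IsMaxProjInjSummand P) {n : ℕ} {Z W : ModuleCat.{0} R}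
    (c : Ch (R := R) ProjInj n Z W) : ∀ A : ModuleCat.{0} R, Module.Finite R A → Summ R A Z →
    ∃ A' : ModuleCat.{0} R, Module.Finite R A' ∧ Ch (MemAdd P) n A A' := by
  have := artin K (R := R)
  induction c with
  | zero e => exact fun A fA h => ⟨A, fA, Ch.zero (LinearEquiv.refl R A)⟩
  | succ f g hs hq c ih =>
    intro A fA h
    obtain ⟨n, u, hu⟩ := dreg_cogen K (R := R) A
    have := dreg_finite K (R := R)
    obtain ⟨H, A', a, a', hs', fH, h1, h2⟩ := hull_step (inj_pi (dreg_inj K) n) u hu h hs hq.2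
    have fA' : Module.Finite R A' := Module.Finite.of_surjective a' hs'.2.2
    obtain ⟨A'', h3, h4⟩ := ih A' fA' h2
    exact ⟨A'', h3, Ch.succ a a' hs' (memAdd_iff.2 (projinj_add hP (h1.proj hq.1) (h1.injective hq.2))) h4⟩

theorem inj_of_ez {E : ModuleCat.{0} R} (h : ∀ N, EZ N E 1) : Module.Injective R E := by
  refine ⟨fun X Y _ _ _ _ f hf g => ?_⟩
  obtain ⟨v, hv⟩ := ez_extend (A := ModuleCat.of R X) (B := ModuleCat.of R Y)
    (C := ModuleCat.of R (Y ⧸ f.range)) (ses_of_inj f hf) (h _) g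
  exact ⟨v, fun x => LinearMap.congr_fun hv x⟩

theorem fact1 (K : Type) [Field K] {R : Type} [Ring R] [Algebra K R] [FiniteDimensional K R] {d : ℕ} (hAG : IsAuslanderGorenstein R d) {P : ModuleCat.{0} R}
    (hP : IsMaxProjInjSummand P) (A : ModuleCat.{0} R) (hA : Summ R A R) :
    ∃ E : ModuleCat.{0} R, Module.Finite R E ∧ Module.Injective R E ∧ Ch (MemAdd P) (d+1) A E := by
  obtain ⟨W, hW⟩ := domch hAG.2
  obtain ⟨E, fE, hE⟩ := dom_step K hP hW A hA.finite hA
  refine ⟨E, fE, inj_of_ez fun N => ?_, hE⟩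
  refine hE.ezr_right (N := N) (fun Q hQ j hj => ?_) 0 (fun j hj => ?_) 1 (by omega)
  · obtain ⟨p, rfl⟩ : ∃ p, j = p + 1 := ⟨j - 1, by omega⟩
    exact ez_inj ((memAdd_iff.1 hQ).injective hP.2.1.2) p
  · exact ezr_summ (M' := reg R) (isSummand_iff.2 hA) (id_ez hAG.1 N j (by omega))

end DomChain
end PSX

namespace PSX
open PS

section ChStuff
variable {R : Type} [Ring R] {P A B : ModuleCat.{0} R} {n : ℕ}

theorem Ch.projinj_left (hP : ProjInj P) (c : Ch (MemAdd P) n A B) (hB : ProjInj B) : ProjInj A := by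
  induction c with
  | zero e => exact ⟨(Summ.of_equiv e).proj hB.1, (Summ.of_equiv e).injective hB.2⟩
  | @succ n A Q A' B f g hs hq c ih =>
    have h1 := ih hB
    have h1p := h1.1
    obtain ⟨s, h2⟩ := Module.projective_lifting_property g LinearMap.id hs.2.2
    obtain ⟨e⟩ := hs.split_right s (fun x => LinearMap.congr_fun h2 x)
    have h3 : Summ R A Q := Summ.fst.trans (Summ.of_equiv e.symm)
    exact ⟨h3.proj ((memAdd_iff.1 hq).proj hP.1), h3.injective ((memAdd_iff.1 hq).injective hP.2)⟩

theorem Ch.projinj_right (hP : ProjInj P) (c : Ch (MemAdd P) n A B) (hB : ProjInj A) : ProjInj B := by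
  induction c with
  | zero e => exact ⟨(Summ.of_equiv e.symm).proj hB.1, (Summ.of_equiv e.symm).injective hB.2⟩
  | @succ n A Q A' B f g hs hq c ih =>
    apply ih
    obtain ⟨s, h2⟩ := hB.2.out f hs.1 LinearMap.id
    obtain ⟨e⟩ := hs.split_left s h2
    have h3 : Summ R A' Q := Summ.snd.trans (Summ.of_equiv e.symm)
    exact ⟨h3.proj ((memAdd_iff.1 hq).proj hP.1), h3.injective ((memAdd_iff.1 hq).injective hP.2)⟩

theorem Ch.cover [IsArtinianRing R] [Module.Finite R P] (hP : ProjInj P) {E : ModuleCat.{0} R}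
    (c : Ch (MemAdd P) n A E) : ∀ E' : ModuleCat.{0} R, Summ R E' E →
      ∃ A' : ModuleCat.{0} R, Ch (MemAdd P) n A' E' ∧ Summ R A' A := by
  induction c with
  | zero e => exact fun E' h => ⟨E', Ch.zero (LinearEquiv.refl R _), h.trans (Summ.of_equiv e.symm)⟩
  | @succ n A Q A' B f g hs hq c ih =>
    intro E' h
    obtain ⟨A'', h1, h2⟩ := ih E' h
    have hq' := memAdd_iff.1 hq
    have : Module.Finite R Q := hq'.finite
    obtain ⟨A0, H, a, b, hs', h3, h4⟩ := cover_step (hq'.proj hP.1) hs h2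
    exact ⟨A0, Ch.succ a b hs' (memAdd_iff.2 (hq'.summ h3)) h1, h4⟩

theorem max_finite (hP : IsMaxProjInjSummand P) : Module.Finite R P :=
  have : Module.Finite R (reg R) := inferInstanceAs (Module.Finite R R)
  (isSummand_iff.1 hP.1).finite

end ChStuff

section Simples
variable {R : Type} [Ring R] 
variable {A E E' S S' : Type} [AddCommGroup A] [Module R A] [AddCommGroup E] [Module R E]
  [AddCommGroup E'] [Module R E'] [AddCommGroup S] [Module R S] [AddCommGroup S'] [Module R S']

theorem soc_exists [IsArtinianRing R] [Module.Finite R E] [Nontrivial E] :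
    ∃ S : Submodule R E, IsSimpleModule R S := by
  obtain ⟨S, hS⟩ := IsAtomic.exists_atom (Submodule R E)
  exact ⟨S, isSimpleModule_iff_isAtom.2 hS⟩

theorem top_exists [IsArtinianRing R] [IsSimpleModule R S] :
    ∃ N : Submodule R R, Ret N ∧ Indec R N ∧ ∃ f : N →ₗ[R] S, f ≠ 0 := by
  have := IsSimpleModule.nontrivial R S
  obtain ⟨x, hx⟩ := exists_ne (0 : S)
  let φ : R →ₗ[R] S := LinearMap.toSpanSingleton R S x
  obtain ⟨N, hN, ⟨y, hy, hy0⟩, hm⟩ := exists_min_ret (R := R) (M := R) (fun N => ∃ y ∈ N, φ y ≠ 0)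
    ⟨1, trivial, by simpa [φ] using hx⟩
  have hne : (⟨y, hy⟩ : N) ≠ 0 := by
    intro h
    have : y = 0 := congrArg Subtype.val h
    exact hy0 (by rw [this, map_zero])
  have key : ∀ U V : Submodule R N, IsCompl U V → (∃ y ∈ U, φ y ≠ 0) → U = ⊤ := by
    rintro U V h ⟨u, hu, hu0⟩
    have := hm (U.map N.subtype) (Submodule.map_subtype_le _ _) (ret_map hN h) ⟨u, ⟨u, hu, rfl⟩, hu0⟩
    rw [eq_top_iff]
    intro z _
    have hz : (z : R) ∈ U.map N.subtype := by rw [this]; exact z.2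
    obtain ⟨w, hw, hwz⟩ := hz
    rwa [← (Subtype.ext hwz : w = z)]
  refine ⟨N, hN, ⟨⟨⟨y, hy⟩, 0, hne⟩, fun g => ?_⟩, φ ∘ₗ N.subtype, fun h => hy0 ?_⟩
  · obtain ⟨n, hn, hc⟩ := fitting g
    have ht : (⟨y, hy⟩ : N) ∈ (g ^ n).range ⊔ (g ^ n).ker := by rw [hc.sup_eq_top]; trivial
    obtain ⟨a, ha, b, hb, hab⟩ := Submodule.mem_sup.1 ht
    by_cases h0 : φ a = 0
    · left
      have hb0 : φ b ≠ 0 := by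
        intro hb0
        apply hy0
        have : y = a + b := (congrArg Subtype.val hab).symm
        rw [this, map_add, h0, hb0, add_zero]
      have := key _ _ hc.symm ⟨b, hb, hb0⟩
      exact ⟨n, LinearMap.ker_eq_top.1 this⟩
    · right
      exact fitting_unit hn hc (key _ _ hc ⟨a, ha, h0⟩)
  · exact LinearMap.congr_fun h (⟨y, hy⟩ : N)

theorem top_unique (hA : Indec R A) (hp : Module.Projective R A) [IsSimpleModule R S]
    [IsSimpleModule R S'] (f : A →ₗ[R] S) (f' : A →ₗ[R] S') (hf : f ≠ 0) (hf' : f' ≠ 0) :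
    Nonempty (S ≃ₗ[R] S') := by
  have hs := LinearMap.surjective_of_ne_zero hf
  by_cases hk : ∀ x, f x = 0 → f' x = 0
  · obtain ⟨ψ, hψ⟩ := (ses_of_surj f hs).desc f' (fun x => hk _ x.2)
    have h0 : ψ ≠ 0 := by
      rintro rfl
      exact hf' (LinearMap.ext fun x => (hψ x).symm)
    exact ⟨LinearEquiv.ofBijective ψ (LinearMap.bijective_of_ne_zero h0)⟩
  · exfalso
    push Not at hk
    obtain ⟨x, hx, hx'⟩ := hk
    have h0 : f' ∘ₗ f.ker.subtype ≠ 0 := fun h => hx' (LinearMap.congr_fun h (⟨x, hx⟩ : f.ker))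
    obtain ⟨h, hh⟩ := Module.projective_lifting_property _ f' (LinearMap.surjective_of_ne_zero h0)
    replace hh : ∀ x, f' (h x) = f' x := fun x => LinearMap.congr_fun hh x
    let g : Module.End R A := f.ker.subtype ∘ₗ h
    have hg : ∀ x, f' (g x) = f' x := hh
    have hg0 : ∀ x, f (g x) = 0 := fun x => (h x).2
    rcases hA.2 g with ⟨n, hn⟩ | hu
    · have h1 : ∀ n x, f' ((g ^ n) x) = f' x := by
        intro n
        induction n with
        | zero => exact fun x => rfl
        | succ n ih => intro x; rw [pow_succ, Module.End.mul_apply, ih, hg]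
      have := h1 n x
      rw [hn] at this
      exact hx' (this.symm.trans (map_zero f'))
    · have hb := (Module.End.isUnit_iff _).1 hu
      refine hf (LinearMap.ext fun x => ?_)
      obtain ⟨t, rfl⟩ := hb.2 x
      exact hg0 t

theorem env_summ (hE : Indec R E) (h1 : Module.Injective R E) (h2 : Module.Injective R E')
    [Nontrivial S] (u : S →ₗ[R] E) (hu : Function.Injective u) (u' : S →ₗ[R] E')
    (hu' : Function.Injective u') : Summ R E E' := by
  obtain ⟨α, hα⟩ := h2.out u hu u'
  obtain ⟨β, hβ⟩ := h1.out u' hu' u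
  have hfix : ∀ x, (β ∘ₗ α) (u x) = u x := fun x => (congrArg β (hα x)).trans (hβ x)
  refine Summ.of_unit α β ((hE.2 (β ∘ₗ α)).resolve_left ?_)
  rintro ⟨n, hn⟩
  obtain ⟨x, hx⟩ := exists_ne (0 : S)
  have h3 : ∀ n, ((β ∘ₗ α : Module.End R E) ^ n) (u x) = u x := by
    intro n
    induction n with
    | zero => rfl
    | succ n ih => rw [pow_succ, Module.End.mul_apply, hfix, ih]
  have := h3 n
  rw [hn] at this
  exact hx (hu (this.symm.trans (map_zero u).symm))

end Simples

section Bij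
variable {R : Type} [Ring R] [IsArtinianRing R]

/-- the indecomposable injective `E` corresponds to the indecomposable projective `A` -/
structure Rel (P : ModuleCat.{0} R) (d : ℕ) (A E : ModuleCat.{0} R) : Prop where
  sA : Summ R A R
  iA : Indec R A
  fE : Module.Finite R E
  iE : Indec R E
  jE : Module.Injective R E
  h : Nonempty (A ≃ₗ[R] E) ∨
    (¬ Module.Injective R A ∧ ¬ Module.Projective R E ∧ Ch (MemAdd P) (d+1) A E)

theorem rel_inj {P : ModuleCat.{0} R} {d : ℕ} (hP : IsMaxProjInjSummand P)
    {A E A' E' : ModuleCat.{0} R} (h : Rel P d A E)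
    (h' : Rel P d A' E') (e : E ≃ₗ[R] E') : Nonempty (A ≃ₗ[R] A') := by
  have pA : Module.Projective R A := h.sA.proj inferInstance
  have pA' : Module.Projective R A' := h'.sA.proj inferInstance
  rcases h.h with ⟨⟨e1⟩⟩ | ⟨h1, h2, h3⟩
  · rcases h'.h with ⟨⟨e2⟩⟩ | ⟨h1', h2', h3'⟩
    · exact ⟨(e1.trans e).trans e2.symm⟩
    · exact absurd ((Summ.of_equiv (e1.trans e).symm).proj pA) h2'
  · rcases h'.h with ⟨⟨e2⟩⟩ | ⟨h1', h2', h3'⟩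
    · exact absurd ((Summ.of_equiv (e2.trans e.symm).symm).proj pA') h2
    · have := h3.schanuel' hP.2.1 h3' (Add.of_summ ((Summ.of_equiv e).trans Summ.fst))
      rcases h.iA.prod (h.iA.add this) with h5 | h5
      · have := h.iA.1
        exact h'.iA.equiv_of_summ h5
      · exact absurd (h5.injective hP.2.1.2) h1

theorem rel_summ {P : ModuleCat.{0} R} {d : ℕ} (hP : IsMaxProjInjSummand P)
    {A E G : ModuleCat.{0} R} (h : Rel P d A E) (c : Ch (MemAdd P) (d+1) (reg R) G) :
    Summ R E (G × P) := by
  have pA : Module.Projective R A := h.sA.proj inferInstance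
  have := h.fE
  rcases h.h with ⟨⟨e1⟩⟩ | ⟨h1, h2, h3⟩
  · exact (h.iE.add (projinj_add hP ((Summ.of_equiv e1.symm).proj pA) h.jE)).trans Summ.snd
  · exact h.iE.add (h3.schanuel hP.2.1 c (Add.of_summ ((show Summ R A (reg R) from h.sA).trans Summ.fst)))

theorem rel_exists (K : Type) [Field K] {R : Type} [Ring R] [Algebra K R] [FiniteDimensional K R]
    {d : ℕ} (hAG : IsAuslanderGorenstein R d) {P : ModuleCat.{0} R}
    (hP : IsMaxProjInjSummand P) (A : ModuleCat.{0} R) (hA : Summ R A R) (iA : Indec R A) :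
    ∃ E, Rel P d A E := by
  have := artin K (R := R)
  have pA : Module.Projective R A := hA.proj inferInstance
  have fA : Module.Finite R A := hA.finite
  by_cases hi : Module.Injective R A
  · exact ⟨A, hA, iA, fA, iA, hi, Or.inl ⟨LinearEquiv.refl R A⟩⟩
  obtain ⟨E, fE, jE, c⟩ := fact1 K hAG hP A hA
  have hnp : ¬ Module.Projective R E := fun h => hi (c.projinj_left hP.2.1 ⟨h, jE⟩).2
  obtain ⟨X, hX, iX, hXp⟩ : ∃ X : Submodule R E, Ret X ∧ Indec R X ∧ ¬ Module.Projective R X := by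
    by_contra hcon
    push Not at hcon
    refine hnp (Add.proj (X := R) (add_of_indec fun X hX iX => ?_) inferInstance)
    have : Module.Finite R X := hX.summ.finite
    exact proj_add (hcon X hX iX)
  have := max_finite hP
  obtain ⟨A', c', h1⟩ := c.cover hP.2.1 (ModuleCat.of R X) hX.summ
  refine ⟨ModuleCat.of R X, hA, iA, hX.summ.finite, iX, hX.summ.injective jE, Or.inr ⟨hi, hXp, ?_⟩⟩
  have : Nontrivial A' := by
    by_contra hA'
    have hA'' := not_nontrivial_iff_subsingleton.1 hA'
    refine hXp (c'.projinj_right hP.2.1 ⟨?_, ?_⟩).1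
    · exact Module.Projective.of_split (R := R) (M := R) 0 0 (LinearMap.ext fun x => Subsingleton.elim _ _)
    · exact ⟨fun X Y _ _ _ _ f hf g => ⟨0, fun x => Subsingleton.elim _ _⟩⟩
  obtain ⟨e⟩ := iA.equiv_of_summ h1
  exact c'.equiv_left e.symm

end Bij

section Pigeon
variable {R : Type} [Ring R] [IsArtinianRing R]

/-- indecomposable projectives up to isomorphism -/
def indSetoid (R : Type) [Ring R] : Setoid {N : Submodule R R // Ret N ∧ Indec R N} where
  r X Y := Nonempty (X.1 ≃ₗ[R] Y.1)
  iseqv := ⟨fun _ => ⟨LinearEquiv.refl R _⟩, fun ⟨e⟩ => ⟨e.symm⟩, fun ⟨e⟩ ⟨e'⟩ => ⟨e.trans e'⟩⟩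

theorem ind_finite : Finite (Quotient (indSetoid R)) := by
  obtain ⟨s, h1, h2, h3⟩ := finite_indec (R := R) R
  have := h1.to_subtype
  refine Finite.of_surjective (fun S : s => Quotient.mk (indSetoid R) ⟨S.1, h2 _ S.2⟩) fun q => ?_
  induction q using Quotient.inductionOn with
  | h X =>
    obtain ⟨S, hS, ⟨e⟩⟩ := h3 X.1 X.2.1 X.2.2
    exact ⟨⟨S, hS⟩, Quotient.sound ⟨e.symm⟩⟩

theorem simple_embeds (K : Type) [Field K] {R : Type} [Ring R] [Algebra K R] [FiniteDimensional K R]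
    {d : ℕ} (hAG : IsAuslanderGorenstein R d) {P : ModuleCat.{0} R}
    (hP : IsMaxProjInjSummand P) (S : Type) [AddCommGroup S] [Module R S] [IsSimpleModule R S] :
    ∃ (A E : ModuleCat.{0} R) (u : S →ₗ[R] E), Rel P d A E ∧ Function.Injective u := by
  have := artin K (R := R)
  have hfin := ind_finite (R := R)
  have tot : ∀ X : {N : Submodule R R // Ret N ∧ Indec R N},
      ∃ (Y : {N : Submodule R R // Ret N ∧ Indec R N}) (E : ModuleCat.{0} R) (T : Submodule R E)
        (f : Y.1 →ₗ[R] T), Rel P d (ModuleCat.of R X.1) E ∧ IsSimpleModule R T ∧ f ≠ 0 := by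
    intro X
    obtain ⟨E, hE⟩ := rel_exists K hAG hP (ModuleCat.of R X.1) X.2.1.summ X.2.2
    have := hE.fE
    have := hE.iE.1
    obtain ⟨T, hT⟩ := soc_exists (R := R) (E := E)
    obtain ⟨N, h1, h2, f, hf⟩ := top_exists (R := R) (S := T)
    exact ⟨⟨N, h1, h2⟩, E, T, f, hE, hT, hf⟩
  choose F E T f hR hT hf using tot
  have hproj : ∀ X : {N : Submodule R R // Ret N ∧ Indec R N}, Module.Projective R X.1 :=
    fun X => X.2.1.summ.proj inferInstance
  have uniq : ∀ (X Y : {N : Submodule R R // Ret N ∧ Indec R N}) (S S' : Type) [AddCommGroup S]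
      [Module R S] [AddCommGroup S'] [Module R S'] [IsSimpleModule R S] [IsSimpleModule R S']
      (f : X.1 →ₗ[R] S) (f' : Y.1 →ₗ[R] S'), f ≠ 0 → f' ≠ 0 → (X.1 ≃ₗ[R] Y.1) →
      Nonempty (S ≃ₗ[R] S') := by
    intro X Y S S' _ _ _ _ _ _ f f' hf hf' e
    refine top_unique X.2.2 (hproj X) f (f' ∘ₗ e.toLinearMap) hf fun h => hf' ?_
    refine LinearMap.ext fun y => ?_
    have := LinearMap.congr_fun h (e.symm y)
    simpa using this
  let G : Quotient (indSetoid R) → Quotient (indSetoid R) := fun q => Quotient.mk _ (F q.out)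
  have hG : Function.Injective G := by
    intro p q hpq
    obtain ⟨e⟩ : Nonempty ((F p.out).1 ≃ₗ[R] (F q.out).1) := Quotient.exact hpq
    have := hT p.out
    have := hT q.out
    obtain ⟨e'⟩ := uniq _ _ _ _ (f p.out) (f q.out) (hf _) (hf _) e
    have := IsSimpleModule.nontrivial R (T p.out)
    have hs : Summ R (E p.out) (E q.out) := env_summ (hR _).iE (hR _).jE (hR _).jE
      (T p.out).subtype Subtype.val_injective ((T q.out).subtype ∘ₗ e'.toLinearMap)
      (Subtype.val_injective.comp e'.injective)
    have := (hR p.out).iE.1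
    obtain ⟨e2⟩ := (hR q.out).iE.equiv_of_summ hs
    have h3 : Nonempty (p.out.1 ≃ₗ[R] q.out.1) := rel_inj hP (hR p.out) (hR q.out) e2
    rw [← Quotient.out_eq p, ← Quotient.out_eq q]
    exact Quotient.sound h3
  have hS := Finite.injective_iff_surjective.1 hG
  obtain ⟨N, h1, h2, g, hg⟩ := top_exists (R := R) (S := S)
  obtain ⟨q, hq⟩ := hS (Quotient.mk _ ⟨N, h1, h2⟩)
  obtain ⟨e⟩ : Nonempty ((F q.out).1 ≃ₗ[R] N) := Quotient.exact hq
  have := hT q.out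
  obtain ⟨e'⟩ := uniq (F q.out) ⟨N, h1, h2⟩ _ _ (f q.out) g (hf _) hg e
  exact ⟨_, E q.out, (T q.out).subtype ∘ₗ e'.symm.toLinearMap, hR q.out,
    Subtype.val_injective.comp e'.symm.injective⟩

theorem fact3 (K : Type) [Field K] {R : Type} [Ring R] [Algebra K R] [FiniteDimensional K R]
    {d : ℕ} (hAG : IsAuslanderGorenstein R d) {P : ModuleCat.{0} R}
    (hP : IsMaxProjInjSummand P) {G : ModuleCat.{0} R} (hG : Module.Injective R G)
    (c : Ch (MemAdd P) (d+1) (reg R) G) : Add R (G × P) (Dreg K R) := by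
  have := artin K (R := R)
  have := dreg_finite K (R := R)
  refine add_of_indec fun X hX iX => ?_
  have fX : Module.Finite R X := hX.summ.finite
  have := iX.1
  obtain ⟨S, hS⟩ := soc_exists (R := R) (E := X)
  have := IsSimpleModule.nontrivial R S
  obtain ⟨A, E, u, hR, hu⟩ := simple_embeds K hAG hP S
  obtain ⟨i, hi⟩ := (rel_summ hP hR c).inj_of
  exact Add.of_summ (env_summ iX (hX.summ.injective (dreg_inj K)) (inj_prod hG hP.2.1.2)
    S.subtype Subtype.val_injective (i ∘ₗ u) (hi.comp hu))

end Pigeon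
end PSX

namespace PSX
open PS

theorem add_equiv {R : Type} [Ring R] [IsArtinianRing R] {T C : ModuleCat.{0} R}
    [Module.Finite R T] [Module.Finite R C] (bT : IsBasic T) (bC : IsBasic C)
    (h : Add R C T) (h' : Add R T C) : Nonempty (T ≃ₗ[R] C) := by
  refine mutual_equiv (R := R) (summ_of_basic ?_ fun X _ _ iX hX => iX.add (h.summ hX))
    (summ_of_basic ?_ fun X _ _ iX hX => iX.add (h'.summ hX))
  · exact fun X _ _ hX => bT (ModuleCat.of R X) (isSummand_iff.2 hX)
  · exact fun X _ _ hX => bC (ModuleCat.of R X) (isSummand_iff.2 hX)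

theorem tilt_side (K : Type) [Field K] {R : Type} [Ring R] [Algebra K R] [FiniteDimensional K R]
    {P : ModuleCat.{0} R} (hP : IsMaxProjInjSummand P) {k : ℕ} {T A : ModuleCat.{0} R}
    (hT : IsSpecialTilting P k T) (c : Ch (MemAdd P) k (reg R) A) :
    Add R T (A × P) ∧ Add R (A × P) T := by
  obtain ⟨⟨fT, pT, eT, -⟩, Y, f, hex, h0, hYT, hYP⟩ := hT
  have c' := ch_of_seq hex hYP
  have hPT : Add R T P := by
    have h1 : Summ R P (Y 0) := by rw [h0]; exact isSummand_iff.1 hP.1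
    obtain ⟨i, hi⟩ := h1.inj_of
    obtain ⟨r, hr⟩ := hP.2.1.2.out (f 0 ∘ₗ i) (hex.1.comp hi) LinearMap.id
    exact (memAdd_iff.1 (hYT 1 le_rfl (by omega))).summ ⟨_, r, hr⟩
  rw [h0] at c'
  have ht := memAdd_iff.1 (hYT (k+1) (by omega) le_rfl)
  generalize Y (k+1) = t at c' ht
  have h1 : Add R (t × P) A := c.schanuel hP.2.1 c' Add.fst
  have h2 : Add R (A × P) t := c'.schanuel hP.2.1 c Add.fst
  have h3 : MemAdd (ModuleCat.of R (t × P)) T := by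
    refine tilting_lemma K (k := k) (m := k) (t := t) (fun j hj => ez_of_extZero T T j hj (eT j hj))
      (pd_ez pT) (memAdd_iff.2 (ht.prod hPT)) (memAdd_iff.2 Add.fst) (c'.mono fun Q hQ => ?_)
    exact memAdd_iff.2 (Add.trans (Add.snd : Add R (t × P) P) (memAdd_iff.1 hQ))
  exact ⟨((ht.prod hPT).trans h1).prod hPT, (h2.prod Add.snd).trans (memAdd_iff.1 h3)⟩

theorem cotilt_side (K : Type) [Field K] {R : Type} [Ring R] [Algebra K R] [FiniteDimensional K R]
    {P : ModuleCat.{0} R} (hP : IsMaxProjInjSummand P) {k : ℕ} {T A E : ModuleCat.{0} R}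
    (hT : IsSpecialCotilting K P k T) (c : Ch (MemAdd P) k A E) (hE : Add R (Dreg K R) E)
    (hE' : Add R (E × P) (Dreg K R)) :
    Add R T (A × P) ∧ Add R (A × P) T := by
  obtain ⟨⟨fT, pT, eT, -⟩, Y, f, hex, h0, hYT, hYP⟩ := hT
  have c' := ch_of_seq hex hYP
  have fP := max_finite hP
  have hPT : Add R T P := by
    have h1 : Add R (Y (k+1)) P := by rw [h0]; exact dreg_add K hP.2.1.2
    obtain ⟨n, h1⟩ := h1
    obtain ⟨p, hp⟩ := h1.surj_of
    have hs : Function.Surjective (f k) := hex.2.1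
    have hs' : Function.Surjective (p ∘ₗ (f k).compLeft (Fin n)) := by
      refine hp.comp fun x => ?_
      choose y hy using fun i => hs (x i)
      exact ⟨y, funext hy⟩
    have := hP.2.1.1
    obtain ⟨s, h2⟩ := Module.projective_lifting_property _ LinearMap.id hs'
    exact ((memAdd_iff.1 (hYT k le_rfl)).pi n).summ
      ⟨s, p ∘ₗ (f k).compLeft (Fin n), fun x => LinearMap.congr_fun h2 x⟩
  rw [h0] at c'
  have ht := memAdd_iff.1 (hYT 0 (by omega))
  generalize Y 0 = t at c' ht
  have h1 : Add R (t × P) A := c.schanuel' hP.2.1 c' (Add.fst.trans hE)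
  have h2 : Add R (A × P) t := c'.schanuel' hP.2.1 c hE'
  have h3 : MemAdd (ModuleCat.of R (t × P)) T := by
    refine cotilting_lemma K (k := k) (m := k) (t := t) (D := Dreg K R)
      (fun W fW => dreg_cogen K (R := R) W)
      (fun j hj => ez_of_extZero T T j hj (eT j hj))
      (id_ez pT) (memAdd_iff.2 (ht.prod hPT)) (memAdd_iff.2 Add.fst) (c'.mono fun Q hQ => ?_)
    exact memAdd_iff.2 (Add.trans (Add.snd : Add R (t × P) P) (memAdd_iff.1 hQ))
  exact ⟨((ht.prod hPT).trans h1).prod hPT, (h2.prod Add.snd).trans (memAdd_iff.1 h3)⟩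

theorem main (K : Type) [Field K] (R : Type) [Ring R] [Algebra K R] [FiniteDimensional K R]
    (d : ℕ) (hAG : IsAuslanderGorenstein R d) (P : ModuleCat.{0} R) (hP : IsMaxProjInjSummand P)
    (k : ℕ) (hk : k ≤ d + 1) (T C : ModuleCat.{0} R) (bT : IsBasic T)
    (hT : IsSpecialTilting P k T) (bC : IsBasic C) (hC : IsSpecialCotilting K P (d + 1 - k) C) :
    Nonempty (T ≃ₗ[R] C) := by
  have := artin K (R := R)
  obtain ⟨E, fE, jE, c⟩ := fact1 K hAG hP (reg R) (Summ.refl (R := R) (M := R))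
  have h3 := fact3 K hAG hP jE c
  have hE : Add R (Dreg K R) E := dreg_add K jE
  obtain ⟨m, hm⟩ : ∃ m, d + 1 = k + m := ⟨d + 1 - k, by omega⟩
  have hm' : d + 1 - k = m := by omega
  rw [hm'] at hC
  rw [hm] at c
  obtain ⟨A, c1, c2⟩ := c.split
  obtain ⟨t1, t2⟩ := tilt_side K hP hT c1
  obtain ⟨s1, s2⟩ := cotilt_side K hP hC c2 hE h3
  have := hT.1.1
  have := hC.1.1
  exact add_equiv bT bC (s1.trans t2) (t1.trans s2)

end PSX

open PS in
/-- Proposition `T=C`.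
Let `Γ` be a `d`-Auslander–Gorenstein finite-dimensional algebra.  Then the shifted and
coshifted modules of `Γ` coincide: `T_k ≅ C^{d+1-k}` for all `0 ≤ k ≤ d+1`. -/
theorem statement8 (K : Type) [Field K] (Γ : Type) [Ring Γ] [Algebra K Γ]
    [FiniteDimensional K Γ] (hbasic : IsBasic (reg Γ)) (d : ℕ) (hd : 1 ≤ d)
    (hAG : IsAuslanderGorenstein Γ d)
    (Pii : ModuleCat.{0} Γ) (hPii : IsMaxProjInjSummand Pii) :
    ∀ k, k ≤ d + 1 →
      ∀ T C : ModuleCat.{0} Γ, IsBasic T → IsSpecialTilting Pii k T →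
        IsBasic C → IsSpecialCotilting K Pii (d + 1 - k) C →
        Nonempty (T ≃ₗ[Γ] C) := by
  intro k hk T C bT hT bC hC
  exact PSX.main K Γ d hAG Pii hPii k hk T C bT hT bC hC
end
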